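/- There exist at least 243 imaginary biquadratic fields K (realized as subfields of ℂ; since such fields are Galois over ℚ, subfields of ℂ correspond bijectively to isomorphism classes) with Cl(K) ≅ C₅, at least 274 with Cl(K) ≅ C₅², at least 54 with Cl(K) ≅ C₅³, and at least 1 with Cl(K) ≅ C₅⁴. -/

import Mathlib

open NumberField

/-- An `n`-quadratic field realized as a subfield of `ℂ`: a finite Galois extension of `ℚ`
with Galois group isomorphic to the elementary abelian 2-group of rank `n`. -/
def IsNQuadratic (n : ℕ) (K : IntermediateField ℚ ℂ) : Prop :=
  FiniteDimensional ℚ K ∧ IsGalois ℚ K ∧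
    Nonempty ((K ≃ₐ[ℚ] K) ≃* (Fin n → Multiplicative (ZMod 2)))

/-- A subfield of `ℂ` is imaginary if it is not contained in `ℝ`; for fields that are Galois
over `ℚ` this is equivalent to not being totally real. -/
def IsImaginary (K : IntermediateField ℚ ℂ) : Prop :=
  ∃ x : K, (x : ℂ).im ≠ 0


section
open NumberField Module

section quad
variable {k : Type*} [Field k] [NumberField k]

/-- Data: `k` is a quadratic field generated by a square root of the squarefree integer `d`. -/
structure QF (k : Type*) [Field k] [NumberField k] (d : ℤ) (δ : k) : Prop where
  rank : finrank ℚ k = 2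
  sqf : Squarefree d
  ne1 : d ≠ 1
  sq : δ ^ 2 = (d : k)

variable {d : ℤ} {δ : k}

lemma sqf_not_sq {d : ℤ} (h : Squarefree d) (h1 : d ≠ 1) (q : ℚ) : q ^ 2 ≠ (d : ℚ) := by
  intro hq
  have hi : IsSquare (d : ℚ) := ⟨q, by rw [← hq]; ring⟩
  rw [Rat.isSquare_intCast_iff] at hi
  obtain ⟨r, hr⟩ := hi
  have hu := h r ⟨1, by rw [hr]; ring⟩
  rcases Int.isUnit_iff.mp hu with h' | h' <;> subst h' <;> simp at hr <;> exact h1 hr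

namespace QF

lemma not_rat (h : QF k d δ) (q : ℚ) : algebraMap ℚ k q ≠ δ := by
  intro hq
  have : algebraMap ℚ k (q ^ 2) = algebraMap ℚ k (d : ℚ) := by
    rw [map_pow, hq, h.sq]; simp
  exact sqf_not_sq h.sqf h.ne1 q ((algebraMap ℚ k).injective this)

lemma linInd (h : QF k d δ) : LinearIndependent ℚ ![(1 : k), δ] := by
  rw [LinearIndependent.pair_iff]
  intro s t hst
  have ht : t = 0 := by
    by_contra ht
    apply h.not_rat (-s / t)
    have : algebraMap ℚ k t ≠ 0 := by simpa using ht
    rw [Algebra.smul_def, Algebra.smul_def] at hst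
    rw [map_div₀, map_neg]
    field_simp
    linear_combination -hst
  subst ht
  simpa using hst

noncomputable def basis (h : QF k d δ) : Basis (Fin 2) ℚ k :=
  basisOfLinearIndependentOfCardEqFinrank h.linInd (by simp [h.rank])

lemma basis_zero (h : QF k d δ) : h.basis 0 = 1 := by simp [basis]
lemma basis_one (h : QF k d δ) : h.basis 1 = δ := by simp [basis]

lemma exists_coord (h : QF k d δ) (x : k) : ∃ a b : ℚ, x = (a : k) + (b : k) * δ := by
  refine ⟨h.basis.repr x 0, h.basis.repr x 1, ?_⟩
  conv_lhs => rw [← h.basis.sum_repr x]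
  simp [Fin.sum_univ_two, basis_zero, basis_one, Algebra.smul_def]

lemma coord_inj (h : QF k d δ) {a b a' b' : ℚ} (e : (a : k) + (b : k) * δ = a' + b' * δ) :
    a = a' ∧ b = b' := by
  have := LinearIndependent.pair_iff.mp h.linInd (a - a') (b - b') (by
    simp only [Algebra.smul_def, eq_ratCast]; push_cast; linear_combination e)
  constructor <;> linarith [this.1, this.2]

lemma leftMul (h : QF k d δ) (a b : ℚ) :
    Algebra.leftMulMatrix h.basis ((a : k) + b * δ) = !![a, d * b; b, a] := by
  have e0 : ∀ u v : ℚ, h.basis.repr ((u : k) + v * δ) = Finsupp.equivFunOnFinite.symm ![u, v] := by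
    intro u v
    have : ((u : k) + v * δ) = u • h.basis 0 + v • h.basis 1 := by
      simp [basis_zero, basis_one, Algebra.smul_def]
    rw [this, map_add, map_smul, map_smul, Basis.repr_self, Basis.repr_self]
    ext i
    fin_cases i <;> simp
  ext i j
  rw [Algebra.leftMulMatrix_eq_repr_mul]
  fin_cases j
  · simp only [Fin.zero_eta, basis_zero, mul_one, e0]
    fin_cases i <;> simp
  · have : ((a : k) + b * δ) * δ = ((d * b : ℚ) : k) + (a : ℚ) * δ := by
      push_cast
      linear_combination (b : k) * h.sq
    simp only [Fin.mk_one, basis_one, this, e0]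
    fin_cases i <;> simp

lemma norm_coord (h : QF k d δ) (a b : ℚ) :
    Algebra.norm ℚ ((a : k) + b * δ) = a ^ 2 - d * b ^ 2 := by
  rw [Algebra.norm_eq_matrix_det h.basis, h.leftMul, Matrix.det_fin_two_of]; ring

lemma trace_coord (h : QF k d δ) (a b : ℚ) :
    Algebra.trace ℚ k ((a : k) + b * δ) = 2 * a := by
  rw [Algebra.trace_eq_matrix_trace h.basis, h.leftMul, Matrix.trace_fin_two_of]; ring

lemma int_coord (h : QF k d δ) (x : 𝓞 k) : ∃ X Y : ℤ, 2 * (x : k) = X + Y * δ ∧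
    X ^ 2 - d * Y ^ 2 = 4 * Algebra.norm ℤ x := by
  obtain ⟨a, b, hab⟩ := h.exists_coord (x : k)
  have hn : ((Algebra.norm ℤ x : ℤ) : ℚ) = a ^ 2 - d * b ^ 2 := by
    rw [Algebra.coe_norm_int, hab, h.norm_coord]
  have ht : ((Algebra.trace ℤ (𝓞 k) x : ℤ) : ℚ) = 2 * a := by
    rw [Algebra.coe_trace_int, hab, h.trace_coord]
  set N := Algebra.norm ℤ x
  set T := Algebra.trace ℤ (𝓞 k) x
  -- a norm and trace identity
  have hb : (d : ℚ) * (2 * b) ^ 2 = ((T ^ 2 - 4 * N : ℤ) : ℚ) := by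
    push_cast; rw [hn, ht]; ring
  have hbi : ∃ Y : ℤ, (Y : ℚ) = 2 * b := by
    set c := 2 * b
    have hden : (d : ℚ) * c.num ^ 2 = ((T ^ 2 - 4 * N : ℤ) : ℚ) * c.den ^ 2 := by
      rw [← hb]
      have := Rat.num_div_den c
      have hne : (c.den : ℚ) ≠ 0 := by exact_mod_cast c.den_ne_zero
      rw [div_eq_iff hne] at this
      rw [this]; ring
    have hden' : d * c.num ^ 2 = (T ^ 2 - 4 * N) * (c.den : ℤ) ^ 2 := by exact_mod_cast hden
    have hcop : IsCoprime ((c.den : ℤ) ^ 2) (c.num ^ 2) := by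
      apply IsCoprime.pow
      rw [Int.isCoprime_iff_gcd_eq_one]
      have := c.reduced
      rw [Nat.Coprime, Nat.gcd_comm] at this
      simpa [Int.gcd] using this
    have hdv : (c.den : ℤ) ^ 2 ∣ d := hcop.dvd_of_dvd_mul_right ⟨T ^ 2 - 4 * N, by rw [hden']; ring⟩
    have hu := h.sqf (c.den : ℤ) (by rw [← pow_two]; exact hdv)
    have h1 : c.den = 1 := by
      rcases Int.isUnit_iff.mp hu with h' | h' <;> omega
    exact ⟨c.num, by rw [Rat.den_eq_one_iff] at h1; exact h1⟩
  obtain ⟨Y, hY⟩ := hbi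
  refine ⟨T, Y, ?_, ?_⟩
  · have e1 : (T : k) = 2 * a := by
      have := congrArg (Rat.cast : ℚ → k) ht; push_cast at this; exact this
    have e2 : (Y : k) = 2 * b := by
      have := congrArg (Rat.cast : ℚ → k) hY; push_cast at this; exact this
    rw [hab, e1, e2]; ring
  · have : ((T ^ 2 - d * Y ^ 2 : ℤ) : ℚ) = ((4 * N : ℤ) : ℚ) := by
      push_cast; rw [hn, ht, hY]; ring
    exact_mod_cast this

lemma exists_int (h : QF k d δ) {X Y n : ℤ} (e : X ^ 2 - d * Y ^ 2 = 4 * n) :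
    ∃ x : 𝓞 k, 2 * (x : k) = X + Y * δ ∧ Algebra.norm ℤ x = n := by
  have hisInt : IsIntegral ℤ (((X / 2 : ℚ) : k) + ((Y / 2 : ℚ) : k) * δ) := by
    refine ⟨Polynomial.X ^ 2 - Polynomial.C X * Polynomial.X + Polynomial.C n, ?_, ?_⟩
    · monicity!
    · simp only [Polynomial.eval₂_add, Polynomial.eval₂_sub, Polynomial.eval₂_mul,
        Polynomial.eval₂_pow, Polynomial.eval₂_X, Polynomial.eval₂_C]
      simp only [eq_intCast]
      have e' : (X : k) ^ 2 - d * Y ^ 2 = 4 * n := by exact_mod_cast congrArg (Int.cast : ℤ → k) e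
      push_cast
      linear_combination (Y ^ 2 / 4 : k) * h.sq - e' / 4
  obtain ⟨z, hz⟩ : ∃ z : 𝓞 k, (z : k) = (((X / 2 : ℚ) : k) + ((Y / 2 : ℚ) : k) * δ) :=
    ⟨⟨_, hisInt⟩, rfl⟩
  refine ⟨z, ?_, ?_⟩
  · rw [hz]
    show 2 * (((X / 2 : ℚ) : k) + ((Y / 2 : ℚ) : k) * δ) = _
    push_cast; ring
  · have : ((Algebra.norm ℤ z : ℤ) : ℚ) = (n : ℚ) := by
      rw [Algebra.coe_norm_int, hz, h.norm_coord]
      have e' : (X : ℚ) ^ 2 - d * Y ^ 2 = 4 * n := by exact_mod_cast congrArg (Int.cast : ℤ → ℚ) e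
      linear_combination e' / 4
    exact_mod_cast this

end QF
end quad

end

section
open NumberField Module

section ideals
variable {k : Type*} [Field k] [NumberField k]

/-- The ideal is nonzero and its class lies in `H`. -/
def InH (H : Subgroup (ClassGroup (𝓞 k))) (I : Ideal (𝓞 k)) : Prop :=
  ∃ h : I ∈ nonZeroDivisors (Ideal (𝓞 k)), ClassGroup.mk0 ⟨I, h⟩ ∈ H

lemma InH.ne_bot {H : Subgroup (ClassGroup (𝓞 k))} {I : Ideal (𝓞 k)} (h : InH H I) : I ≠ ⊥ :=
  nonZeroDivisors.ne_zero h.1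

lemma InH.mul {H : Subgroup (ClassGroup (𝓞 k))} {I J : Ideal (𝓞 k)} (hI : InH H I)
    (hJ : InH H J) : InH H (I * J) := by
  obtain ⟨a, ha⟩ := hI
  obtain ⟨b, hb⟩ := hJ
  refine ⟨mul_mem a b, ?_⟩
  have : (⟨I * J, mul_mem a b⟩ : nonZeroDivisors (Ideal (𝓞 k))) = ⟨I, a⟩ * ⟨J, b⟩ := rfl
  rw [this, map_mul]
  exact mul_mem ha hb

lemma InH.of_mul {H : Subgroup (ClassGroup (𝓞 k))} {I J : Ideal (𝓞 k)} (hI : InH H I)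
    (hJ : InH H (I * J)) : InH H J := by
  obtain ⟨a, ha⟩ := hI
  obtain ⟨b, hb⟩ := hJ
  have c : J ∈ nonZeroDivisors (Ideal (𝓞 k)) := by
    rw [mem_nonZeroDivisors_iff_ne_zero] at b ⊢
    exact right_ne_zero_of_mul b
  refine ⟨c, ?_⟩
  have : (⟨I * J, b⟩ : nonZeroDivisors (Ideal (𝓞 k))) = ⟨I, a⟩ * ⟨J, c⟩ := rfl
  rw [this, map_mul] at hb
  exact (H.mul_mem_cancel_left ha).mp hb

lemma InH.principal (H : Subgroup (ClassGroup (𝓞 k))) {x : 𝓞 k} (hx : x ≠ 0) :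
    InH H (Ideal.span {x}) := by
  have h : Ideal.span {x} ∈ nonZeroDivisors (Ideal (𝓞 k)) := by
    rw [mem_nonZeroDivisors_iff_ne_zero]; simpa using hx
  refine ⟨h, ?_⟩
  have : ClassGroup.mk0 ⟨Ideal.span {x}, h⟩ = 1 := by
    rw [ClassGroup.mk0_eq_one_iff]; exact ⟨⟨x, rfl⟩⟩
  rw [this]; exact one_mem H

/-- All primes above `l` have class in `H`. -/
def Good (H : Subgroup (ClassGroup (𝓞 k))) (l : ℕ) : Prop :=
  ∀ P : Ideal (𝓞 k), P ≠ ⊥ → P.IsPrime → (l : 𝓞 k) ∈ P → InH H P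

lemma inH_of_good {H : Subgroup (ClassGroup (𝓞 k))} (I : Ideal (𝓞 k)) (hI : I ≠ ⊥)
    (hg : ∀ r : ℕ, r.Prime → r ∣ Ideal.absNorm I → Good H r) : InH H I := by
  induction I using UniqueFactorizationMonoid.induction_on_prime with
  | h₁ => exact absurd rfl hI
  | h₂ I hI' =>
    obtain rfl : I = ⊤ := by simpa using hI'
    have := InH.principal H (one_ne_zero : (1 : 𝓞 k) ≠ 0)
    simpa using this
  | h₃ J P hJ hP ih =>
    have hPp := Ideal.isPrime_of_prime hP
    have hPm := hPp.isMaximal hP.ne_zero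
    obtain ⟨q, n, hn, hqP, hq, hN⟩ := Ideal.exists_prime_and_absNorm_eq_pow P
    refine InH.mul ?_ (ih hJ ?_)
    · refine hg q hq ?_ P hP.ne_zero hPp hqP
      rw [map_mul, hN]
      exact dvd_mul_of_dvd_left (dvd_pow_self q (by omega)) _
    · intro r hr hd
      exact hg r hr (by rw [map_mul]; exact dvd_mul_of_dvd_right hd _)

lemma natCast_ne_zero_of_prime {l : ℕ} (hl : l.Prime) : (l : 𝓞 k) ≠ 0 := by
  exact_mod_cast hl.ne_zero

lemma finrank_int (hr : finrank ℚ k = 2) : finrank ℤ (𝓞 k) = 2 := by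
  rw [RingOfIntegers.rank, hr]

/-- a prime over `l` has norm `l` or equals `(l)` -/
lemma prime_over (hr : finrank ℚ k = 2) {l : ℕ} (hl : l.Prime) {P : Ideal (𝓞 k)} (hP : P.IsPrime)
    (hlP : (l : 𝓞 k) ∈ P) : (Ideal.absNorm P = l ∧ ∃ P' : Ideal (𝓞 k), Ideal.absNorm P' = l ∧
      Ideal.span {(l : 𝓞 k)} = P * P') ∨ P = Ideal.span {(l : 𝓞 k)} := by
  have hle : Ideal.span {(l : 𝓞 k)} ≤ P := by
    rw [Ideal.span_singleton_le_iff_mem]; exact hlP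
  have hN : Ideal.absNorm (Ideal.span {(l : 𝓞 k)}) = l ^ 2 := by
    rw [Ideal.absNorm_span_natCast, finrank_int hr]
  obtain ⟨P', hP'⟩ := Ideal.dvd_iff_le.mpr hle
  have hmul : Ideal.absNorm P * Ideal.absNorm P' = l ^ 2 := by
    rw [← map_mul, ← hP', hN]
  have hdv : Ideal.absNorm P ∣ l ^ 2 := ⟨_, hmul.symm⟩
  have hpos := hl.pos
  rw [Nat.dvd_prime_pow hl] at hdv
  obtain ⟨i, hi, he⟩ := hdv
  interval_cases i
  · rw [pow_zero, Ideal.absNorm_eq_one_iff] at he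
    exact absurd he hP.ne_top
  · left
    rw [pow_one] at he
    refine ⟨he, P', ?_, hP'⟩
    rw [he, pow_two] at hmul
    exact Nat.eq_of_mul_eq_mul_left hpos hmul
  · right
    rw [he] at hmul
    have h1 : Ideal.absNorm P' = 1 := by
      have : 0 < l ^ 2 := by positivity
      nlinarith
    rw [Ideal.absNorm_eq_one_iff] at h1
    rw [hP', h1, Ideal.mul_top]

lemma isMax_of_norm_prime {l : ℕ} (hl : l.Prime) {P : Ideal (𝓞 k)} (h : Ideal.absNorm P = l) :
    P.IsMaximal := by
  have h1 : P.IsPrime := Ideal.isPrime_of_irreducible_absNorm (by rw [h]; exact hl)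
  refine h1.isMaximal ?_
  rintro rfl
  rw [Ideal.absNorm_bot] at h
  exact hl.ne_zero h.symm

/-- the primes over `l` when `(l)` is a product of two primes -/
lemma over_eq {l : ℕ} (hl : l.Prime) {P P' : Ideal (𝓞 k)}
    (h : Ideal.absNorm P = l) (h' : Ideal.absNorm P' = l)
    (he : Ideal.span {(l : 𝓞 k)} = P * P') {Q : Ideal (𝓞 k)} (hQ : Q.IsPrime)
    (hlQ : (l : 𝓞 k) ∈ Q) : Q = P ∨ Q = P' := by
  have hle : P * P' ≤ Q := by
    rw [← he, Ideal.span_singleton_le_iff_mem]; exact hlQ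
  rcases hQ.mul_le.mp hle with h1 | h1
  · left; exact ((isMax_of_norm_prime hl h).eq_of_le hQ.ne_top h1).symm
  · right; exact ((isMax_of_norm_prime hl h').eq_of_le hQ.ne_top h1).symm

lemma exists_max_dvd {l : ℕ} (hl : l.Prime) (I : Ideal (𝓞 k)) (h : l ∣ Ideal.absNorm I) :
    ∃ P : Ideal (𝓞 k), P.IsMaximal ∧ (l : 𝓞 k) ∈ P ∧ P ∣ I := by
  obtain ⟨P, hP, hu, hd⟩ := Ideal.exists_isMaximal_dvd_of_dvd_absNorm' hl I h
  refine ⟨P, hP, ?_, hd⟩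
  have : (l : ℤ) ∈ P.under ℤ := by rw [hu]; exact Ideal.mem_span_singleton_self _
  simpa [Ideal.mem_comap] using this

lemma good_of_span (H : Subgroup (ClassGroup (𝓞 k))) {l : ℕ} (hl : l.Prime)
    (hm : (Ideal.span {(l : 𝓞 k)}).IsMaximal) : Good H l := by
  intro P hP hPp hlP
  have : Ideal.span {(l : 𝓞 k)} = P :=
    hm.eq_of_le hPp.ne_top (by rw [Ideal.span_singleton_le_iff_mem]; exact hlP)
  rw [← this]
  exact InH.principal H (natCast_ne_zero_of_prime hl)

lemma good_of_norm {H : Subgroup (ClassGroup (𝓞 k))} (hr : finrank ℚ k = 2) {l m : ℕ}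
    (hl : l.Prime) (hm : m ≠ 0) (x : 𝓞 k) (hx : (Algebra.norm ℤ x).natAbs = l * m)
    (hg : ∀ r : ℕ, r.Prime → r ∣ m → Good H r) : Good H l := by
  have hN : Ideal.absNorm (Ideal.span {x}) = l * m := by rw [Ideal.absNorm_span_singleton, hx]
  have hx0 : x ≠ 0 := by
    rintro rfl
    have : l * m = 0 := by rw [← hx]; simp
    rcases Nat.mul_eq_zero.mp this with h | h
    · exact hl.ne_zero h
    · exact hm h
  obtain ⟨P, hP, hlP, J, hJ⟩ := exists_max_dvd hl (Ideal.span {x}) (by rw [hN]; exact dvd_mul_right _ _)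
  rcases prime_over hr hl hP.isPrime hlP with ⟨h1, P', h2, h3⟩ | h1
  · have hJN : Ideal.absNorm J = m := by
      rw [hJ, map_mul, h1] at hN
      exact Nat.eq_of_mul_eq_mul_left hl.pos hN
    have hJ0 : J ≠ ⊥ := by
      rintro rfl; rw [Ideal.absNorm_bot] at hJN; exact hm hJN.symm
    have hJH : InH H J := inH_of_good J hJ0 (by rw [hJN]; exact hg)
    have hPH : InH H P := by
      apply InH.of_mul hJH
      rw [mul_comm, ← hJ]; exact InH.principal H hx0
    have hPH' : InH H P' := by
      apply InH.of_mul hPH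
      rw [← h3]; exact InH.principal H (natCast_ne_zero_of_prime hl)
    intro Q hQ hQp hlQ
    rcases over_eq hl h1 h2 h3 hQp hlQ with rfl | rfl <;> assumption
  · apply good_of_span H hl
    rw [← h1]; exact hP

/-- norm-`l` primes have residue field generated by integers -/
lemma residue_int {l : ℕ} (hl : l.Prime) {P : Ideal (𝓞 k)} (h : Ideal.absNorm P = l) (x : 𝓞 k) :
    ∃ n : ℕ, x - n ∈ P := by
  have hc : Nat.card (𝓞 k ⧸ P) = l := h
  have : Fact l.Prime := ⟨hl⟩
  have hgen : AddSubgroup.zmultiples (1 : 𝓞 k ⧸ P) = ⊤ := by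
    apply zmultiples_eq_top_of_prime_card hc
    have hm := isMax_of_norm_prime hl h
    have : Nontrivial (𝓞 k ⧸ P) := Ideal.Quotient.nontrivial_iff.mpr hm.ne_top
    exact one_ne_zero
  have hx : (Ideal.Quotient.mk P x) ∈ AddSubgroup.zmultiples (1 : 𝓞 k ⧸ P) := by rw [hgen]; trivial
  obtain ⟨z, hz⟩ := AddSubgroup.mem_zmultiples_iff.mp hx
  have hlP : (l : 𝓞 k) ∈ P := by rw [← h]; exact Ideal.absNorm_mem P
  refine ⟨(z % l).toNat, ?_⟩
  rw [← Ideal.Quotient.eq_zero_iff_mem]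
  have hl0 : ((l : ℤ) : 𝓞 k ⧸ P) = 0 := by
    have := Ideal.Quotient.eq_zero_iff_mem.mpr hlP
    simpa using this
  have hnn : 0 ≤ z % l := Int.emod_nonneg _ (by exact_mod_cast hl.ne_zero)
  have e : (((z % l).toNat : ℕ) : 𝓞 k ⧸ P) = (z : 𝓞 k ⧸ P) := by
    rw [← Int.cast_natCast, Int.toNat_of_nonneg hnn]
    conv_rhs => rw [← Int.emod_add_mul_ediv z l]
    push_cast
    have : ((l : ℕ) : 𝓞 k ⧸ P) = 0 := by simpa using hl0
    rw [this]; ring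
  rw [map_sub, map_natCast, e, ← hz]
  simp

lemma norm_dvd_of_mem {P : Ideal (𝓞 k)} {x : 𝓞 k} {l : ℕ} (h : Ideal.absNorm P = l) (hx : x ∈ P) :
    (l : ℤ) ∣ Algebra.norm ℤ x := by
  rw [← h]; exact Ideal.absNorm_dvd_norm_of_mem hx

/-- if some integral element has `N (x - n)` never divisible by `l` then `l` is inert -/
lemma good_inert (H : Subgroup (ClassGroup (𝓞 k))) (hr : finrank ℚ k = 2) {l : ℕ} (hl : l.Prime)
    (x : 𝓞 k) (hx : ∀ n : ℕ, ¬ (l : ℤ) ∣ Algebra.norm ℤ (x - n)) : Good H l := by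
  intro P hP hPp hlP
  rcases prime_over hr hl hPp hlP with ⟨h1, -⟩ | h1
  · obtain ⟨n, hn⟩ := residue_int hl h1 x
    exact absurd (norm_dvd_of_mem h1 hn) (hx n)
  · rw [h1]; exact InH.principal H (natCast_ne_zero_of_prime hl)

/-- if `l ∈ P^2` for primes over `l` then `P^2 = (l)`-/
lemma good_ram (S : Subgroup (ClassGroup (𝓞 k))) (hr : finrank ℚ k = 2) {l : ℕ} (hl : l.Prime)
    (hx : ∀ P : Ideal (𝓞 k), P.IsPrime → (l : 𝓞 k) ∈ P → (l : 𝓞 k) ∈ P * P) :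
    Good (S.comap (powMonoidHom 2)) l := by
  intro P hP hPp hlP
  rcases prime_over hr hl hPp hlP with ⟨h1, P', h2, h3⟩ | h1
  · have hm' := isMax_of_norm_prime hl h2
    have hle : P * P' ≤ P * P := by
      rw [← h3, Ideal.span_singleton_le_iff_mem]; exact hx P hPp hlP
    have : P' ≤ P := by
      rw [← Ideal.dvd_iff_le] at hle ⊢
      exact (mul_dvd_mul_iff_left hP).mp hle
    have he : P' = P := hm'.eq_of_le hPp.ne_top this
    rw [he] at h3
    have hnz : P ∈ nonZeroDivisors (Ideal (𝓞 k)) := by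
      rw [mem_nonZeroDivisors_iff_ne_zero]; exact hP
    refine ⟨hnz, ?_⟩
    obtain ⟨a, ha⟩ := InH.principal S (natCast_ne_zero_of_prime (k := k) hl)
    rw [Subgroup.mem_comap]
    have e : (⟨Ideal.span {(l : 𝓞 k)}, a⟩ : nonZeroDivisors (Ideal (𝓞 k))) = ⟨P, hnz⟩ * ⟨P, hnz⟩ :=
      Subtype.ext h3
    rw [e, map_mul] at ha
    simpa [pow_two] using ha
  · rw [h1]; exact InH.principal _ (natCast_ne_zero_of_prime hl)

end ideals

end

section
open NumberField Module

section quad2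
variable {k : Type*} [Field k] [NumberField k] {d : ℤ} {δ : k}
lemma oext {x y : 𝓞 k} (h : algebraMap (𝓞 k) k x = algebraMap (𝓞 k) k y) : x = y :=
  RingOfIntegers.coe_injective h

namespace QF

lemma half (h : QF k d δ) {x : 𝓞 k} {X Y : ℤ} (e : 2 * (x : k) = X + Y * δ) :
    (x : k) = ((X / 2 : ℚ) : k) + ((Y / 2 : ℚ) : k) * δ := by
  have := h.sq
  push_cast
  linear_combination e / 2

lemma norm_of (h : QF k d δ) {x : 𝓞 k} {X Y : ℤ} (e : 2 * (x : k) = X + Y * δ) :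
    X ^ 2 - d * Y ^ 2 = 4 * Algebra.norm ℤ x := by
  have : ((X ^ 2 - d * Y ^ 2 : ℤ) : ℚ) = ((4 * Algebra.norm ℤ x : ℤ) : ℚ) := by
    push_cast
    rw [Algebra.coe_norm_int, h.half e, h.norm_coord]; ring
  exact_mod_cast this

lemma trace_of (h : QF k d δ) {x : 𝓞 k} {X Y : ℤ} (e : 2 * (x : k) = X + Y * δ) :
    Algebra.trace ℤ (𝓞 k) x = X := by
  have : ((Algebra.trace ℤ (𝓞 k) x : ℤ) : ℚ) = (X : ℚ) := by
    rw [Algebra.coe_trace_int, h.half e, h.trace_coord]; ring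
  exact_mod_cast this

lemma exists_sqrt (h : QF k d δ) : ∃ x : 𝓞 k, (x : k) = δ := by
  obtain ⟨x, hx, -⟩ := h.exists_int (X := 0) (Y := 2) (n := -d) (by ring)
  refine ⟨x, ?_⟩
  push_cast at hx
  linear_combination hx / 2

lemma exists_omega (h : QF k d δ) (h1 : d % 4 = 1) : ∃ x : 𝓞 k, 2 * (x : k) = 1 + δ := by
  obtain ⟨x, hx, -⟩ := h.exists_int (X := 1) (Y := 1) (n := (1 - d) / 4) (by omega)
  exact ⟨x, by simpa using hx⟩

lemma good_of_rep (h : QF k d δ) {H : Subgroup (ClassGroup (𝓞 k))} {l m : ℕ} (hl : l.Prime)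
    (hm : m ≠ 0) {X Y : ℤ} (e : (X ^ 2 - d * Y ^ 2).natAbs = 4 * (l * m))
    (hg : ∀ r : ℕ, r.Prime → r ∣ m → Good H r) : Good H l := by
  obtain ⟨n, hn⟩ : (4 : ℤ) ∣ X ^ 2 - d * Y ^ 2 := by
    rw [← Int.natAbs_dvd_natAbs, e]; exact dvd_mul_right _ _
  obtain ⟨x, -, hx⟩ := h.exists_int hn
  refine good_of_norm h.rank hl hm x ?_ hg
  rw [hx]
  rw [hn, Int.natAbs_mul] at e
  simp at e
  exact e

lemma good_inert_odd (h : QF k d δ) (H : Subgroup (ClassGroup (𝓞 k))) {l : ℕ} (hl : l.Prime)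
    (h2 : l ≠ 2) (he : (d : ZMod l) ^ ((l - 1) / 2) = -1) : Good H l := by
  obtain ⟨x, hx⟩ := h.exists_sqrt
  have : Fact l.Prime := ⟨hl⟩
  have hodd : l % 2 = 1 := by
    rcases hl.eq_two_or_odd with h | h
    · exact absurd h h2
    · exact h
  have : Fact (2 < l) := ⟨by have := hl.two_le; omega⟩
  refine good_inert H h.rank hl x ?_
  intro n hn
  have e : 2 * ((x - n : 𝓞 k) : k) = ((-2 * n : ℤ) : k) + ((2 : ℤ) : k) * δ := by
    push_cast; linear_combination 2 * hx
  have e2 := h.norm_of e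
  have e3 : Algebra.norm ℤ (x - (n : 𝓞 k)) = n ^ 2 - d := by linarith
  rw [e3] at hn
  have e4 : (d : ZMod l) = (n : ZMod l) ^ 2 := by
    have := (ZMod.intCast_zmod_eq_zero_iff_dvd _ l).mpr hn
    push_cast at this
    linear_combination -this
  rw [e4, ← pow_mul, show 2 * ((l - 1) / 2) = l - 1 by omega] at he
  by_cases hz : (n : ZMod l) = 0
  · rw [hz, zero_pow (by have := hl.two_le; omega)] at he
    have : (1 : ZMod l) = 0 := by linear_combination he
    exact one_ne_zero this
  · rw [ZMod.pow_card_sub_one_eq_one hz] at he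
    exact ZMod.neg_one_ne_one he.symm

lemma good_inert_two (h : QF k d δ) (H : Subgroup (ClassGroup (𝓞 k))) (h5 : d % 8 = 5) :
    Good H 2 := by
  obtain ⟨x, hx⟩ := h.exists_omega (by omega)
  refine good_inert H h.rank Nat.prime_two x ?_
  intro n hn
  have e : 2 * ((x - n : 𝓞 k) : k) = ((1 - 2 * n : ℤ) : k) + ((1 : ℤ) : k) * δ := by
    push_cast
    linear_combination hx
  have e2 := h.norm_of e
  obtain ⟨t, ht⟩ := hn
  rw [ht] at e2
  push_cast at e2
  have : ((n : ℤ) * (n + 1)) % 2 = 0 := Int.even_iff.mp (Int.even_mul_succ_self _)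
  have e3 : (1 - 2 * (n : ℤ)) ^ 2 = 4 * ((n : ℤ) * (n + 1)) - 8 * n + 1 := by ring
  rw [e3] at e2
  omega

lemma good_ram_dvd (h : QF k d δ) (S : Subgroup (ClassGroup (𝓞 k))) {r : ℕ} (hr : r.Prime)
    (hd : (r : ℤ) ∣ d) : Good (S.comap (powMonoidHom 2)) r := by
  apply good_ram S h.rank hr
  intro P hP hrP
  obtain ⟨x, hx⟩ := h.exists_sqrt
  have hx2 : x * x = (d : 𝓞 k) := by
    apply oext
    rw [map_mul, map_intCast, ← h.sq, pow_two]
    exact congrArg₂ _ hx hx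
  obtain ⟨e, he⟩ := hd
  have hdP : (d : 𝓞 k) ∈ P := by
    rw [he]; push_cast; exact Ideal.mul_mem_right _ _ hrP
  have hxP : x ∈ P := by
    rw [← hx2] at hdP
    rcases hP.mem_or_mem hdP with h | h <;> exact h
  have hcop : IsCoprime (r : ℤ) e := by
    rw [Int.isCoprime_iff_gcd_eq_one]
    have hg : ¬ (r : ℤ) ∣ e := by
      rintro ⟨f, hf⟩
      have hu := h.sqf r ⟨f, by rw [he, hf]; ring⟩
      have := Int.isUnit_iff.mp hu
      have := hr.two_le
      omega
    have := (Nat.Prime.coprime_iff_not_dvd hr).mpr (fun hh => hg (Int.natCast_dvd.mpr hh))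
    simpa [Int.gcd] using this
  obtain ⟨u, v, huv⟩ := hcop
  have : (r : 𝓞 k) = (u : 𝓞 k) * (r * r) + v * (x * x) := by
    rw [hx2, he]
    have : (1 : 𝓞 k) = u * r + v * e := by exact_mod_cast congrArg (Int.cast : ℤ → 𝓞 k) huv.symm
    push_cast
    linear_combination (r : 𝓞 k) * this
  rw [this]
  exact add_mem (Ideal.mul_mem_left _ _ (Ideal.mul_mem_mul hrP hrP))
    (Ideal.mul_mem_left _ _ (Ideal.mul_mem_mul hxP hxP))

lemma good_ram_two (h : QF k d δ) (S : Subgroup (ClassGroup (𝓞 k)))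
    (hd : d % 4 = 3) : Good (S.comap (powMonoidHom 2)) 2 := by
  apply good_ram S h.rank Nat.prime_two
  intro P hP hrP
  obtain ⟨x, hx⟩ := h.exists_sqrt
  have hx2 : x * x = (d : 𝓞 k) := by
    apply oext
    rw [map_mul, map_intCast, ← h.sq, pow_two]
    exact congrArg₂ _ hx hx
  obtain ⟨e, he⟩ : ∃ e, d = 4 * e + 3 := ⟨d / 4, by omega⟩
  have hdP : (x + 1) * (x + 1) ∈ P := by
    have : (x + 1) * (x + 1) = ((2 : ℕ) : 𝓞 k) * (2 * e + 2 + x) := by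
      have : (d : 𝓞 k) = 4 * e + 3 := by exact_mod_cast congrArg (Int.cast : ℤ → 𝓞 k) he
      push_cast
      linear_combination hx2 + this
    rw [this]; exact Ideal.mul_mem_right _ _ hrP
  have hxP : x + 1 ∈ P := by
    rcases hP.mem_or_mem hdP with h | h <;> exact h
  have : ((2 : ℕ) : 𝓞 k) = (x + 1) * (x + 1) - ((2 : ℕ) : 𝓞 k) * (x + 1)
      - e * (((2 : ℕ) : 𝓞 k) * ((2 : ℕ) : 𝓞 k)) := by
    have : (d : 𝓞 k) = 4 * e + 3 := by exact_mod_cast congrArg (Int.cast : ℤ → 𝓞 k) he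
    push_cast
    linear_combination - hx2 - this
  rw [this]
  exact sub_mem (sub_mem (Ideal.mul_mem_mul hxP hxP) (Ideal.mul_mem_mul hrP hxP))
    (Ideal.mul_mem_left _ _ (Ideal.mul_mem_mul hrP hrP))

lemma discr_le (h : QF k d δ) {w : 𝓞 k} {X Y : ℤ} (e : 2 * (w : k) = X + Y * δ) (hY : Y ≠ 0) :
    |(discr k : ℝ)| ≤ |(d * Y ^ 2 : ℝ)| := by
  let b0 := RingOfIntegers.basis k
  have hc : Fintype.card (Free.ChooseBasisIndex ℤ (𝓞 k)) = Fintype.card (Fin 2) := by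
    rw [← finrank_eq_card_basis b0, finrank_int h.rank]; simp
  let b : Basis (Fin 2) ℤ (𝓞 k) := b0.reindex (Fintype.equivOfCardEq hc)
  have hb : Algebra.discr ℤ b = discr k := NumberField.discr_eq_discr k b
  have hv : Algebra.discr ℤ ![(1 : 𝓞 k), w] = d * Y ^ 2 := by
    have e2 : 2 * ((w * w : 𝓞 k) : k) = (((X ^ 2 + d * Y ^ 2) / 2 : ℚ) : k) + ((X * Y : ℚ) : k) * δ := by
      push_cast
      linear_combination (2 * (w : k) + X + Y * δ) / 2 * e + (Y : k) ^ 2 / 2 * h.sq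
    have t2 : ((Algebra.trace ℤ (𝓞 k) (w * w) : ℤ) : ℚ) = (X ^ 2 + d * Y ^ 2) / 2 := by
      have : ((w * w : 𝓞 k) : k) = (((X ^ 2 + d * Y ^ 2) / 4 : ℚ) : k) + ((X * Y / 2 : ℚ) : k) * δ := by
        push_cast at e2 ⊢
        linear_combination e2 / 2
      rw [Algebra.coe_trace_int, this, h.trace_coord]; ring
    have t1 : Algebra.trace ℤ (𝓞 k) w = X := h.trace_of e
    have t0 : Algebra.trace ℤ (𝓞 k) 1 = 2 := by
      apply h.trace_of (Y := 0); simp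
    rw [Algebra.discr_def, Matrix.det_fin_two]
    simp only [Algebra.traceMatrix_apply, Algebra.traceForm_apply]
    simp only [Matrix.cons_val_zero, Matrix.cons_val_one, mul_one, one_mul, t0, t1]
    have : ((2 * Algebra.trace ℤ (𝓞 k) (w * w) - X * X : ℤ) : ℚ) = ((d * Y ^ 2 : ℤ) : ℚ) := by
      push_cast; rw [t2]; ring
    exact_mod_cast this
  have hmat : Algebra.discr ℤ ![(1 : 𝓞 k), w] = (b.toMatrix ![(1 : 𝓞 k), w]).det ^ 2 * discr k := by
    rw [← hb, ← Algebra.discr_of_matrix_vecMul b, Basis.toMatrix_map_vecMul]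
  rw [hv] at hmat
  have hne : (b.toMatrix ![(1 : 𝓞 k), w]).det ≠ 0 := by
    intro h0
    rw [h0] at hmat
    have : d * Y ^ 2 = 0 := by rw [hmat]; ring
    rcases mul_eq_zero.mp this with h1 | h1
    · exact h.sqf.ne_zero h1
    · exact hY (pow_eq_zero_iff (by norm_num) |>.mp h1)
  have h1 : (1 : ℤ) ≤ (b.toMatrix ![(1 : 𝓞 k), w]).det ^ 2 := by
    have := sq_nonneg (b.toMatrix ![(1 : 𝓞 k), w]).det
    have h3 : (b.toMatrix ![(1 : 𝓞 k), w]).det ^ 2 ≠ 0 := pow_ne_zero 2 hne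
    omega
  have h2 : |discr k| ≤ |d * Y ^ 2| := by
    rw [hmat, abs_mul, abs_pow, sq_abs]
    nlinarith [abs_nonneg (discr k)]
  exact_mod_cast h2

lemma discr_le' (h : QF k d δ) : |(discr k : ℝ)| ≤ |((if d % 4 = 1 then d else 4 * d : ℤ) : ℝ)| := by
  split_ifs with h1
  · obtain ⟨x, hx⟩ := h.exists_omega h1
    have := h.discr_le (w := x) (X := 1) (Y := 1) (by simpa using hx) one_ne_zero
    simpa using this
  · obtain ⟨x, hx⟩ := h.exists_sqrt
    have := h.discr_le (w := x) (X := 0) (Y := 2) (by rw [hx]; simp) two_ne_zero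
    refine this.trans (le_of_eq ?_)
    push_cast; congr 1; ring

lemma totallyReal (h : QF k d δ) (hd : 0 < d) : IsTotallyReal k := by
  refine ⟨fun v => ?_⟩
  rw [InfinitePlace.isReal_iff, ComplexEmbedding.isReal_iff]
  ext x
  rw [ComplexEmbedding.conjugate_coe_eq]
  obtain ⟨a, b, rfl⟩ := h.exists_coord x
  have hs : (starRingEnd ℂ) (v.embedding δ) = v.embedding δ := by
    have : (v.embedding δ) ^ 2 = ((d : ℝ) : ℂ) := by
      rw [← map_pow, h.sq]; simp
    have h2 : (v.embedding δ) ^ 2 = ((Real.sqrt d : ℝ) : ℂ) ^ 2 := by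
      rw [this, ← Complex.ofReal_pow, Real.sq_sqrt (by exact_mod_cast hd.le)]
    rcases sq_eq_sq_iff_eq_or_eq_neg.mp h2 with h | h <;> rw [h] <;> simp
  simp [hs]

lemma top_of_good (h : QF k d δ) {H : Subgroup (ClassGroup (𝓞 k))} {B : ℕ}
    (hM : (4 / Real.pi) ^ InfinitePlace.nrComplexPlaces k * (1 / 2 *
      Real.sqrt |((if d % 4 = 1 then d else 4 * d : ℤ) : ℝ)|) < B + 1)
    (hg : ∀ l : ℕ, l.Prime → l ≤ B → Good H l) : H = ⊤ := by
  rw [eq_top_iff]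
  intro c _
  obtain ⟨I, rfl, hI⟩ := exists_ideal_in_class_of_norm_le c
  have hle : Ideal.absNorm (I : Ideal (𝓞 k)) ≤ B := by
    have h2 : ((Ideal.absNorm (I : Ideal (𝓞 k)) : ℕ) : ℝ) < B + 1 := by
      refine lt_of_le_of_lt (hI.trans ?_) hM
      rw [h.rank]
      have h1 := Real.sqrt_le_sqrt h.discr_le'
      have h3 : (0 : ℝ) ≤ (4 / Real.pi) ^ InfinitePlace.nrComplexPlaces k := by positivity
      have : ((Nat.factorial 2 : ℕ) : ℝ) / ((2 : ℕ) : ℝ) ^ 2 = 1 / 2 := by norm_num [Nat.factorial]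
      rw [this]
      apply mul_le_mul_of_nonneg_left _ h3
      linarith
    have : Ideal.absNorm (I : Ideal (𝓞 k)) < B + 1 := by exact_mod_cast h2
    omega
  have hpos : 0 < Ideal.absNorm (I : Ideal (𝓞 k)) := Ideal.absNorm_pos_of_nonZeroDivisors I
  obtain ⟨_, hc⟩ := inH_of_good (H := H) (I : Ideal (𝓞 k)) (nonZeroDivisors.coe_ne_zero I)
    (fun r hr hd => hg r hr ((Nat.le_of_dvd hpos hd).trans hle))
  exact hc

lemma top_real (h : QF k d δ) (hd : 0 < d) {H : Subgroup (ClassGroup (𝓞 k))} {B : ℕ}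
    (hB : (if d % 4 = 1 then d else 4 * d : ℤ) < 4 * (B + 1) ^ 2)
    (hg : ∀ l : ℕ, l.Prime → l ≤ B → Good H l) : H = ⊤ := by
  have hR := h.totallyReal hd
  refine h.top_of_good ?_ hg
  rw [IsTotallyReal.nrComplexPlaces_eq_zero, pow_zero, one_mul]
  set D := (if d % 4 = 1 then d else 4 * d : ℤ)
  have hD : 0 < D := by simp only [D]; split_ifs <;> omega
  have hB' : (D : ℝ) < 4 * (B + 1) ^ 2 := by exact_mod_cast hB
  rw [abs_of_pos (by exact_mod_cast hD)]
  have : Real.sqrt D < 2 * (B + 1) := by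
    rw [Real.sqrt_lt' (by positivity)]; linarith
  linarith

lemma top_imag (h : QF k d δ) {H : Subgroup (ClassGroup (𝓞 k))} {B : ℕ}
    (hB : 4 * |(if d % 4 = 1 then d else 4 * d : ℤ)| < 9 * (B + 1) ^ 2)
    (hg : ∀ l : ℕ, l.Prime → l ≤ B → Good H l) : H = ⊤ := by
  refine h.top_of_good ?_ hg
  set D := (if d % 4 = 1 then d else 4 * d : ℤ)
  have hc : InfinitePlace.nrComplexPlaces k ≤ 1 := by
    have := InfinitePlace.card_add_two_mul_card_eq_rank k
    rw [h.rank] at this; omega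
  have hB' : 4 * |(D : ℝ)| < 9 * (B + 1) ^ 2 := by exact_mod_cast hB
  have h1 : Real.sqrt |(D : ℝ)| < 3 / 2 * (B + 1) := by
    rw [Real.sqrt_lt' (by positivity)]; nlinarith
  have hpi := Real.pi_gt_three
  have h2 : (4 / Real.pi) ^ InfinitePlace.nrComplexPlaces k ≤ 4 / 3 := by
    have h3 : 4 / Real.pi ≤ 4 / 3 := by gcongr
    rcases Nat.le_one_iff_eq_zero_or_eq_one.mp hc with h5 | h5 <;> rw [h5]
    · norm_num
    · rw [pow_one]; exact h3
  have h4 := Real.sqrt_nonneg |(D : ℝ)|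
  calc _ ≤ 4 / 3 * (1 / 2 * Real.sqrt |(D : ℝ)|) := by gcongr
    _ < _ := by linarith

end QF
end quad2

end

section
open NumberField Module

section gens
variable {k : Type*} [Field k] [NumberField k] {d : ℤ} {δ : k}

/-- `g` is a class with `g^5=1` of a prime of norm `q`; its inverse is the class of the other prime. -/
structure Gen (q : ℕ) (g : ClassGroup (𝓞 k)) : Prop where
  pow5 : g ^ 5 = 1
  ex : ∃ Q Q' : nonZeroDivisors (Ideal (𝓞 k)), Ideal.absNorm (Q : Ideal (𝓞 k)) = q ∧
    Ideal.absNorm (Q' : Ideal (𝓞 k)) = q ∧ ClassGroup.mk0 Q = g ∧ ClassGroup.mk0 Q' = g⁻¹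
  good : ∀ S : Subgroup (ClassGroup (𝓞 k)), g ∈ S → Good S q

lemma eq_pow_of_norm {q : ℕ} (hq : q.Prime) {Q : Ideal (𝓞 k)} (hQ : Ideal.absNorm Q = q) (n : ℕ) :
    ∀ J : Ideal (𝓞 k), Ideal.absNorm J = q ^ n →
    (∀ P : Ideal (𝓞 k), P.IsPrime → (q : 𝓞 k) ∈ P → P ∣ J → P = Q) → J = Q ^ n := by
  induction n with
  | zero =>
    intro J hJ _
    rw [pow_zero, Ideal.absNorm_eq_one_iff] at hJ
    rw [hJ, pow_zero, Ideal.one_eq_top]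
  | succ n ih =>
    intro J hJ hP
    obtain ⟨P, hPm, hqP, hPJ⟩ := exists_max_dvd hq J (by rw [hJ]; exact dvd_pow_self q (by omega))
    obtain rfl := hP P hPm.isPrime hqP hPJ
    obtain ⟨J', rfl⟩ := hPJ
    rw [map_mul, hQ, pow_succ'] at hJ
    have := ih J' (Nat.eq_of_mul_eq_mul_left hq.pos hJ)
      (fun P' h1 h2 h3 => hP P' h1 h2 (dvd_mul_of_dvd_right h3 _))
    rw [pow_succ', ← this]

lemma QF.exists_gen (h : QF k d δ) {q : ℕ} (hq : q.Prime) {X Y : ℤ}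
    (hX : ¬ (q : ℤ) ∣ X) (e : (X ^ 2 - d * Y ^ 2).natAbs = 4 * q ^ 5) :
    ∃ g : ClassGroup (𝓞 k), Gen q g ∧ ∃ c : 𝓞 k, 2 * (c : k) = X + Y * δ ∧
      (g = 1 → ∃ (x : 𝓞 k) (u : (𝓞 k)ˣ), x ^ 5 = c * u) := by
  obtain ⟨n, hn⟩ : (4 : ℤ) ∣ X ^ 2 - d * Y ^ 2 := by
    rw [← Int.natAbs_dvd_natAbs, e]; exact dvd_mul_right _ _
  obtain ⟨c, hc, hcn⟩ := h.exists_int hn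
  have hN : Ideal.absNorm (Ideal.span {c}) = q ^ 5 := by
    rw [Ideal.absNorm_span_singleton, hcn]
    rw [hn, Int.natAbs_mul] at e
    simp at e
    exact e
  have hnd : ¬ Ideal.span {(q : 𝓞 k)} ∣ Ideal.span {c} := by
    rw [Ideal.dvd_iff_le, Ideal.span_singleton_le_span_singleton]
    rintro ⟨b, rfl⟩
    apply hX
    have ht := h.trace_of hc
    rw [← ht, ← nsmul_eq_mul, map_nsmul, nsmul_eq_mul]
    exact ⟨_, rfl⟩
  obtain ⟨Q, hQm, hqQ, J, hJ⟩ := exists_max_dvd hq (Ideal.span {c})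
    (by rw [hN]; exact dvd_pow_self q (by omega))
  rcases prime_over h.rank hq hQm.isPrime hqQ with ⟨h1, Q', h2, h3⟩ | h1
  swap
  · exact absurd ⟨J, by rw [← h1]; exact hJ⟩ hnd
  have hJ4 : Ideal.absNorm J = q ^ 4 := by
    rw [hJ, map_mul, h1, show q ^ 5 = q * q ^ 4 by ring] at hN
    exact Nat.eq_of_mul_eq_mul_left hq.pos hN
  have hJQ : J = Q ^ 4 := by
    apply eq_pow_of_norm hq h1 4 J hJ4
    intro P hP hqP hPJ
    rcases over_eq hq h1 h2 h3 hP hqP with rfl | rfl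
    · rfl
    · exfalso; apply hnd
      rw [h3, hJ]; exact mul_dvd_mul_left _ hPJ
  have hQ5 : Ideal.span {c} = Q ^ 5 := by rw [hJ, hJQ]; ring
  have nz : ∀ P : Ideal (𝓞 k), Ideal.absNorm P = q → P ∈ nonZeroDivisors (Ideal (𝓞 k)) := by
    intro P hP
    rw [← Ideal.absNorm_ne_zero_iff_mem_nonZeroDivisors, hP]; exact hq.ne_zero
  have hcz : c ≠ 0 := by
    rintro rfl
    apply hnd; simp
  set QQ : nonZeroDivisors (Ideal (𝓞 k)) := ⟨Q, nz Q h1⟩ with hQQ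
  set QQ' : nonZeroDivisors (Ideal (𝓞 k)) := ⟨Q', nz Q' h2⟩ with hQQ'
  have hg5 : (ClassGroup.mk0 QQ) ^ 5 = 1 := by
    rw [← map_pow, ClassGroup.mk0_eq_one_iff]
    refine ⟨⟨c, ?_⟩⟩
    rw [SubmonoidClass.coe_pow]
    exact hQ5.symm
  have hinv : ClassGroup.mk0 QQ' = (ClassGroup.mk0 QQ)⁻¹ := by
    rw [eq_inv_iff_mul_eq_one, ← map_mul, ClassGroup.mk0_eq_one_iff]
    refine ⟨⟨(q : 𝓞 k), ?_⟩⟩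
    rw [Submonoid.coe_mul, mul_comm]
    exact h3.symm
  refine ⟨ClassGroup.mk0 QQ, ⟨hg5, ⟨QQ, QQ', h1, h2, rfl, hinv⟩, ?_⟩, c, hc, ?_⟩
  · intro S hS P hP hPp hqP
    rcases over_eq hq h1 h2 h3 hPp hqP with rfl | rfl
    · exact ⟨_, hS⟩
    · exact ⟨nz _ h2, by rw [hinv]; exact inv_mem hS⟩
  · intro h1
    rw [ClassGroup.mk0_eq_one_iff] at h1
    obtain ⟨⟨x, hx⟩⟩ := h1
    have hx' : Q = Ideal.span {x} := hx
    rw [hx', Ideal.span_singleton_pow, Ideal.span_singleton_eq_span_singleton] at hQ5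
    obtain ⟨u, hu⟩ := hQ5
    exact ⟨x, u, hu.symm⟩

lemma pow_val_add {G : Type*} [Group G] {g : G} (h : g ^ 5 = 1) (a b : ZMod 5) :
    g ^ (a + b).val = g ^ a.val * g ^ b.val := by
  rw [ZMod.val_add, ← pow_add]
  conv_rhs => rw [← Nat.mod_add_div (a.val + b.val) 5, pow_add, pow_mul, h, one_pow, mul_one]

/-- The homomorphism from `C_5^r` determined by elements of exponent five. -/
def psi {G : Type*} [CommGroup G] {r : ℕ} (g : Fin r → G) (h : ∀ i, g i ^ 5 = 1) :
    (Fin r → Multiplicative (ZMod 5)) →* G where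
  toFun f := ∏ i, g i ^ (Multiplicative.toAdd (f i)).val
  map_one' := by simp
  map_mul' f f' := by
    rw [← Finset.prod_mul_distrib]
    refine Finset.prod_congr rfl fun i _ => ?_
    rw [Pi.mul_apply, toAdd_mul, pow_val_add (h i)]

lemma mem_psi {G : Type*} [CommGroup G] {r : ℕ} (g : Fin r → G) (h : ∀ i, g i ^ 5 = 1) (i : Fin r) :
    g i ∈ (psi g h).range := by
  refine ⟨Pi.mulSingle i (Multiplicative.ofAdd 1), ?_⟩
  show ∏ j, g j ^ (Multiplicative.toAdd ((Pi.mulSingle i (Multiplicative.ofAdd 1) :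
    Fin r → Multiplicative (ZMod 5)) j)).val = _
  rw [Finset.prod_eq_single i]
  · rw [Pi.mulSingle_eq_same, toAdd_ofAdd, show (1 : ZMod 5).val = 1 from rfl, pow_one]
  · intro j _ hj
    rw [Pi.mulSingle_eq_of_ne hj]; simp
  · simp

lemma psi_inj_zero {G : Type*} [CommGroup G] (g : Fin 0 → G) (h : ∀ i, g i ^ 5 = 1) :
    Function.Injective (psi g h) := fun _ _ _ => Subsingleton.elim _ _

lemma psi_inj_one {G : Type*} [CommGroup G] (g : Fin 1 → G) (h : ∀ i, g i ^ 5 = 1) (h0 : g 0 ≠ 1) :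
    Function.Injective (psi g h) := by
  rw [injective_iff_map_eq_one]
  intro f hf
  have hf' : ∏ i, g i ^ (Multiplicative.toAdd (f i)).val = 1 := hf
  rw [Fin.prod_univ_one] at hf'
  have : Fact (Nat.Prime 5) := ⟨Nat.prime_five⟩
  have ho : orderOf (g 0) = 5 := orderOf_eq_prime (h 0) h0
  have hd := orderOf_dvd_of_pow_eq_one hf'
  rw [ho] at hd
  have hlt := ZMod.val_lt (Multiplicative.toAdd (f 0))
  have : (Multiplicative.toAdd (f 0)).val = 0 := by omega
  rw [ZMod.val_eq_zero] at this
  ext i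
  obtain rfl : i = 0 := Subsingleton.elim _ _
  exact this

lemma psi_inj_two {G : Type*} [CommGroup G] (g : Fin 2 → G) (h : ∀ i, g i ^ 5 = 1)
    (h0 : ∀ c < 5, g 0 * g 1 ^ c ≠ 1) (h1 : g 1 ≠ 1) :
    Function.Injective (psi g h) := by
  rw [injective_iff_map_eq_one]
  intro f hf
  have hf' : ∏ i, g i ^ (Multiplicative.toAdd (f i)).val = 1 := hf
  rw [Fin.prod_univ_two] at hf'
  have ha := ZMod.val_lt (Multiplicative.toAdd (f 0))
  have hb := ZMod.val_lt (Multiplicative.toAdd (f 1))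
  suffices hs : (Multiplicative.toAdd (f 0)).val = 0 ∧ (Multiplicative.toAdd (f 1)).val = 0 by
    rw [ZMod.val_eq_zero, ZMod.val_eq_zero] at hs
    ext i
    fin_cases i
    · exact hs.1
    · exact hs.2
  generalize (Multiplicative.toAdd (f 0)).val = a at *
  generalize (Multiplicative.toAdd (f 1)).val = b at *
  by_contra hab
  have hpm : ∀ (i : Fin 2) (n : ℕ), g i ^ n = g i ^ (n % 5) := by
    intro i n
    conv_lhs => rw [← Nat.mod_add_div n 5, pow_add, pow_mul, h i, one_pow, mul_one]
  have key : ∀ m : ℕ, g 0 ^ ((a * m) % 5) * g 1 ^ ((b * m) % 5) = 1 := by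
    intro m
    rw [← hpm, ← hpm, pow_mul, pow_mul, ← mul_pow, hf', one_pow]
  by_cases ha0 : a = 0
  · subst ha0
    obtain ⟨m, hm⟩ : ∃ m, (b * m) % 5 = 1 := by
      have : b ≠ 0 := by rintro rfl; exact hab ⟨rfl, rfl⟩
      interval_cases b
      · exact absurd rfl this
      · exact ⟨1, rfl⟩
      · exact ⟨3, rfl⟩
      · exact ⟨2, rfl⟩
      · exact ⟨4, rfl⟩
    have := key m
    rw [hm] at this
    simp at this
    exact h1 this
  · obtain ⟨m, hm⟩ : ∃ m, (a * m) % 5 = 1 := by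
      interval_cases a
      · exact absurd rfl ha0
      · exact ⟨1, rfl⟩
      · exact ⟨3, rfl⟩
      · exact ⟨2, rfl⟩
      · exact ⟨4, rfl⟩
    have := key m
    rw [hm, pow_one] at this
    exact h0 _ (Nat.mod_lt _ (by norm_num)) this

/-- no element of norm `n` in an imaginary field: ideals of norm `n` are not principal -/
lemma QF.mk0_ne_one (h : QF k d δ) (hd : d < 0) {n : ℕ} (hn : ∀ X Y : ℤ, X ^ 2 - d * Y ^ 2 ≠ 4 * n)
    (I : nonZeroDivisors (Ideal (𝓞 k))) (hI : Ideal.absNorm (I : Ideal (𝓞 k)) = n) :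
    ClassGroup.mk0 I ≠ 1 := by
  intro h1
  rw [ClassGroup.mk0_eq_one_iff] at h1
  obtain ⟨⟨x, hx⟩⟩ := h1
  have hx' : (I : Ideal (𝓞 k)) = Ideal.span {x} := hx
  rw [hx', Ideal.absNorm_span_singleton] at hI
  obtain ⟨X, Y, -, e⟩ := h.int_coord x
  apply hn X Y
  rw [e, ← hI]
  have : 0 ≤ 4 * Algebra.norm ℤ x := by rw [← e]; nlinarith [sq_nonneg X, sq_nonneg Y]
  omega

/-- class group statement for a quadratic field : an injective homomorphism from `C_5^r`
whose range contains all squares -/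
def SqC5 (k : Type*) [Field k] [NumberField k] (r : ℕ) : Prop :=
  ∃ ψ : (Fin r → Multiplicative (ZMod 5)) →* ClassGroup (𝓞 k), Function.Injective ψ ∧
    ∀ c, c ^ 2 ∈ ψ.range

/-- The class group is `C_5^r`. -/
def IsC5 (k : Type*) [Field k] [NumberField k] (r : ℕ) : Prop :=
  ∃ ψ : (Fin r → Multiplicative (ZMod 5)) →* ClassGroup (𝓞 k), Function.Injective ψ ∧
    ∀ c, c ∈ ψ.range

lemma IsC5.sq {r : ℕ} (h : IsC5 k r) : SqC5 k r := by
  obtain ⟨ψ, h1, h2⟩ := h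
  exact ⟨ψ, h1, fun c => h2 _⟩

lemma QF.imag_two_inj (h : QF k d δ) (hd : d < 0) {g : Fin 2 → ClassGroup (𝓞 k)} {q : Fin 2 → ℕ}
    (hg : ∀ i, Gen (q i) (g i))
    (h0 : ∀ X Y : ℤ, X ^ 2 - d * Y ^ 2 ≠ 4 * (q 0 : ℕ))
    (h1 : ∀ X Y : ℤ, X ^ 2 - d * Y ^ 2 ≠ 4 * (q 1 : ℕ))
    (h2 : ∀ X Y : ℤ, X ^ 2 - d * Y ^ 2 ≠ 4 * (q 0 * q 1 : ℕ))
    (h3 : ∀ X Y : ℤ, X ^ 2 - d * Y ^ 2 ≠ 4 * (q 0 * (q 1 * q 1) : ℕ)) :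
    Function.Injective (psi g (fun i => (hg i).pow5)) := by
  obtain ⟨A, A', hA, hA', cA, cA'⟩ := (hg 0).ex
  obtain ⟨C, C', hC, hC', cC, cC'⟩ := (hg 1).ex
  have p5 := (hg 1).pow5
  apply psi_inj_two
  · intro c hc
    interval_cases c
    · rw [pow_zero, mul_one, ← cA]; exact h.mk0_ne_one hd h0 A hA
    · rw [pow_one, ← cA, ← cC, ← map_mul]
      exact h.mk0_ne_one hd h2 _ (by rw [Submonoid.coe_mul, map_mul, hA, hC])
    · rw [pow_two, ← cA, ← cC, ← map_mul, ← map_mul]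
      exact h.mk0_ne_one hd h3 _ (by rw [Submonoid.coe_mul, Submonoid.coe_mul, map_mul, map_mul, hA, hC])
    · have : g 1 ^ 3 = (g 1)⁻¹ * (g 1)⁻¹ := by
        rw [← mul_inv, eq_inv_iff_mul_eq_one, ← pow_two, ← pow_add]; exact p5
      rw [this, ← cA, ← cC', ← map_mul, ← map_mul]
      exact h.mk0_ne_one hd h3 _ (by rw [Submonoid.coe_mul, Submonoid.coe_mul, map_mul, map_mul, hA, hC'])
    · have : g 1 ^ 4 = (g 1)⁻¹ := by
        rw [eq_inv_iff_mul_eq_one, ← pow_succ]; exact p5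
      rw [this, ← cA, ← cC', ← map_mul]
      exact h.mk0_ne_one hd h2 _ (by rw [Submonoid.coe_mul, map_mul, hA, hC'])
  · rw [← cC]; exact h.mk0_ne_one hd h1 C hC

end gens

end

section
open NumberField Module

section realchar
variable {k : Type*} [Field k] [NumberField k] {d : ℤ} {δ : k}

lemma QF.exists_char (h : QF k d δ) {r : ℕ} (hr : r.Prime) (h2 : r ≠ 2) {ρ : ZMod r}
    (hρ : ρ ^ 2 = (d : ZMod r)) : ∃ e : 𝓞 k →* ZMod r, ∀ (x : 𝓞 k) (X Y : ℤ),
      2 * (x : k) = X + Y * δ → 2 * e x = X + Y * ρ := by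
  have : Fact r.Prime := ⟨hr⟩
  have two : (2 : ZMod r) ≠ 0 := by
    intro h0
    have : ((2 : ℕ) : ZMod r) = 0 := by exact_mod_cast h0
    rw [ZMod.natCast_eq_zero_iff] at this
    exact h2 ((Nat.prime_dvd_prime_iff_eq hr Nat.prime_two).mp this)
  choose X Y hXY hN using h.int_coord
  have uniq : ∀ (x : 𝓞 k) (X' Y' : ℤ), 2 * (x : k) = X' + Y' * δ → X' = X x ∧ Y' = Y x := by
    intro x X' Y' e
    have e2 : ((X' : ℚ) : k) + ((Y' : ℚ) : k) * δ = ((X x : ℚ) : k) + ((Y x : ℚ) : k) * δ := by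
      push_cast; rw [← e, ← hXY]
    have := h.coord_inj e2
    exact_mod_cast this
  refine ⟨⟨⟨fun x => (X x + Y x * ρ) / 2, ?_⟩, ?_⟩, ?_⟩
  · obtain ⟨a, b⟩ := uniq 1 2 0 (by simp)
    rw [← a, ← b]; push_cast; field_simp; ring
  · intro x y
    have e3 : (2 * X (x * y) = X x * X y + d * Y x * Y y) ∧ 2 * Y (x * y) = X x * Y y + X y * Y x := by
      have e : (((2 * X (x * y) : ℤ) : ℚ) : k) + (((2 * Y (x * y) : ℤ) : ℚ) : k) * δ =
          (((X x * X y + d * Y x * Y y : ℤ) : ℚ) : k) + (((X x * Y y + X y * Y x : ℤ) : ℚ) : k) * δ := by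
        have e1 := hXY x
        have e2 := hXY y
        have e3 := hXY (x * y)
        have e4 : ((x * y : 𝓞 k) : k) = (x : k) * (y : k) := by push_cast; rfl
        rw [e4] at e3
        push_cast
        linear_combination (-2) * e3 + (2 * (y : k)) * e1 + (X x + Y x * δ) * e2 +
          (Y x * Y y : k) * h.sq
      have := h.coord_inj e
      exact_mod_cast this
    have a1 : (2 * X (x * y) : ZMod r) = X x * X y + d * Y x * Y y := by exact_mod_cast congrArg (Int.cast : ℤ → ZMod r) e3.1
    have a2 : (2 * Y (x * y) : ZMod r) = X x * Y y + X y * Y x := by exact_mod_cast congrArg (Int.cast : ℤ → ZMod r) e3.2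
    show ((X (x * y) : ZMod r) + Y (x * y) * ρ) / 2 = (X x + Y x * ρ) / 2 * ((X y + Y y * ρ) / 2)
    field_simp
    linear_combination a1 + ρ * a2 - (Y x * Y y : ZMod r) * hρ
  · intro x X' Y' e
    obtain ⟨a, b⟩ := uniq x X' Y' e
    show 2 * (((X x : ZMod r) + Y x * ρ) / 2) = _
    rw [a, b]; field_simp

lemma QF.real_not_pow (h : QF k d δ) (hd : 0 < d) {c : 𝓞 k} {X Y U V : ℤ}
    (hc : 2 * (c : k) = X + Y * δ) (hU : (U ^ 2 - d * V ^ 2).natAbs = 4)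
    {r s : ℕ} (hr : r.Prime) (hs : s.Prime) (hr5 : r % 10 = 1) (hs5 : s % 10 = 1)
    {ρ : ZMod r} {σ : ZMod s} (hρ : ρ ^ 2 = d) (hσ : σ ^ 2 = d)
    {E C : ZMod r} {F : ZMod s} (hE : 2 * E = U + V * ρ) (hC : 2 * C = X + Y * ρ)
    (hF : 2 * F = U + V * σ) (h0 : C ≠ 0)
    (h1 : E ^ ((r - 1) / 5) = 1) (h2 : C ^ ((r - 1) / 5) ≠ 1)
    (h3 : F ^ ((s - 1) / 5) ≠ 1) :
    ¬ ∃ (x : 𝓞 k) (u : (𝓞 k)ˣ), x ^ 5 = c * u := by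
  rintro ⟨x, u, hxu⟩
  have : Fact r.Prime := ⟨hr⟩
  have : Fact s.Prime := ⟨hs⟩
  have hR := h.totallyReal hd
  have tw : ∀ {r : ℕ}, r.Prime → r % 10 = 1 → (2 : ZMod r) ≠ 0 := by
    intro r hr h5 h0
    have : ((2 : ℕ) : ZMod r) = 0 := by exact_mod_cast h0
    rw [ZMod.natCast_eq_zero_iff] at this
    have := (Nat.prime_dvd_prime_iff_eq hr Nat.prime_two).mp this
    omega
  obtain ⟨e, he⟩ := h.exists_char hr (by omega) hρ
  obtain ⟨f, hf⟩ := h.exists_char hs (by omega) hσ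
  have t2 := tw hr hr5
  have s2 := tw hs hs5
  have hec : e c = C := mul_left_cancel₀ t2 ((he _ _ _ hc).trans hC.symm)
  -- the unit
  obtain ⟨n, hn⟩ : (4 : ℤ) ∣ U ^ 2 - d * V ^ 2 := by
    rw [← Int.natAbs_dvd_natAbs, hU]; rfl
  obtain ⟨y, hy, hyn⟩ := h.exists_int hn
  have hn1 : IsUnit n := by
    rw [Int.isUnit_iff_natAbs_eq]
    rw [hn, Int.natAbs_mul] at hU
    simp at hU; omega
  have hyu : IsUnit y := by
    rw [← Ideal.span_singleton_eq_top, ← Ideal.absNorm_eq_one_iff, Ideal.absNorm_span_singleton, hyn]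
    exact Int.isUnit_iff_natAbs_eq.mp hn1
  obtain ⟨w, hw⟩ := hyu
  have hey : e y = E := mul_left_cancel₀ t2 ((he _ _ _ hy).trans hE.symm)
  have hfy : f y = F := mul_left_cancel₀ s2 ((hf _ _ _ hy).trans hF.symm)
  -- Dirichlet
  have hrank : Units.rank k = 1 := by
    have := InfinitePlace.card_eq_nrRealPlaces_add_nrComplexPlaces k
    rw [IsTotallyReal.nrComplexPlaces_eq_zero, ← IsTotallyReal.finrank, h.rank] at this
    rw [Units.rank, this]
  let ε : (𝓞 k)ˣ := Units.fundSystem k ⟨0, by omega⟩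
  have htors : ∀ ζ : (𝓞 k)ˣ, ζ ∈ Units.torsion k → ζ = 1 ∨ ζ = -1 := by
    intro ζ hζ
    have hv : Nonempty (InfinitePlace k) := inferInstance
    obtain ⟨v⟩ := hv
    have hvr := hR.isReal v
    have h1 := (Units.mem_torsion k).mp hζ v
    have e1 := InfinitePlace.norm_embedding_of_isReal hvr (ζ : k)
    rw [h1, Real.norm_eq_abs, abs_eq zero_le_one] at e1
    rcases e1 with e1 | e1
    · left
      ext
      apply (InfinitePlace.embedding_of_isReal hvr).injective
      rw [e1]; simp
    · right
      ext
      apply (InfinitePlace.embedding_of_isReal hvr).injective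
      rw [e1]; simp
  have hunit : ∀ z : (𝓞 k)ˣ, ∃ m : ℤ, z = ε ^ m ∨ z = - ε ^ m := by
    intro z
    obtain ⟨⟨ζ, m⟩, hz, -⟩ := Units.exist_unique_eq_mul_prod k z
    refine ⟨m ⟨0, by omega⟩, ?_⟩
    have : ∏ i, Units.fundSystem k i ^ (m i) = ε ^ (m ⟨0, by omega⟩) := by
      apply Fintype.prod_eq_single
      intro j hj
      exfalso; apply hj
      ext; have := j.2; simp; omega
    simp only at hz
    rw [this] at hz
    rcases htors ζ ζ.2 with h | h
    · left; rw [hz, h, one_mul]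
    · right; rw [hz, h, neg_one_mul]
  -- characters on units
  have hchar : ∀ {r : ℕ} [Fact r.Prime] (hr5 : r % 10 = 1) (e : 𝓞 k →* ZMod r) (z : (𝓞 k)ˣ) (m : ℤ),
      (z = ε ^ m ∨ z = - ε ^ m) →
      (e z) ^ ((r - 1) / 5) = ((e ε) ^ ((r - 1) / 5)) ^ m := by
    intro r _ hr5 e z m hz
    have hE : ∀ z : (𝓞 k)ˣ, e z = (Units.map e z : (ZMod r)ˣ) := fun z => rfl
    have key : (e z) ^ ((r - 1) / 5) = (e ((ε ^ m : (𝓞 k)ˣ) : 𝓞 k)) ^ ((r - 1) / 5) := by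
      rcases hz with h | h
      · rw [h]
      · have hev : Even ((r - 1) / 5) := by
          rw [Nat.even_iff]; omega
        have : (z : 𝓞 k) = (-1) * ((ε ^ m : (𝓞 k)ˣ) : 𝓞 k) := by rw [h]; simp
        rw [this, map_mul, mul_pow]
        have h11 : e (-1) ^ ((r - 1) / 5) = 1 := by
          obtain ⟨t, ht⟩ := hev
          rw [ht, pow_add, ← mul_pow, ← map_mul]; simp
        rw [h11, one_mul]
    rw [key, hE, map_zpow, hE]
    simp only [← Units.val_pow_eq_pow_val, ← Units.val_zpow_eq_zpow_val]
    congr 1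
    rw [← zpow_natCast, ← zpow_mul, ← zpow_natCast (Units.map e ε), ← zpow_mul, mul_comm]
  obtain ⟨m, hm⟩ := hunit w
  obtain ⟨l, hl⟩ := hunit u
  -- (fy)^..≠1 gives 5 ∤ m
  have h5m : ¬ (5 : ℤ) ∣ m := by
    rintro ⟨t, ht⟩
    apply h3
    rw [← hfy, ← hw, hchar hs5 f w m hm, ht, zpow_mul]
    have hfe : f ε ≠ 0 := by
      have hE : f ε = (Units.map f ε : (ZMod s)ˣ) := rfl
      rw [hE]; exact Units.ne_zero _
    have : (f ε ^ ((s - 1) / 5)) ^ (5 : ℤ) = 1 := by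
      rw [show (5 : ℤ) = ((5 : ℕ) : ℤ) from rfl, zpow_natCast, ← pow_mul,
        show (s - 1) / 5 * 5 = s - 1 by omega]
      exact ZMod.pow_card_sub_one_eq_one hfe
    rw [this, one_zpow]
  have hee0 : e ε ≠ 0 := by
    have hE : e ε = (Units.map e ε : (ZMod r)ˣ) := rfl
    rw [hE]; exact Units.ne_zero _
  set t := e ε ^ ((r - 1) / 5) with ht
  have ht5 : t ^ (5 : ℤ) = 1 := by
    rw [show (5 : ℤ) = ((5 : ℕ) : ℤ) from rfl, zpow_natCast, ht, ← pow_mul,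
        show (r - 1) / 5 * 5 = r - 1 by omega]
    exact ZMod.pow_card_sub_one_eq_one hee0
  have htm : t ^ m = 1 := by
    rw [ht, ← hchar hr5 e w m hm, hw, hey]; exact h1
  have ht0 : t ≠ 0 := pow_ne_zero _ hee0
  have ht1 : t = 1 := by
    have hcop : IsCoprime (5 : ℤ) m := by
      rw [Prime.coprime_iff_not_dvd (by norm_num)]; exact h5m
    obtain ⟨a, b, hab⟩ := hcop
    have : t = t ^ (a * 5 + b * m) := by rw [hab, zpow_one]
    rw [this, zpow_add₀ ht0, mul_comm a, mul_comm b, zpow_mul, zpow_mul, ht5, htm]; simp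
  have hu1 : (e u) ^ ((r - 1) / 5) = 1 := by
    rw [hchar hr5 e u l hl, ← ht, ht1, one_zpow]
  apply h2
  rw [← hec]
  have hex : e x ≠ 0 := by
    intro hz
    have := congrArg e hxu
    rw [map_pow, hz, map_mul, zero_pow (by norm_num)] at this
    have hE : e u = (Units.map e u : (ZMod r)ˣ) := rfl
    rcases mul_eq_zero.mp this.symm with h | h
    · exact h0 (hec ▸ h)
    · rw [hE] at h; exact Units.ne_zero _ h
  have := congrArg (fun z => z ^ ((r - 1) / 5)) (congrArg e hxu)
  simp only [map_pow, map_mul, mul_pow, hu1, mul_one] at this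
  rw [← this, ← pow_mul, show 5 * ((r - 1) / 5) = r - 1 by omega]
  exact ZMod.pow_card_sub_one_eq_one hex

end realchar

end

section
open NumberField Module

section galois
variable {K : Type*} [Field K] [NumberField K]

/-- The induced automorphism of the ring of integers. -/
noncomputable def sg (σ : K ≃ₐ[ℚ] K) : 𝓞 K ≃+* 𝓞 K := RingOfIntegers.mapRingEquiv σ.toRingEquiv

lemma sg_coe (σ : K ≃ₐ[ℚ] K) (x : 𝓞 K) : ((sg σ x : 𝓞 K) : K) = σ (x : K) := rfl

/-- The image of an ideal. -/
noncomputable def simg (σ : K ≃ₐ[ℚ] K) (I : Ideal (𝓞 K)) : Ideal (𝓞 K) :=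
  I.map (sg σ : 𝓞 K →+* 𝓞 K)

lemma simg_mul (σ : K ≃ₐ[ℚ] K) (I J : Ideal (𝓞 K)) : simg σ (I * J) = simg σ I * simg σ J :=
  Ideal.map_mul _ _ _

lemma mem_simg (σ : K ≃ₐ[ℚ] K) (I : Ideal (𝓞 K)) {x : 𝓞 K} (h : x ∈ I) : sg σ x ∈ simg σ I :=
  Ideal.mem_map_of_mem _ h

lemma simg_span (σ : K ≃ₐ[ℚ] K) (x : 𝓞 K) :
    simg σ (Ideal.span {x}) = Ideal.span {sg σ x} := by
  rw [simg, Ideal.map_span, Set.image_singleton]; rfl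

lemma simg_simg (σ τ : K ≃ₐ[ℚ] K) (I : Ideal (𝓞 K)) : simg σ (simg τ I) = simg (σ * τ) I := by
  rw [simg, simg, simg, Ideal.map_map]; rfl

lemma simg_one (I : Ideal (𝓞 K)) : simg 1 I = I := by
  have : ((sg (1 : K ≃ₐ[ℚ] K)) : 𝓞 K →+* 𝓞 K) = RingHom.id _ := by
    ext x; rfl
  rw [simg, this, Ideal.map_id]

lemma simg_ne_bot (σ : K ≃ₐ[ℚ] K) {I : Ideal (𝓞 K)} (h : I ≠ ⊥) : simg σ I ≠ ⊥ := by
  rw [simg, Ne, Ideal.map_eq_bot_iff_of_injective]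
  · exact h
  · exact (sg σ).injective

lemma absNorm_simg (σ : K ≃ₐ[ℚ] K) (I : Ideal (𝓞 K)) :
    Ideal.absNorm (simg σ I) = Ideal.absNorm I := by
  have h := Ideal.relNorm_map_algEquiv (R := ℤ) (S := 𝓞 K) (T := 𝓞 K)
    ({ (sg σ) with commutes' := by intro r; simp } : 𝓞 K ≃ₐ[ℤ] 𝓞 K) I
  have h2 := congrArg Ideal.absNorm h
  rw [Ideal.absNorm_relNorm, Ideal.absNorm_relNorm] at h2
  exact h2

/-- Equality of ideals from inclusion and norms. -/
lemma eq_of_le_norm {I J : Ideal (𝓞 K)} (hJ : J ≠ ⊥) (h : I ≤ J)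
    (hn : Ideal.absNorm I = Ideal.absNorm J) : I = J := by
  obtain ⟨C, rfl⟩ := Ideal.dvd_iff_le.mpr h
  rw [map_mul] at hn
  have hz : Ideal.absNorm J ≠ 0 := by rwa [Ne, Ideal.absNorm_eq_zero_iff]
  have : Ideal.absNorm C = 1 := by
    have : Ideal.absNorm J * Ideal.absNorm C = Ideal.absNorm J * 1 := by rw [hn, mul_one]
    exact Nat.eq_of_mul_eq_mul_left (Nat.pos_of_ne_zero hz) this
  rw [Ideal.absNorm_eq_one_iff] at this
  rw [this, Ideal.mul_top]

variable {k : Type*} [Field k] [NumberField k] [Algebra k K]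

/-- `K` is a quadratic extension of `k` with nontrivial automorphism `σ`. -/
structure QE (k : Type*) {K : Type*} [Field K] [NumberField K] [Field k] [NumberField k]
    [Algebra k K] (σ : K ≃ₐ[ℚ] K) : Prop where
  rank : finrank k K = 2
  nrm : ∀ x : K, algebraMap k K (Algebra.norm k x) = x * σ x

variable (k) in
/-- Relative norm of ideals. -/
noncomputable def rN (I : Ideal (𝓞 K)) : Ideal (𝓞 k) := Ideal.relNorm (𝓞 k) I

/-- Extension of ideals. -/
noncomputable def ext (K : Type*) [Field K] [NumberField K] {k : Type*} [Field k] [NumberField k]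
    [Algebra k K] (I : Ideal (𝓞 k)) : Ideal (𝓞 K) := I.map (algebraMap (𝓞 k) (𝓞 K))

lemma QE.rank' {σ : K ≃ₐ[ℚ] K} (h : QE k σ) : finrank (𝓞 k) (𝓞 K) = 2 := by
  rw [← h.rank]
  exact (IsFractionRing.finrank_eq (𝓞 k) k (𝓞 K) K).symm

lemma absNorm_rN (I : Ideal (𝓞 K)) : Ideal.absNorm (rN k I) = Ideal.absNorm I :=
  Ideal.absNorm_relNorm _ _ I

lemma QE.absNorm_ext {σ : K ≃ₐ[ℚ] K} (h : QE k σ) (I : Ideal (𝓞 k)) :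
    Ideal.absNorm (ext K I) = Ideal.absNorm I ^ 2 := by
  rw [ext, Ideal.absNorm_algebraMap, h.rank']

lemma QE.rN_ext {σ : K ≃ₐ[ℚ] K} (h : QE k σ) (I : Ideal (𝓞 k)) : rN k (ext K I) = I ^ 2 := by
  rw [rN, ext, Ideal.relNorm_algebraMap, h.rank']

lemma coe_intNorm (x : 𝓞 K) :
    ((Algebra.intNorm (𝓞 k) (𝓞 K) x : 𝓞 k) : k) = Algebra.norm k (x : K) :=
  Algebra.algebraMap_intNorm (A := 𝓞 k) (K := k) (B := 𝓞 K) (L := K) x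

lemma QE.algebraMap_intNorm {σ : K ≃ₐ[ℚ] K} (h : QE k σ) (x : 𝓞 K) :
    algebraMap (𝓞 k) (𝓞 K) (Algebra.intNorm (𝓞 k) (𝓞 K) x) = x * sg σ x := by
  apply RingOfIntegers.ext
  have : ((algebraMap (𝓞 k) (𝓞 K) (Algebra.intNorm (𝓞 k) (𝓞 K) x) : 𝓞 K) : K)
      = algebraMap k K ((Algebra.intNorm (𝓞 k) (𝓞 K) x : 𝓞 k) : k) := rfl
  rw [this, coe_intNorm, h.nrm]
  rfl

/-- The relative norm, extended back, is `I * σ I`. -/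
lemma QE.ext_rN {σ : K ≃ₐ[ℚ] K} (h : QE k σ) (I : Ideal (𝓞 K)) :
    ext K (rN k I) = I * simg σ I := by
  by_cases hI : I = ⊥
  · subst hI
    rw [rN, Ideal.relNorm_bot, ext, Ideal.map_bot, Ideal.bot_mul]
  apply eq_of_le_norm (mul_ne_zero hI (simg_ne_bot σ hI))
  · rw [rN, ext, Ideal.map_relNorm, Ideal.span_le]
    rintro _ ⟨x, hx, rfl⟩
    simp only [Function.comp_apply, SetLike.mem_coe]
    rw [h.algebraMap_intNorm]
    exact Ideal.mul_mem_mul hx (mem_simg σ I hx)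
  · rw [h.absNorm_ext, absNorm_rN, map_mul, absNorm_simg, sq]

lemma rN_mul (I J : Ideal (𝓞 K)) : rN k (I * J) = rN k I * rN k J := map_mul _ _ _

lemma rN_span (x : 𝓞 K) : rN k (Ideal.span {x}) = Ideal.span {Algebra.intNorm (𝓞 k) (𝓞 K) x} :=
  Ideal.relNorm_singleton _ x

lemma rN_ne_bot {I : Ideal (𝓞 K)} (h : I ≠ ⊥) : rN k I ≠ ⊥ := by
  rwa [rN, Ne, Ideal.relNorm_eq_bot_iff]

lemma ext_mul (I J : Ideal (𝓞 k)) : ext K (I * J) = ext K I * ext K J := Ideal.map_mul _ _ _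

lemma ext_span (x : 𝓞 k) : ext K (Ideal.span {x}) = Ideal.span {algebraMap (𝓞 k) (𝓞 K) x} := by
  rw [ext, Ideal.map_span, Set.image_singleton]

lemma ext_ne_bot {I : Ideal (𝓞 k)} (h : I ≠ ⊥) : ext K I ≠ ⊥ := by
  rw [ext, Ne, Ideal.map_eq_bot_iff_of_injective]
  · exact h
  · exact FaithfulSMul.algebraMap_injective _ _

variable {k' : Type*} [Field k'] [NumberField k'] [Algebra k' K]

/-- Extension followed by norm to another quadratic subfield. -/
lemma QE.rN_ext_other {σ τ : K ≃ₐ[ℚ] K} (h : QE k σ) (h' : QE k' τ)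
    (hn : ∀ x : k', Algebra.norm k (algebraMap k' K x) = algebraMap ℚ k (Algebra.norm ℚ x))
    (hr : finrank ℚ k = 2) (J : Ideal (𝓞 k')) :
    rN k (ext K J) = Ideal.span {((Ideal.absNorm J : ℕ) : 𝓞 k)} := by
  by_cases hJ : J = ⊥
  · subst hJ
    rw [rN, ext, Ideal.map_bot, Ideal.relNorm_bot]
    simp
  symm
  apply eq_of_le_norm (rN_ne_bot (ext_ne_bot hJ))
  · rw [Ideal.span_singleton_le_iff_mem]
    have h1 : ((Ideal.absNorm J : ℕ) : ℤ) ∈ Ideal.relNorm ℤ J := by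
      rw [Ideal.relNorm_int]; exact Ideal.mem_span_singleton_self _
    have h2 : Ideal.relNorm ℤ J ≤ (rN k (ext K J)).comap (algebraMap ℤ (𝓞 k)) := by
      rw [Ideal.relNorm_apply, Ideal.span_le]
      rintro _ ⟨x, hx, rfl⟩
      simp only [SetLike.mem_coe, Ideal.mem_comap]
      have : algebraMap ℤ (𝓞 k) (Algebra.intNorm ℤ (𝓞 k') x)
        = Algebra.intNorm (𝓞 k) (𝓞 K) (algebraMap (𝓞 k') (𝓞 K) x) := by
        apply RingOfIntegers.ext
        rw [coe_intNorm]
        have h3 : ((algebraMap (𝓞 k') (𝓞 K) x : 𝓞 K) : K) = algebraMap k' K (x : k') := rfl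
        rw [h3, hn, ← Algebra.algebraMap_intNorm (A := ℤ) (B := 𝓞 k') (K := ℚ) (L := k')]
        simp
      rw [this]
      have : Ideal.span {algebraMap (𝓞 k') (𝓞 K) x} ≤ ext K J := by
        rw [Ideal.span_singleton_le_iff_mem]
        exact Ideal.mem_map_of_mem _ hx
      have := Ideal.relNorm_mono (R := 𝓞 k) this
      rw [Ideal.relNorm_singleton, Ideal.span_singleton_le_iff_mem] at this
      exact this
    have := h2 h1
    simpa using this
  · rw [absNorm_rN, h'.absNorm_ext, Ideal.absNorm_span_singleton]
    have : ((Ideal.absNorm J : ℕ) : 𝓞 k) = algebraMap ℤ (𝓞 k) (Ideal.absNorm J : ℤ) := by simp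
    rw [this, Algebra.norm_algebraMap, finrank_int hr]
    simp [Int.natAbs_pow]

end galois

end

section
open NumberField Module

section cls
variable {K : Type*} [Field K] [NumberField K]

open Classical in
/-- The class of an ideal. -/
noncomputable def cls (I : Ideal (𝓞 K)) : ClassGroup (𝓞 K) :=
  if h : I ∈ nonZeroDivisors (Ideal (𝓞 K)) then ClassGroup.mk0 ⟨I, h⟩ else 1

lemma cls_of {I : Ideal (𝓞 K)} (h : I ∈ nonZeroDivisors (Ideal (𝓞 K))) :
    cls I = ClassGroup.mk0 ⟨I, h⟩ := dif_pos h

lemma cls_mul {I J : Ideal (𝓞 K)} (hI : I ≠ ⊥) (hJ : J ≠ ⊥) : cls (I * J) = cls I * cls J := by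
  have a := mem_nonZeroDivisors_iff_ne_zero.mpr hI
  have b := mem_nonZeroDivisors_iff_ne_zero.mpr hJ
  rw [cls_of a, cls_of b, cls_of (mul_mem a b), ← map_mul]
  rfl

lemma cls_span {x : 𝓞 K} (hx : x ≠ 0) : cls (Ideal.span {x}) = 1 := by
  have a : Ideal.span {x} ∈ nonZeroDivisors (Ideal (𝓞 K)) := by
    rw [mem_nonZeroDivisors_iff_ne_zero]
    simpa using hx
  rw [cls_of a, ClassGroup.mk0_eq_one_iff]
  exact ⟨x, rfl⟩

lemma cls_eq_one {I : Ideal (𝓞 K)} (hI : I ≠ ⊥) (h : cls I = 1) :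
    ∃ x : 𝓞 K, x ≠ 0 ∧ I = Ideal.span {x} := by
  have a := mem_nonZeroDivisors_iff_ne_zero.mpr hI
  rw [cls_of a, ClassGroup.mk0_eq_one_iff] at h
  obtain ⟨x, hx⟩ := h
  have hx : I = Ideal.span {x} := hx
  refine ⟨x, ?_, hx⟩
  rintro rfl
  exact hI (by simpa using hx)

lemma cls_surj (c : ClassGroup (𝓞 K)) : ∃ I : Ideal (𝓞 K), I ≠ ⊥ ∧ cls I = c := by
  obtain ⟨⟨I, h⟩, rfl⟩ := ClassGroup.mk0_surjective c
  exact ⟨I, mem_nonZeroDivisors_iff_ne_zero.mp h, cls_of h⟩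

variable {k : Type*} [Field k] [NumberField k] [Algebra k K]

lemma extendedHom_cls {I : Ideal (𝓞 k)} (hI : I ≠ ⊥) :
    ClassGroup.extendedHom (𝓞 k) (𝓞 K) (cls I) = cls (ext K I) := by
  have a := mem_nonZeroDivisors_iff_ne_zero.mpr hI
  have b : ext K I ∈ nonZeroDivisors (Ideal (𝓞 K)) :=
    mem_nonZeroDivisors_iff_ne_zero.mpr (ext_ne_bot hI)
  rw [cls_of a, cls_of b, ClassGroup.extendedHom_mk0]
  rfl

/-- `k'` and `k` are different quadratic subfields of `K`. -/
def Oth (k k' K : Type*) [Field K] [NumberField K] [Field k] [NumberField k]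
    [Algebra k K] [Field k'] [NumberField k'] [Algebra k' K] : Prop :=
  ∀ x : k', Algebra.norm k (algebraMap k' K x) = algebraMap ℚ k (Algebra.norm ℚ x)

variable {k1 k2 k3 : Type*} [Field k1] [NumberField k1] [Algebra k1 K]
  [Field k2] [NumberField k2] [Algebra k2 K] [Field k3] [NumberField k3] [Algebra k3 K]

lemma absNorm_cast_ne {I : Ideal (𝓞 k1)} (hI : I ≠ ⊥) :
    ((Ideal.absNorm I : ℕ) : 𝓞 k2) ≠ 0 := by
  rw [Nat.cast_ne_zero, Ne, Ideal.absNorm_eq_zero_iff]; exact hI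

/-- Squares of classes come from the three quadratic subfields. -/
lemma sq_eq {σ1 σ2 σ3 : K ≃ₐ[ℚ] K} (h1 : QE k1 σ1) (h2 : QE k2 σ2) (h3 : QE k3 σ3)
    (hs : σ2 * σ1 = σ3) (o : Oth k2 k1 K) (r2 : finrank ℚ k2 = 2)
    (c : ClassGroup (𝓞 K)) : ∃ c1 c2 c3,
      c ^ 2 = ClassGroup.extendedHom (𝓞 k1) (𝓞 K) c1 * ClassGroup.extendedHom (𝓞 k2) (𝓞 K) c2
        * ClassGroup.extendedHom (𝓞 k3) (𝓞 K) c3 := by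
  obtain ⟨I, hI, rfl⟩ := cls_surj c
  refine ⟨cls (rN k1 I), cls (rN k2 I), cls (rN k3 I), ?_⟩
  rw [extendedHom_cls (rN_ne_bot hI), extendedHom_cls (rN_ne_bot hI),
    extendedHom_cls (rN_ne_bot hI), h1.ext_rN, h2.ext_rN, h3.ext_rN]
  have e : cls (ext K (rN k1 I)) * cls (simg σ2 (ext K (rN k1 I))) = 1 := by
    have hE : ext K (rN k1 I) ≠ ⊥ := ext_ne_bot (rN_ne_bot hI)
    rw [← cls_mul hE (simg_ne_bot _ hE), ← h2.ext_rN, h2.rN_ext_other h1 o r2, ext_span]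
    apply cls_span
    rw [map_natCast]
    exact absNorm_cast_ne (rN_ne_bot hI)
  have b1 := simg_ne_bot σ1 hI
  have b2 := simg_ne_bot σ2 hI
  have b3 := simg_ne_bot σ3 hI
  rw [h1.ext_rN, simg_mul, simg_simg, hs, cls_mul hI b1, cls_mul b2 b3] at e
  rw [cls_mul hI b1, cls_mul hI b2, cls_mul hI b3]
  calc cls I ^ 2 = cls I ^ 2 * (cls I * cls (simg σ1 I) * (cls (simg σ2 I) * cls (simg σ3 I))) := by
        rw [e, mul_one]
    _ = _ := by
        simp only [pow_two, mul_assoc, mul_left_comm, mul_comm]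

/-- Independence of the three contributions. -/
lemma indep {σ1 σ2 σ3 : K ≃ₐ[ℚ] K} (h1 : QE k1 σ1) (h2 : QE k2 σ2) (h3 : QE k3 σ3)
    (o2 : Oth k1 k2 K) (o3 : Oth k1 k3 K) (r1 : finrank ℚ k1 = 2) (c1 c2 c3)
    (h : ClassGroup.extendedHom (𝓞 k1) (𝓞 K) c1 * ClassGroup.extendedHom (𝓞 k2) (𝓞 K) c2
        * ClassGroup.extendedHom (𝓞 k3) (𝓞 K) c3 = 1) : c1 ^ 2 = 1 := by
  obtain ⟨I1, b1, rfl⟩ := cls_surj c1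
  obtain ⟨I2, b2, rfl⟩ := cls_surj c2
  obtain ⟨I3, b3, rfl⟩ := cls_surj c3
  have e1 : ext K I1 ≠ ⊥ := ext_ne_bot b1
  have e2 : ext K I2 ≠ ⊥ := ext_ne_bot b2
  have e3 : ext K I3 ≠ ⊥ := ext_ne_bot b3
  have e12 : ext K I1 * ext K I2 ≠ ⊥ := mul_ne_zero e1 e2
  rw [extendedHom_cls b1, extendedHom_cls b2, extendedHom_cls b3, ← cls_mul e1 e2,
    ← cls_mul e12 e3] at h
  obtain ⟨x, hx, hI⟩ := cls_eq_one (mul_ne_zero e12 e3) h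
  have hh := congrArg (rN k1) hI
  rw [rN_mul, rN_mul, h1.rN_ext, h1.rN_ext_other h2 o2 r1, h1.rN_ext_other h3 o3 r1, rN_span] at hh
  have hh2 := congrArg cls hh
  have hn : Algebra.intNorm (𝓞 k1) (𝓞 K) x ≠ 0 := by
    rwa [Ne, Algebra.intNorm_eq_zero]
  have n2 := absNorm_cast_ne (k2 := k1) b2
  have n3 := absNorm_cast_ne (k2 := k1) b3
  have s2 : Ideal.span {((Ideal.absNorm I2 : ℕ) : 𝓞 k1)} ≠ ⊥ := by simpa using n2
  have s3 : Ideal.span {((Ideal.absNorm I3 : ℕ) : 𝓞 k1)} ≠ ⊥ := by simpa using n3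
  have s1 : I1 ^ 2 ≠ ⊥ := pow_ne_zero 2 b1
  rw [cls_span hn, cls_mul (mul_ne_zero s1 s2) s3, cls_mul s1 s2, cls_span n2, cls_span n3, sq,
    cls_mul b1 b1, mul_one, mul_one, ← sq] at hh2
  exact hh2

lemma m5_sq {r : ℕ} (x : Fin r → Multiplicative (ZMod 5)) (h : x ^ 2 = 1) : x = 1 := by
  funext i
  have : (x i) ^ 2 = 1 := congrFun h i
  have key : ∀ y : Multiplicative (ZMod 5), y ^ 2 = 1 → y = 1 := by decide
  exact key _ this

theorem assemble {σ1 σ2 σ3 : K ≃ₐ[ℚ] K} (h1 : QE k1 σ1) (h2 : QE k2 σ2) (h3 : QE k3 σ3)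
    (hs : σ2 * σ1 = σ3) (o12 : Oth k1 k2 K) (o13 : Oth k1 k3 K) (o21 : Oth k2 k1 K)
    (o23 : Oth k2 k3 K) (o31 : Oth k3 k1 K) (o32 : Oth k3 k2 K)
    (r1 : finrank ℚ k1 = 2) (r2 : finrank ℚ k2 = 2) (r3 : finrank ℚ k3 = 2)
    {n1 n2 n3 : ℕ} (s1 : SqC5 k1 n1) (s2 : SqC5 k2 n2) (s3 : SqC5 k3 n3)
    (hodd : ∀ c : ClassGroup (𝓞 K), c ^ 2 = 1 → c = 1) :
    Nonempty (ClassGroup (𝓞 K) ≃* (Fin (n1 + n2 + n3) → Multiplicative (ZMod 5))) := by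
  obtain ⟨p1, i1, j1⟩ := s1
  obtain ⟨p2, i2, j2⟩ := s2
  obtain ⟨p3, i3, j3⟩ := s3
  let Φ : (((Fin n1 → Multiplicative (ZMod 5)) × (Fin n2 → Multiplicative (ZMod 5))) ×
      (Fin n3 → Multiplicative (ZMod 5))) →* ClassGroup (𝓞 K) :=
    MonoidHom.coprod (MonoidHom.coprod ((ClassGroup.extendedHom (𝓞 k1) (𝓞 K)).comp p1)
      ((ClassGroup.extendedHom (𝓞 k2) (𝓞 K)).comp p2))
      ((ClassGroup.extendedHom (𝓞 k3) (𝓞 K)).comp p3)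
  have hΦ : ∀ x y z, Φ ((x, y), z) = ClassGroup.extendedHom (𝓞 k1) (𝓞 K) (p1 x) *
    ClassGroup.extendedHom (𝓞 k2) (𝓞 K) (p2 y) * ClassGroup.extendedHom (𝓞 k3) (𝓞 K) (p3 z) :=
    fun x y z => rfl
  have inj : Function.Injective Φ := by
    rw [injective_iff_map_eq_one]
    rintro ⟨⟨x, y⟩, z⟩ h
    rw [hΦ] at h
    have hx := indep h1 h2 h3 o12 o13 r1 _ _ _ h
    have hy := indep h2 h1 h3 o21 o23 r2 (p2 y) (p1 x) (p3 z) (by rw [← h]; congr 1; rw [mul_comm])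
    have hz := indep h3 h1 h2 o31 o32 r3 (p3 z) (p1 x) (p2 y) (by rw [← h, mul_assoc, mul_comm])
    rw [← map_pow] at hx hy hz
    have hx' := m5_sq x (i1 (by rw [hx, map_one]))
    have hy' := m5_sq y (i2 (by rw [hy, map_one]))
    have hz' := m5_sq z (i3 (by rw [hz, map_one]))
    rw [hx', hy', hz']; rfl
  have sqinj : Function.Injective (powMonoidHom 2 : ClassGroup (𝓞 K) →* ClassGroup (𝓞 K)) := by
    rw [injective_iff_map_eq_one]
    intro a ha
    exact hodd a ha
  have sqsurj := Finite.surjective_of_injective sqinj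
  have surj : Function.Surjective Φ := by
    intro a
    obtain ⟨b, hb⟩ := sqsurj a
    obtain ⟨c, hc⟩ := sqsurj b
    obtain ⟨c1, c2, c3, h⟩ := sq_eq h1 h2 h3 hs o21 r2 c
    obtain ⟨x, hx⟩ := j1 c1
    obtain ⟨y, hy⟩ := j2 c2
    obtain ⟨z, hz⟩ := j3 c3
    refine ⟨((x, y), z), ?_⟩
    rw [hΦ, hx, hy, hz, ← hb, ← hc]
    change _ = (c ^ 2) ^ 2
    rw [h, mul_pow, mul_pow, map_pow, map_pow, map_pow]
  let e := MulEquiv.ofBijective Φ ⟨inj, surj⟩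
  have f : ∀ m n : ℕ, Nonempty (((Fin m → Multiplicative (ZMod 5)) × (Fin n → Multiplicative (ZMod 5)))
      ≃* (Fin (m + n) → Multiplicative (ZMod 5))) := fun m n =>
    ⟨{ (Fin.appendEquiv m n (α := Multiplicative (ZMod 5))) with
      map_mul' := by
        rintro ⟨a, b⟩ ⟨c, d⟩
        funext i
        refine Fin.addCases (fun j => ?_) (fun j => ?_) i <;> simp [Fin.appendEquiv] }⟩
  obtain ⟨f1⟩ := f n1 n2
  obtain ⟨f2⟩ := f (n1 + n2) n3
  exact ⟨e.symm.trans ((MulEquiv.prodCongr f1 (MulEquiv.refl _)).trans f2)⟩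
end cls

end

section
open NumberField Module

/-- The product of the ramified primes. -/
def ramR (d : ℤ) : ℤ := if d % 4 = 3 then 2 * d else d

lemma dvd_ramR {d : ℤ} (hd : Squarefree d) {m : ℕ} (hm : Squarefree m) {X Y e : ℤ}
    (he : e = 1 ∨ e = -1) (h : X ^ 2 - d * Y ^ 2 = 4 * (e * m)) (hX : (m : ℤ) ∣ X ^ 2) :
    (m : ℤ) ∣ ramR d := by
  rw [Int.natCast_dvd, ← Nat.prod_primeFactors_of_squarefree hm]
  apply Finset.prod_primes_dvd
  · intro p hp
    exact (Nat.prime_iff.mp (Nat.prime_of_mem_primeFactors hp))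
  · intro p hp
    rw [← Int.natCast_dvd]
    have hpp := Nat.prime_of_mem_primeFactors hp
    have hpi := Nat.prime_iff_prime_int.mp hpp
    have hpm := Nat.dvd_of_mem_primeFactors hp
    obtain ⟨m', rfl⟩ := hpm
    have hm' : ¬ (p ∣ m') := by
      rintro ⟨c, rfl⟩
      have := hm p ⟨c, by ring⟩
      exact hpp.one_lt.ne' (Nat.isUnit_iff.mp this)
    have hpX : (p : ℤ) ∣ X := by
      apply hpi.dvd_of_dvd_pow (n := 2)
      exact dvd_trans ⟨(m' : ℤ), by push_cast; ring⟩ hX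
    obtain ⟨X', rfl⟩ := hpX
    push_cast at h
    by_cases hpd : (p : ℤ) ∣ d
    · rw [ramR]; split_ifs
      · exact dvd_mul_of_dvd_right hpd _
      · exact hpd
    by_cases hp2 : p = 2
    · subst hp2
      push_cast at *
      have hm2 : (m' : ℤ) % 2 = 1 := by omega
      have hY : (2 : ℤ) ∣ Y := by
        have : (2 : ℤ) ∣ d * Y ^ 2 := ⟨2 * X' ^ 2 - 4 * (e * m'), by linear_combination -h⟩
        rcases hpi.dvd_or_dvd this with h1 | h1
        · exact absurd h1 hpd
        · exact hpi.dvd_of_dvd_pow h1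
      obtain ⟨Y', rfl⟩ := hY
      have h2 : X' ^ 2 - d * Y' ^ 2 = 2 * (e * m') := by linarith
      rw [ramR, if_pos]
      · exact dvd_mul_right _ _
      · by_contra h3
        have hd1 : d % 4 = 1 := by omega
        obtain ⟨D, hD⟩ : ∃ D, d = 4 * D + 1 := ⟨d / 4, by omega⟩
        obtain ⟨M, hM⟩ : ∃ M, (m' : ℤ) = 2 * M + 1 := ⟨m' / 2, by omega⟩
        rw [hD, hM] at h2
        have h4 : (X' ^ 2 - Y' ^ 2) % 4 = 2 := by
          rcases he with rfl | rfl
          · have : X' ^ 2 - Y' ^ 2 = 4 * (D * Y' ^ 2 + M) + 2 := by linear_combination h2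
            omega
          · have : X' ^ 2 - Y' ^ 2 = 4 * (D * Y' ^ 2 - M) - 2 := by linear_combination h2
            omega
        rcases Int.even_or_odd' X' with ⟨x, rfl | rfl⟩ <;>
          rcases Int.even_or_odd' Y' with ⟨y, rfl | rfl⟩ <;> ring_nf at h4 <;> omega
    · exfalso
      have hp4 : ¬ ((p : ℤ) ∣ 4) := by
        intro h4
        have : p ∣ 2 ^ 2 := by exact_mod_cast h4
        exact hp2 ((Nat.prime_dvd_prime_iff_eq hpp Nat.prime_two).mp (hpp.dvd_of_dvd_pow this))
      have hY : (p : ℤ) ∣ Y := by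
        have : (p : ℤ) ∣ d * Y ^ 2 := ⟨p * X' ^ 2 - 4 * (e * m'), by linear_combination -h⟩
        rcases hpi.dvd_or_dvd this with h1 | h1
        · exact absurd h1 hpd
        · exact hpi.dvd_of_dvd_pow h1
      obtain ⟨Y', rfl⟩ := hY
      have h2 : (p : ℤ) * (X' ^ 2 - d * Y' ^ 2) = 4 * (e * m') := by
        have : (p : ℤ) * (p * (X' ^ 2 - d * Y' ^ 2)) = p * (4 * (e * m')) := by
          linear_combination h
        exact mul_left_cancel₀ hpi.ne_zero this
      have h3 : (p : ℤ) ∣ 4 * m' := by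
        rcases he with rfl | rfl
        · exact ⟨X' ^ 2 - d * Y' ^ 2, by linear_combination -h2⟩
        · exact ⟨-(X' ^ 2 - d * Y' ^ 2), by linear_combination h2⟩
      rcases hpi.dvd_or_dvd h3 with h1 | h1
      · exact hp4 h1
      · exact hm' (by exact_mod_cast h1)

variable {K : Type*} [Field K] [NumberField K] {k : Type*} [Field k] [NumberField k] [Algebra k K]
  {d : ℤ} {δ : k}

/-- Data describing a CM biquadratic field over its real quadratic subfield. -/
structure CM (k : Type*) {K : Type*} [Field K] [NumberField K] [Field k] [NumberField k]
    [Algebra k K] (d : ℤ) (δ : k) (σ : K ≃ₐ[ℚ] K) : Prop where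
  qf : QF k d δ
  qe : QE k σ
  fix : ∀ x : k, σ (algebraMap k K x) = algebraMap k K x
  tau : ∃ τ : K ≃ₐ[ℚ] K, τ (algebraMap k K δ) = - algebraMap k K δ ∧ ∀ x, τ (σ x) = σ (τ x)
  conj : ∃ ψ : K →+* ℂ, ∀ x, ψ (σ x) = (starRingEnd ℂ) (ψ x)
  mu : ∀ m : ℕ, Squarefree m → (m : ℤ) ∣ ramR d → ∃ μ : K, μ * σ μ = m ∧ μ ^ 8 = (m : K) ^ 4

/-- Totally positive units which are norms are norms of units. -/
lemma CM.unit_norm {σ : K ≃ₐ[ℚ] K} (h : CM k d δ σ) (u : (𝓞 k)ˣ) (α : K) (hα : α ≠ 0)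
    (hu : α * σ α = algebraMap k K ((u : 𝓞 k) : k)) :
    ∃ η : (𝓞 K)ˣ, ((η : 𝓞 K) : K) * σ ((η : 𝓞 K) : K) = algebraMap k K ((u : 𝓞 k) : k) := by
  obtain ⟨A, B, hAB, hN⟩ := h.qf.int_coord (u : 𝓞 k)
  obtain ⟨τ, hτ, hτσ⟩ := h.tau
  obtain ⟨ψ, hψ⟩ := h.conj
  set U : K := algebraMap k K ((u : 𝓞 k) : k) with hU
  set Δ : K := algebraMap k K δ with hΔ
  have hΔ2 : Δ ^ 2 = (d : K) := by rw [hΔ, ← map_pow, h.qf.sq]; simp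
  have h2U : 2 * U = A + B * Δ := by
    have := congrArg (algebraMap k K) hAB
    simpa only [map_mul, map_add, map_ofNat, map_intCast] using this
  have h2T : 2 * τ U = A - B * Δ := by
    have := congrArg τ h2U
    simp only [map_mul, map_add, map_ofNat, map_intCast, hτ] at this
    linear_combination this
  have pos : ∀ x : K, x ≠ 0 → ∃ r : ℝ, 0 < r ∧ ψ (x * σ x) = r := by
    intro x hx
    refine ⟨Complex.normSq (ψ x), Complex.normSq_pos.mpr ((map_ne_zero ψ).mpr hx), ?_⟩
    rw [map_mul, hψ, Complex.mul_conj]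
  obtain ⟨r1, hr1, e1⟩ := pos α hα
  obtain ⟨r2, hr2, e2⟩ := pos (τ α) ((map_ne_zero τ).mpr hα)
  rw [← hτσ, ← map_mul] at e2
  rw [hu] at e1 e2
  have hA : 0 < A := by
    have : ((A : ℝ) : ℂ) = ((r1 + r2 : ℝ) : ℂ) := by
      push_cast
      rw [← e1, ← e2, ← map_add]
      have : U + τ U = A := by linear_combination (h2U + h2T) / 2
      rw [this]; simp
    have := Complex.ofReal_injective this
    have : (0 : ℝ) < A := by rw [this]; positivity
    exact_mod_cast this
  have hUT : U * τ U = ((Algebra.norm ℤ (u : 𝓞 k) : ℤ) : K) := by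
    have hN' : (A : K) ^ 2 - d * B ^ 2 = 4 * ((Algebra.norm ℤ (u : 𝓞 k) : ℤ) : K) := by
      exact_mod_cast congrArg (Int.cast : ℤ → K) hN
    have : 4 * (U * τ U) = 4 * ((Algebra.norm ℤ (u : 𝓞 k) : ℤ) : K) := by
      rw [← hN']
      calc 4 * (U * τ U) = (2 * U) * (2 * τ U) := by ring
        _ = _ := by rw [h2U, h2T, ← hΔ2]; ring
    linear_combination this / 4
  have hN1 : Algebra.norm ℤ (u : 𝓞 k) = 1 := by
    have hp : 0 < Algebra.norm ℤ (u : 𝓞 k) := by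
      have : (((Algebra.norm ℤ (u : 𝓞 k) : ℤ) : ℝ) : ℂ) = ((r1 * r2 : ℝ) : ℂ) := by
        push_cast
        rw [← e1, ← e2, ← map_mul, hUT]; simp
      have := Complex.ofReal_injective this
      have : (0 : ℝ) < (Algebra.norm ℤ (u : 𝓞 k) : ℤ) := by rw [this]; positivity
      exact_mod_cast this
    have hunit : IsUnit (Algebra.norm ℤ (u : 𝓞 k)) := u.isUnit.map _
    rcases Int.isUnit_iff.mp hunit with h1 | h1
    · exact h1
    · omega
  rw [hN1] at hN
  obtain ⟨n, hn⟩ : ∃ n : ℕ, (n : ℤ) = A + 2 := ⟨(A + 2).toNat, by omega⟩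
  obtain ⟨m, s, hms, hm⟩ := Nat.sq_mul_squarefree n
  have hs0 : s ≠ 0 := by rintro rfl; simp at hms; omega
  have hm0 : m ≠ 0 := hm.ne_zero
  set w : k := ((u : 𝓞 k) : k) with hw
  have hw2 : w ^ 2 - A * w + 1 = 0 := by
    have hN' : (A : k) ^ 2 - d * B ^ 2 = 4 := by
      exact_mod_cast congrArg (Int.cast : ℤ → k) hN
    have e : (2 * w - A) ^ 2 = d * B ^ 2 := by
      rw [hAB, ← h.qf.sq]; ring
    linear_combination e / 4 - hN' / 4
  have hsK : (s : k) ≠ 0 := by exact_mod_cast hs0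
  have hmk : (m : k) ≠ 0 := by exact_mod_cast hm0
  have hns : (s : k) ^ 2 * m = A + 2 := by
    have : ((s ^ 2 * m : ℕ) : ℤ) = A + 2 := by rw [mul_comm] at hms; rw [← hn, ← hms, mul_comm]
    exact_mod_cast congrArg (Int.cast : ℤ → k) this
  have hy2 : ((1 + w) / s) ^ 2 = m * w := by
    field_simp
    linear_combination hw2 - w * hns
  have hyint : IsIntegral ℤ ((1 + w) / (s : k)) := by
    apply IsIntegral.of_pow (n := 2) (by norm_num)
    rw [hy2]
    have : (m : k) * w = (((m : 𝓞 k) * (u : 𝓞 k) : 𝓞 k) : k) := by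
      rw [hw]; simp
    rw [this]
    exact RingOfIntegers.isIntegral_coe _
  obtain ⟨y, hy⟩ : ∃ y : 𝓞 k, (y : k) = (1 + w) / s := ⟨⟨_, hyint⟩, rfl⟩
  have hyy : (y : k) ^ 2 = m * w := by rw [hy, hy2]
  obtain ⟨X, Y, hXY, hNy⟩ := h.qf.int_coord y
  have hyy' : y ^ 2 = (m : 𝓞 k) * u := by
    apply RingOfIntegers.ext
    simpa using hyy
  have hNy2 : (Algebra.norm ℤ y) ^ 2 = (m : ℤ) ^ 2 := by
    rw [← map_pow, hyy', map_mul, hN1, mul_one]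
    have : (m : 𝓞 k) = algebraMap ℤ (𝓞 k) (m : ℤ) := by simp
    rw [this, Algebra.norm_algebraMap, finrank_int h.qf.rank]
  obtain ⟨e, he, hNe⟩ : ∃ e : ℤ, (e = 1 ∨ e = -1) ∧ Algebra.norm ℤ y = e * m := by
    rcases sq_eq_sq_iff_eq_or_eq_neg.mp hNy2 with h1 | h1
    · exact ⟨1, Or.inl rfl, by rw [h1, one_mul]⟩
    · exact ⟨-1, Or.inr rfl, by rw [h1]; ring⟩
  rw [hNe] at hNy
  have hX2 : (m : ℤ) ∣ X ^ 2 := by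
    have hc : (((X ^ 2 + d * Y ^ 2 : ℤ) : ℚ) : k) + ((2 * X * Y : ℤ) : ℚ) * δ
        = ((2 * m * A : ℤ) : ℚ) + ((2 * m * B : ℤ) : ℚ) * δ := by
      push_cast
      have h1 : (X + Y * δ) ^ 2 = 4 * (m * w) := by rw [← hXY, ← hyy]; ring
      have h2 : 4 * (m * w) = 2 * m * (A + B * δ) := by rw [← hAB]; ring
      rw [h2] at h1
      linear_combination h1 - Y ^ 2 * h.qf.sq
    have := (h.qf.coord_inj hc).1
    have h3 : X ^ 2 + d * Y ^ 2 = 2 * m * A := by exact_mod_cast this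
    exact ⟨A + 2 * e, by linarith⟩
  obtain ⟨μ, hμ1, hμ2⟩ := h.mu m hm (dvd_ramR h.qf.sqf hm he hNy hX2)
  have hmK : (m : K) ≠ 0 := by exact_mod_cast hm0
  have hμ0 : μ ≠ 0 := by
    rintro rfl
    rw [zero_mul] at hμ1
    exact hmK hμ1.symm
  set Z : K := algebraMap k K (y : k) with hZ
  have hZ2 : Z ^ 2 = m * U := by rw [hZ, ← map_pow, hyy, map_mul]; simp [hU]
  have hU0 : U ≠ 0 := by rw [← hu]; exact mul_ne_zero hα ((map_ne_zero σ).mpr hα)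
  have hZ0 : Z ≠ 0 := by
    intro h0
    rw [h0, zero_pow two_ne_zero] at hZ2
    exact mul_ne_zero hmK hU0 hZ2.symm
  have hη8 : (Z / μ) ^ 8 = U ^ 4 := by
    rw [div_pow, hμ2, show Z ^ 8 = (Z ^ 2) ^ 4 by ring, hZ2, mul_pow]
    field_simp
  have hη8' : (μ / Z) ^ 8 = (algebraMap k K (((u⁻¹ : (𝓞 k)ˣ) : 𝓞 k) : k)) ^ 4 := by
    have h1 : U * algebraMap k K (((u⁻¹ : (𝓞 k)ˣ) : 𝓞 k) : k) = 1 := by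
      rw [hU, ← map_mul]
      have : w * (((u⁻¹ : (𝓞 k)ˣ) : 𝓞 k) : k) = (((u : 𝓞 k) * ((u⁻¹ : (𝓞 k)ˣ) : 𝓞 k) : 𝓞 k) : k) := rfl
      rw [this, Units.mul_inv]; simp
    have h2 : algebraMap k K (((u⁻¹ : (𝓞 k)ˣ) : 𝓞 k) : k) = U⁻¹ :=
      eq_inv_of_mul_eq_one_right h1
    rw [h2, inv_pow, ← hη8, div_pow, div_pow, inv_div]
  have int1 : IsIntegral ℤ (Z / μ) := by
    apply IsIntegral.of_pow (n := 8) (by norm_num)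
    rw [hη8]
    exact ((RingOfIntegers.isIntegral_coe (u : 𝓞 k)).map (algebraMap k K).toIntAlgHom).pow 4
  have int2 : IsIntegral ℤ (μ / Z) := by
    apply IsIntegral.of_pow (n := 8) (by norm_num)
    rw [hη8']
    exact ((RingOfIntegers.isIntegral_coe ((u⁻¹ : (𝓞 k)ˣ) : 𝓞 k)).map
      (algebraMap k K).toIntAlgHom).pow 4
  refine ⟨⟨⟨Z / μ, int1⟩, ⟨μ / Z, int2⟩, ?_, ?_⟩, ?_⟩
  · apply RingOfIntegers.ext
    change Z / μ * (μ / Z) = 1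
    field_simp
  · apply RingOfIntegers.ext
    change μ / Z * (Z / μ) = 1
    field_simp
  · change Z / μ * σ (Z / μ) = U
    have hσZ : σ Z = Z := h.fix _
    rw [map_div₀, hσZ]
    have : Z / μ * (Z / σ μ) = Z ^ 2 / (μ * σ μ) := by ring
    rw [this, hμ1, hZ2]
    field_simp

end

section
open NumberField Module

variable {K : Type*} [Field K] [NumberField K] {k : Type*} [Field k] [NumberField k] [Algebra k K]
  {d : ℤ} {δ : k}

lemma simg_maximal (σ : K ≃ₐ[ℚ] K) {P : Ideal (𝓞 K)} (hP : P.IsMaximal) :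
    (simg σ P).IsMaximal := by
  exact Ideal.map_isMaximal_of_equiv (sg σ)

/-- A prime fixed by the automorphism is extended or ramified. -/
lemma QE.fixed_prime {σ : K ≃ₐ[ℚ] K} (h : QE k σ)
    (hfix : ∀ x : k, σ (algebraMap k K x) = algebraMap k K x)
    {P : Ideal (𝓞 K)} (hP : P.IsMaximal) (hP0 : P ≠ ⊥) (hs : simg σ P = P) :
    (∃ p : Ideal (𝓞 k), p ≠ ⊥ ∧ P = ext K p) ∨ (∀ x : 𝓞 K, x - sg σ x ∈ P) := by
  set p : Ideal (𝓞 k) := P.comap (algebraMap (𝓞 k) (𝓞 K)) with hp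
  have hpP : p.IsPrime := Ideal.comap_isPrime _ _
  have hlie : P.LiesOver p := ⟨rfl⟩
  have hp0 : p ≠ ⊥ := by
    intro h0
    have := Ideal.relNorm_le_comap (𝓞 k) P
    rw [← hp, h0, le_bot_iff, Ideal.relNorm_eq_bot_iff] at this
    exact hP0 this
  obtain ⟨s, hsn⟩ := Ideal.exists_relNorm_eq_pow_of_isPrime P p
  have hn : Ideal.absNorm P = Ideal.absNorm p ^ s := by
    rw [← Ideal.absNorm_relNorm (𝓞 k) (𝓞 K) P, hsn, map_pow]
  have hle : ext K p ≤ P := Ideal.map_comap_le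
  have hq1 : Ideal.absNorm p ≠ 1 := by
    rw [Ne, Ideal.absNorm_eq_one_iff]; exact hpP.ne_top
  have hq0 : Ideal.absNorm p ≠ 0 := by
    rw [Ne, Ideal.absNorm_eq_zero_iff]; exact hp0
  have hdv : Ideal.absNorm p ^ s ∣ Ideal.absNorm p ^ 2 := by
    rw [← hn, ← h.absNorm_ext]
    exact Ideal.absNorm_dvd_absNorm_of_le hle
  have hs2 : s ≤ 2 := (Nat.pow_dvd_pow_iff_le_right (by omega)).mp hdv
  have hs0 : s ≠ 0 := by
    rintro rfl
    rw [pow_zero, Ideal.absNorm_eq_one_iff] at hn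
    exact hP.ne_top hn
  obtain rfl | rfl : s = 1 ∨ s = 2 := by omega
  · right
    rw [pow_one] at hn
    have hcard : Nat.card (𝓞 K ⧸ P) = Nat.card (𝓞 k ⧸ p) := hn
    let f : 𝓞 k ⧸ p →+* 𝓞 K ⧸ P := Ideal.quotientMap P (algebraMap (𝓞 k) (𝓞 K)) le_rfl
    have finj : Function.Injective f := Ideal.quotientMap_injective
    have : Finite (𝓞 K ⧸ P) := Ideal.finiteQuotientOfFreeOfNeBot P hP0
    have fbij := (Nat.bijective_iff_injective_and_card f).mpr ⟨finj, hcard.symm⟩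
    intro x
    obtain ⟨y, hy⟩ := fbij.2 (Ideal.Quotient.mk P x)
    obtain ⟨y, rfl⟩ := Ideal.Quotient.mk_surjective y
    rw [Ideal.quotientMap_mk, Ideal.Quotient.eq] at hy
    have h2 := mem_simg σ P hy
    rw [hs, map_sub] at h2
    have h3 : sg σ (algebraMap (𝓞 k) (𝓞 K) y) = algebraMap (𝓞 k) (𝓞 K) y := by
      apply RingOfIntegers.ext
      exact hfix y
    rw [h3] at h2
    have := P.sub_mem h2 hy
    have e : x - sg σ x = (algebraMap (𝓞 k) (𝓞 K)) y - (sg σ) x - ((algebraMap (𝓞 k) (𝓞 K)) y - x) := by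
      ring
    rw [e]; exact this
  · left
    refine ⟨p, hp0, (eq_of_le_norm hP0 hle ?_).symm⟩
    rw [h.absNorm_ext, hn]

lemma QE.invariant {σ : K ≃ₐ[ℚ] K} (h : QE k σ) (hσ : σ * σ = 1)
    (hfix : ∀ x : k, σ (algebraMap k K x) = algebraMap k K x)
    (hram : ∀ P : Ideal (𝓞 K), P.IsMaximal → P ≠ ⊥ → (∀ x : 𝓞 K, x - sg σ x ∈ P) → cls P = 1)
    (n : ℕ) : ∀ J : Ideal (𝓞 K), J ≠ ⊥ → Ideal.absNorm J ≤ n → simg σ J = J →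
      cls J ∈ (ClassGroup.extendedHom (𝓞 k) (𝓞 K)).range := by
  induction n with
  | zero =>
    intro J hJ hn
    exact absurd (Ideal.absNorm_eq_zero_iff.mp (Nat.le_zero.mp hn)) hJ
  | succ n ih =>
    intro J hJ hn hs
    by_cases htop : J = ⊤
    · rw [htop, ← Ideal.span_singleton_one, cls_span one_ne_zero]
      exact one_mem _
    obtain ⟨P, hP, hJP⟩ := Ideal.exists_le_maximal J htop
    have hP0 : P ≠ ⊥ := by
      rintro rfl
      exact hJ (le_bot_iff.mp hJP)
    have hP1 : Ideal.absNorm P ≠ 1 := by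
      rw [Ne, Ideal.absNorm_eq_one_iff]; exact hP.ne_top
    have hPn0 : Ideal.absNorm P ≠ 0 := by rwa [Ne, Ideal.absNorm_eq_zero_iff]
    have key : ∀ Q J' : Ideal (𝓞 K), J = Q * J' → Q ≤ P → simg σ Q = Q →
        cls Q ∈ (ClassGroup.extendedHom (𝓞 k) (𝓞 K)).range →
        cls J ∈ (ClassGroup.extendedHom (𝓞 k) (𝓞 K)).range := by
      intro Q J' hJQ hQP hQ hc
      have hQ0 : Q ≠ ⊥ := by
        rintro rfl; exact hJ (by rw [hJQ, Ideal.bot_mul])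
      have hJ'0 : J' ≠ ⊥ := by
        rintro rfl; exact hJ (by rw [hJQ, Ideal.mul_bot])
      rw [hJQ, cls_mul hQ0 hJ'0]
      apply mul_mem hc
      apply ih J' hJ'0
      · have h1 : Ideal.absNorm J = Ideal.absNorm Q * Ideal.absNorm J' := by rw [hJQ, map_mul]
        have h2 : Ideal.absNorm Q ≠ 0 := by rwa [Ne, Ideal.absNorm_eq_zero_iff]
        have h3 : Ideal.absNorm Q ≠ 1 := by
          rw [Ne, Ideal.absNorm_eq_one_iff]
          rintro rfl
          exact hP.ne_top (top_le_iff.mp hQP)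
        have h4 : Ideal.absNorm J' ≠ 0 := by rwa [Ne, Ideal.absNorm_eq_zero_iff]
        have h5 : 2 ≤ Ideal.absNorm Q := by omega
        have h6 : 2 * Ideal.absNorm J' ≤ Ideal.absNorm J := by
          rw [h1]; exact Nat.mul_le_mul_right _ h5
        omega
      · have h1 := hs
        rw [hJQ, simg_mul, hQ] at h1
        exact mul_left_cancel₀ hQ0 h1
    obtain ⟨J1, hJ1⟩ := Ideal.dvd_iff_le.mpr hJP
    by_cases hsP : simg σ P = P
    · rcases h.fixed_prime hfix hP hP0 hsP with ⟨p, hp0, hp⟩ | hx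
      · exact key P J1 hJ1 le_rfl hsP ⟨cls p, by rw [hp, extendedHom_cls hp0]⟩
      · exact key P J1 hJ1 le_rfl hsP (by rw [hram P hP hP0 hx]; exact one_mem _)
    · have hPσ := simg_maximal σ hP
      have hJσ : J ≤ simg σ P := by
        rw [← hs]; exact Ideal.map_mono hJP
      have hcop : IsCoprime P (simg σ P) := by
        rw [Ideal.isCoprime_iff_sup_eq]
        exact hP.coprime_of_ne hPσ (fun e => hsP e.symm)
      obtain ⟨J2, hJ2⟩ := hcop.mul_dvd (Ideal.dvd_iff_le.mpr hJP) (Ideal.dvd_iff_le.mpr hJσ)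
      refine key _ J2 hJ2 Ideal.mul_le_left ?_ ?_
      · rw [simg_mul, simg_simg, hσ, simg_one, mul_comm]
      · rw [← h.ext_rN, ← extendedHom_cls (rN_ne_bot hP0)]
        exact ⟨_, rfl⟩

theorem CM.odd {σ : K ≃ₐ[ℚ] K} (h : CM k d δ σ) (hσ : σ * σ = 1) (hσ1 : σ ≠ 1)
    (hram : ∀ P : Ideal (𝓞 K), P.IsMaximal → P ≠ ⊥ → (∀ x : 𝓞 K, x - sg σ x ∈ P) → cls P = 1)
    (hk : ∀ c : ClassGroup (𝓞 k), c ^ 2 = 1 → c = 1)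
    (c : ClassGroup (𝓞 K)) (hc : c ^ 2 = 1) : c = 1 := by
  obtain ⟨I, hI, rfl⟩ := cls_surj c
  rw [sq, ← cls_mul hI hI] at hc
  have hII : I * I ≠ ⊥ := mul_ne_zero hI hI
  obtain ⟨β, hβ, hIβ⟩ := cls_eq_one hII hc
  have hNI : rN k I ≠ ⊥ := rN_ne_bot hI
  have hnβ : Algebra.intNorm (𝓞 k) (𝓞 K) β ≠ 0 := by rwa [Ne, Algebra.intNorm_eq_zero]
  have e1 : rN k I * rN k I = Ideal.span {Algebra.intNorm (𝓞 k) (𝓞 K) β} := by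
    rw [← rN_mul, hIβ, rN_span]
  have c1 : cls (rN k I) = 1 := by
    apply hk
    rw [sq, ← cls_mul hNI hNI, e1, cls_span hnβ]
  obtain ⟨a, ha, hIa⟩ := cls_eq_one hNI c1
  rw [hIa, Ideal.span_singleton_mul_span_singleton, Ideal.span_singleton_eq_span_singleton] at e1
  obtain ⟨v, hv⟩ := e1.symm
  have hIσ : I * simg σ I = Ideal.span {algebraMap (𝓞 k) (𝓞 K) a} := by
    rw [← h.qe.ext_rN, hIa, ext_span]
  set a' : 𝓞 K := algebraMap (𝓞 k) (𝓞 K) a with ha'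
  have ha'0 : a' ≠ 0 := by
    rw [ha']
    intro h0
    apply ha
    apply FaithfulSMul.algebraMap_injective (𝓞 k) (𝓞 K)
    rw [h0, map_zero]
  have hσa : sg σ a' = a' := by
    apply RingOfIntegers.ext
    exact h.fix a
  have hβK : (β : K) ≠ 0 := by
    intro h0; exact hβ (RingOfIntegers.ext h0)
  have haK : (a' : K) ≠ 0 := by
    intro h0; exact ha'0 (RingOfIntegers.ext h0)
  have hrel : (a' : K) * a' = (β : K) * σ (β : K) * algebraMap k K ((v : 𝓞 k) : k) := by
    have := congrArg (algebraMap (𝓞 k) (𝓞 K)) hv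
    rw [map_mul, map_mul, h.qe.algebraMap_intNorm] at this
    have := congrArg (fun z : 𝓞 K => (z : K)) this
    exact this.symm
  have hσβK : σ (β : K) ≠ 0 := (map_ne_zero σ).mpr hβK
  have hσaK : σ (a' : K) = a' := congrArg (fun z : 𝓞 K => (z : K)) hσa
  obtain ⟨η, hη⟩ := h.unit_norm v ((a' : K) / β) (div_ne_zero haK hβK) (by
    rw [map_div₀, hσaK]
    field_simp
    linear_combination hrel)
  have hσσ : ∀ x, σ (σ x) = x := fun x => by
    have := congrArg (fun f : K ≃ₐ[ℚ] K => f x) hσ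
    exact this
  set y : K := ((η : 𝓞 K) : K) with hy
  have hy0 : y ≠ 0 := by
    intro h0
    exact η.ne_zero (RingOfIntegers.ext h0)
  have hσy0 : σ y ≠ 0 := (map_ne_zero σ).mpr hy0
  set γ : K := a' / β / y with hγ
  have hγ0 : γ ≠ 0 := div_ne_zero (div_ne_zero haK hβK) hy0
  have hγ1 : γ * σ γ = 1 := by
    rw [hγ, map_div₀, map_div₀, hσaK]
    have : algebraMap k K ((v : 𝓞 k) : k) ≠ 0 := by rw [← hη]; exact mul_ne_zero hy0 hσy0
    field_simp
    rw [sq, hrel, ← hη]; ring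
  obtain ⟨ε, hε0, hε⟩ : ∃ ε : K, ε ≠ 0 ∧ γ * σ ε = ε := by
    by_cases h1 : γ = -1
    · obtain ⟨t, ht⟩ : ∃ t, σ t ≠ t := by
        by_contra hcon
        push Not at hcon
        exact hσ1 (AlgEquiv.ext hcon)
      refine ⟨t - σ t, sub_ne_zero.mpr ht.symm, ?_⟩
      rw [map_sub, hσσ, h1]; ring
    · refine ⟨1 + γ, fun h0 => h1 (by linear_combination h0), ?_⟩
      rw [map_add, map_one, mul_add, hγ1]; ring
  obtain ⟨x, z, hz, hxz⟩ := IsFractionRing.div_surjective (A := 𝓞 K) ε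
  have hz0 : z ≠ 0 := nonZeroDivisors.ne_zero hz
  have hzK : (z : K) ≠ 0 := by
    intro h0; exact hz0 (RingOfIntegers.ext h0)
  have hσzK : σ (z : K) ≠ 0 := (map_ne_zero σ).mpr hzK
  have hxK : (x : K) = ε * z := by
    rw [← hxz]
    change (x : K) = (x : K) / (z : K) * z
    field_simp
  set E : 𝓞 K := x * sg σ z with hE
  have hEK : (E : K) = ε * (z * σ (z : K)) := by
    have : (E : K) = (x : K) * σ (z : K) := rfl
    rw [this, hxK]; ring
  have hE0 : E ≠ 0 := by
    intro h0
    rw [h0] at hEK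
    have : ε * (z * σ (z : K)) = 0 := hEK.symm
    exact mul_ne_zero hε0 (mul_ne_zero hzK hσzK) this
  have hEE : a' * sg σ E = β * (η : 𝓞 K) * E := by
    apply RingOfIntegers.ext
    change (a' : K) * σ (E : K) = β * y * E
    rw [hEK, map_mul, map_mul, hσσ]
    have h1 : (a' : K) = γ * (β * y) := by rw [hγ]; field_simp
    rw [h1]
    linear_combination (β * y * (z * σ (z : K))) * hε
  have hsE : Ideal.span {a'} * Ideal.span {sg σ E} = Ideal.span {β} * Ideal.span {E} := by
    rw [Ideal.span_singleton_mul_span_singleton, Ideal.span_singleton_mul_span_singleton, hEE,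
      Ideal.span_singleton_eq_span_singleton]
    exact ⟨η⁻¹, by
      have : (η : 𝓞 K) * ((η⁻¹ : (𝓞 K)ˣ) : 𝓞 K) = 1 := Units.mul_inv η
      linear_combination (β * E) * this⟩
  have hβs : Ideal.span {β} ≠ ⊥ := by simpa using hβ
  have hEs : Ideal.span {E} ≠ ⊥ := by simpa using hE0
  set J := Ideal.span {E} * I with hJ
  have hJ0 : J ≠ ⊥ := mul_ne_zero hEs hI
  have hJinv : simg σ J = J := by
    apply mul_left_cancel₀ hβs
    rw [hJ, simg_mul, simg_span]
    calc Ideal.span {β} * (Ideal.span {sg σ E} * simg σ I)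
        = Ideal.span {sg σ E} * (I * I * simg σ I) := by rw [hIβ]; ring
      _ = Ideal.span {sg σ E} * ((I * simg σ I) * I) := by ring
      _ = (Ideal.span {a'} * Ideal.span {sg σ E}) * I := by rw [hIσ]; ring
      _ = Ideal.span {β} * (Ideal.span {E} * I) := by rw [hsE]; ring
  have hJc : cls J = cls I := by rw [hJ, cls_mul hEs hI, cls_span hE0, one_mul]
  have := h.qe.invariant hσ h.fix hram _ J hJ0 le_rfl hJinv
  rw [hJc] at this
  obtain ⟨c', hc'⟩ := this
  obtain ⟨I', hI', rfl⟩ := cls_surj c'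
  rw [extendedHom_cls hI'] at hc'
  rw [cls_mul hI hI, ← hc', ← cls_mul (ext_ne_bot hI') (ext_ne_bot hI')] at hc
  obtain ⟨w, hw, hIw⟩ := cls_eq_one (mul_ne_zero (ext_ne_bot hI') (ext_ne_bot hI')) hc
  have e2 := congrArg (rN k) hIw
  rw [rN_mul, h.qe.rN_ext, rN_span] at e2
  have hnw : Algebra.intNorm (𝓞 k) (𝓞 K) w ≠ 0 := by rwa [Ne, Algebra.intNorm_eq_zero]
  have e3 := congrArg cls e2
  have hI2 : I' * I' ≠ ⊥ := mul_ne_zero hI' hI'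
  rw [cls_span hnw, sq, cls_mul hI2 hI2, ← sq] at e3
  have e4 := hk _ e3
  rw [cls_mul hI' hI', ← sq] at e4
  have e5 := hk _ e4
  rw [← hc', ← extendedHom_cls hI', e5, map_one]

end

section
open NumberField Module

/-- A biquadratic field generated by `A = √a`, `B = √b` with third subfield generated by
`√c`, `c g² = a b`. -/
structure BQ (K : Type*) [Field K] [NumberField K] (a b c g : ℤ) (A B : K) : Prop where
  gal : IsGalois ℚ K
  det : ∀ f h : K ≃ₐ[ℚ] K, f A = h A → f B = h B → f = h
  hA : A ^ 2 = (a : K)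
  hB : B ^ 2 = (b : K)
  sa : Squarefree a
  sb : Squarefree b
  sc : Squarefree c
  a0 : a < 0
  b0 : b < 0
  c1 : c ≠ 1
  g0 : g ≠ 0
  abc : a * b = c * g ^ 2

/-- The three automorphisms. -/
structure Sig {K : Type*} [Field K] [NumberField K] (A B : K) (σ1 σ2 σ3 : K ≃ₐ[ℚ] K) : Prop where
  a1 : σ1 A = A
  b1 : σ1 B = -B
  a2 : σ2 A = -A
  b2 : σ2 B = B
  a3 : σ3 A = -A
  b3 : σ3 B = -B

section
variable {K : Type*} [Field K] [NumberField K] {a b c g : ℤ} {A B : K}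

lemma sgn (h : A ^ 2 = (a : K)) (f : K ≃ₐ[ℚ] K) : f A = A ∨ f A = -A := by
  apply sq_eq_sq_iff_eq_or_eq_neg.mp
  rw [← map_pow, h, map_intCast]

lemma exists_sgn [IsGalois ℚ K] (h : A ^ 2 = (a : K)) (hq : ∀ q : ℚ, q ^ 2 ≠ (a : ℚ)) :
    ∃ f : K ≃ₐ[ℚ] K, f A = -A := by
  by_contra hc
  push Not at hc
  have : A ∈ Set.range (algebraMap ℚ K) := by
    rw [IsGalois.mem_range_algebraMap_iff_fixed]
    intro f
    exact (sgn h f).resolve_right (hc f)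
  obtain ⟨q, rfl⟩ := this
  apply hq q
  apply (algebraMap ℚ K).injective
  rw [map_pow, h]; simp

namespace BQ

lemma gK (h : BQ K a b c g A B) : (g : K) ≠ 0 := by exact_mod_cast h.g0

lemma hC (h : BQ K a b c g A B) : (A * B / g) ^ 2 = (c : K) := by
  have := h.gK
  rw [div_pow, mul_pow, h.hA, h.hB, div_eq_iff (by positivity)]
  exact_mod_cast h.abc

lemma Ane (h : BQ K a b c g A B) : A ≠ 0 := by
  intro h0
  have := h.hA
  rw [h0] at this
  have h1 : (a : K) = 0 := by rw [← this]; simp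
  have := h.a0
  have : a = 0 := by exact_mod_cast h1
  omega

lemma Bne (h : BQ K a b c g A B) : B ≠ 0 := by
  intro h0
  have := h.hB
  rw [h0] at this
  have h1 : (b : K) = 0 := by rw [← this]; simp
  have := h.b0
  have : b = 0 := by exact_mod_cast h1
  omega

lemma exists_sig (h : BQ K a b c g A B) : ∃ σ1 σ2 σ3 : K ≃ₐ[ℚ] K, Sig A B σ1 σ2 σ3 := by
  haveI := h.gal
  have ha := h.a0
  have hb := h.b0
  have hg : ∀ f : K ≃ₐ[ℚ] K, f (A * B / g) = f A * f B / g := fun f => by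
    rw [map_div₀, map_mul, map_intCast]
  have key : ∃ σ1 σ2 : K ≃ₐ[ℚ] K, σ1 A = A ∧ σ1 B = -B ∧ σ2 A = -A ∧ σ2 B = B := by
    obtain ⟨s, hs⟩ := exists_sgn h.hA (sqf_not_sq h.sa (by omega))
    obtain ⟨t, ht⟩ := exists_sgn h.hB (sqf_not_sq h.sb (by omega))
    obtain ⟨u, hu⟩ := exists_sgn h.hC (sqf_not_sq h.sc h.c1)
    have hAB : A * B ≠ 0 := mul_ne_zero h.Ane h.Bne
    have h2 : A * B ≠ -(A * B) := by
      intro e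
      have : (2 : K) * (A * B) = 0 := by linear_combination e
      simp [hAB] at this
    have hu' : u A * u B = -(A * B) := by
      rw [hg] at hu
      have := h.gK
      field_simp at hu
      exact hu
    rcases sgn h.hA u with h3 | h3 <;> rcases sgn h.hB u with h4 | h4 <;> rw [h3, h4] at hu'
    · exact absurd hu' h2
    · rcases sgn h.hB s with h5 | h5
      · exact ⟨u, s, h3, h4, hs, h5⟩
      · exact ⟨u, s * u, h3, h4, by simp [h3, hs], by simp [h4, h5]⟩
    · rcases sgn h.hA t with h5 | h5
      · exact ⟨t, u, h5, ht, h3, h4⟩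
      · exact ⟨t * u, u, by simp [h3, h5], by simp [h4, ht], h3, h4⟩
    · exact absurd (by linear_combination hu') h2
  obtain ⟨σ1, σ2, h1, h2, h3, h4⟩ := key
  exact ⟨σ1, σ2, σ2 * σ1, h1, h2, h3, h4, by simp [h1, h3], by simp [h2, h4]⟩

variable {σ1 σ2 σ3 : K ≃ₐ[ℚ] K}

lemma two_ne {x : K} (hx : x ≠ 0) : -x ≠ x := by
  intro e
  have : (2 : K) * x = 0 := by linear_combination -e
  simp [hx] at this

lemma sq1 (h : BQ K a b c g A B) (f : K ≃ₐ[ℚ] K) : f * f = 1 := by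
  apply h.det
  · rcases sgn h.hA f with e | e <;> simp [e]
  · rcases sgn h.hB f with e | e <;> simp [e]

lemma prod (h : BQ K a b c g A B) (s : Sig A B σ1 σ2 σ3) : σ2 * σ1 = σ3 :=
  h.det _ _ (by simp [s.a1, s.a2, s.a3]) (by simp [s.b1, s.b2, s.b3])

lemma all (h : BQ K a b c g A B) (s : Sig A B σ1 σ2 σ3) (f : K ≃ₐ[ℚ] K) :
    f = 1 ∨ f = σ1 ∨ f = σ2 ∨ f = σ3 := by
  rcases sgn h.hA f with e | e <;> rcases sgn h.hB f with e' | e'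
  · exact Or.inl (h.det _ _ (by simp [e]) (by simp [e']))
  · exact Or.inr (Or.inl (h.det _ _ (by rw [e, s.a1]) (by rw [e', s.b1])))
  · exact Or.inr (Or.inr (Or.inl (h.det _ _ (by rw [e, s.a2]) (by rw [e', s.b2]))))
  · exact Or.inr (Or.inr (Or.inr (h.det _ _ (by rw [e, s.a3]) (by rw [e', s.b3]))))

lemma ne1 (h : BQ K a b c g A B) (s : Sig A B σ1 σ2 σ3) : σ1 ≠ 1 := by
  rintro rfl; exact two_ne h.Bne s.b1.symm
lemma ne2 (h : BQ K a b c g A B) (s : Sig A B σ1 σ2 σ3) : σ2 ≠ 1 := by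
  rintro rfl; exact two_ne h.Ane s.a2.symm
lemma ne3 (h : BQ K a b c g A B) (s : Sig A B σ1 σ2 σ3) : σ3 ≠ 1 := by
  rintro rfl; exact two_ne h.Ane s.a3.symm

lemma card4 (h : BQ K a b c g A B) : Nat.card (K ≃ₐ[ℚ] K) = 4 := by
  classical
  obtain ⟨σ1, σ2, σ3, s⟩ := h.exists_sig
  have n12 : σ1 ≠ σ2 := by rintro rfl; exact two_ne h.Ane (s.a2.symm.trans s.a1)
  have n13 : σ1 ≠ σ3 := by rintro rfl; exact two_ne h.Ane (s.a3.symm.trans s.a1)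
  have n23 : σ2 ≠ σ3 := by rintro rfl; exact two_ne h.Bne (s.b3.symm.trans s.b2)
  have hu : (Finset.univ : Finset (K ≃ₐ[ℚ] K)) = {1, σ1, σ2, σ3} := by
    ext f; simpa using h.all s f
  rw [Nat.card_eq_fintype_card, ← Finset.card_univ, hu]
  rw [Finset.card_insert_of_notMem, Finset.card_insert_of_notMem, Finset.card_insert_of_notMem,
    Finset.card_singleton]
  · simpa using n23
  · simp [n12, n13]
  · simp [(h.ne1 s).symm, (h.ne2 s).symm, (h.ne3 s).symm]

lemma klein (h : BQ K a b c g A B) :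
    Nonempty ((K ≃ₐ[ℚ] K) ≃* (Fin 2 → Multiplicative (ZMod 2))) := by
  haveI : IsKleinFour (K ≃ₐ[ℚ] K) := by
    refine ⟨h.card4, ?_⟩
    have hd : Monoid.exponent (K ≃ₐ[ℚ] K) ∣ 2 :=
      Monoid.exponent_dvd_of_forall_pow_eq_one (fun f => by rw [pow_two]; exact h.sq1 f)
    rcases (Nat.dvd_prime Nat.prime_two).mp hd with e | e
    · rw [Monoid.exp_eq_one_iff] at e
      have := h.card4
      rw [Nat.card_of_subsingleton (1 : K ≃ₐ[ℚ] K)] at this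
      omega
    · exact e
  haveI : IsKleinFour (Fin 2 → Multiplicative (ZMod 2)) := by
    refine ⟨by simp, ?_⟩
    have hd : Monoid.exponent (Fin 2 → Multiplicative (ZMod 2)) ∣ 2 :=
      Monoid.exponent_dvd_of_forall_pow_eq_one (by decide)
    rcases (Nat.dvd_prime Nat.prime_two).mp hd with e | e
    · rw [Monoid.exp_eq_one_iff] at e
      exact absurd (e.elim (fun _ => 1) (fun _ => Multiplicative.ofAdd 1)) (by decide)
    · exact e
  exact IsKleinFour.nonempty_mulEquiv

lemma rank4 (h : BQ K a b c g A B) : finrank ℚ K = 4 := by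
  haveI := h.gal
  rw [← IsGalois.card_aut_eq_finrank, h.card4]

end BQ

/-- fixed field -/
noncomputable abbrev Fx (σ : K ≃ₐ[ℚ] K) : IntermediateField ℚ K :=
  IntermediateField.fixedField (Subgroup.zpowers σ)

lemma mem_Fx {σ : K ≃ₐ[ℚ] K} {x : K} : x ∈ Fx σ ↔ σ x = x := by
  rw [Fx, IntermediateField.mem_fixedField_iff]
  constructor
  · intro h; exact h σ (Subgroup.mem_zpowers σ)
  · intro h f hf
    have : Subgroup.zpowers σ ≤ MulAction.stabilizer (K ≃ₐ[ℚ] K) x := by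
      rw [Subgroup.zpowers_le]; exact h
    exact this hf

lemma QE_Fx [IsGalois ℚ K] {σ : K ≃ₐ[ℚ] K} (h : σ * σ = 1) (h1 : σ ≠ 1) : QE (Fx σ) σ := by
  classical
  have ho : orderOf σ = 2 := orderOf_eq_prime (by rw [pow_two, h]) h1
  have hr : finrank (Fx σ) K = 2 := by
    rw [IntermediateField.finrank_fixedField_eq_card, Nat.card_zpowers, ho]
  refine ⟨hr, fun x => ?_⟩
  let σ' : K ≃ₐ[Fx σ] K := IntermediateField.fixingSubgroupEquiv (Fx σ)
    ⟨σ, by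
      rw [IntermediateField.mem_fixingSubgroup_iff]
      intro y hy; exact mem_Fx.mp hy⟩
  have hσ' : ∀ y, σ' y = σ y := fun y => rfl
  have hne : σ' ≠ 1 := by
    intro e
    apply h1
    ext y
    rw [← hσ', e]; rfl
  have hc : Fintype.card (K ≃ₐ[Fx σ] K) = 2 := by
    rw [← Nat.card_eq_fintype_card, IsGalois.card_aut_eq_finrank, hr]
  have hu : (Finset.univ : Finset (K ≃ₐ[Fx σ] K)) = {1, σ'} := by
    symm
    apply Finset.eq_univ_of_card
    rw [Finset.card_pair hne.symm, hc]
  rw [Algebra.norm_eq_prod_automorphisms, hu, Finset.prod_pair hne.symm, hσ']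
  rfl

lemma QF_Fx (h4 : finrank ℚ K = 4) {σ : K ≃ₐ[ℚ] K} (h : QE (Fx σ) σ) {d : ℤ} {Δ : K}
    (hd : Squarefree d) (h1 : d ≠ 1) (hs : Δ ^ 2 = (d : K)) (hf : σ Δ = Δ) :
    QF (Fx σ) d (⟨Δ, mem_Fx.mpr hf⟩ : Fx σ) := by
  refine ⟨?_, hd, h1, ?_⟩
  · have := finrank_mul_finrank ℚ (Fx σ) K
    rw [h.rank, h4] at this
    omega
  · apply Subtype.ext
    push_cast
    exact hs

lemma Oth_Fx {σ τ : K ≃ₐ[ℚ] K} (h : QE (Fx σ) σ) {d : ℤ} {δ : Fx τ} (hq : QF (Fx τ) d δ)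
    (hn : σ (δ : K) = -δ) : Oth (Fx σ) (Fx τ) K := by
  intro x
  obtain ⟨u, v, rfl⟩ := hq.exists_coord x
  apply (algebraMap (Fx σ) K).injective
  rw [h.nrm, hq.norm_coord]
  have e1 : algebraMap (Fx τ) K ((u : Fx τ) + v * δ) = (u : K) + v * δ := by
    simp [map_add, map_mul]
  have e2 : ((δ : Fx τ) : K) ^ 2 = d := by
    have := congrArg (algebraMap (Fx τ) K) hq.sq
    simpa using this
  rw [e1, map_add, map_mul, hn, map_ratCast, map_ratCast]
  simp
  linear_combination -(v : K) ^ 2 * e2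
end

end

section
open NumberField Module

/-- The prime ramified in `ℚ(√a)`. -/
def rr (a : ℤ) : ℕ := if a = -1 then 2 else a.natAbs
/-- An integer in every ramified prime. -/
def nn (a : ℤ) : ℤ := if a % 4 = 1 then a else 4 * a

section
variable {K : Type} [Field K] [NumberField K] {a b c g : ℤ} {A B : K} {σ σ1 σ2 σ3 : K ≃ₐ[ℚ] K}

lemma int_sqrt (hA : A ^ 2 = (a : K)) : ∃ x : 𝓞 K, (x : K) = A := by
  have : IsIntegral ℤ A := by
    refine ⟨Polynomial.X ^ 2 - Polynomial.C a, Polynomial.monic_X_pow_sub_C _ two_ne_zero, ?_⟩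
    rw [Polynomial.eval₂_sub, Polynomial.eval₂_pow, Polynomial.eval₂_X, Polynomial.eval₂_C, hA]
    simp
  exact ⟨⟨A, this⟩, rfl⟩

lemma int_omega (hA : A ^ 2 = (a : K)) (h : a % 4 = 1) : ∃ x : 𝓞 K, 2 * (x : K) = 1 + A := by
  obtain ⟨e, he⟩ : ∃ e, a = 4 * e + 1 := ⟨a / 4, by omega⟩
  have h2 : (2 : K) ≠ 0 := two_ne_zero
  have : IsIntegral ℤ ((1 + A) / 2) := by
    refine ⟨Polynomial.X ^ 2 - (Polynomial.X + Polynomial.C e),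
      Polynomial.monic_X_pow_sub ?_, ?_⟩
    · exact by rw [Polynomial.degree_X_add_C]; norm_num
    · rw [Polynomial.eval₂_sub, Polynomial.eval₂_pow, Polynomial.eval₂_add, Polynomial.eval₂_X,
        Polynomial.eval₂_C, eq_intCast]
      rw [he] at hA; push_cast at hA
      linear_combination hA / 4
  exact ⟨⟨_, this⟩, by change 2 * ((1 + A) / 2) = 1 + A; field_simp⟩

lemma int_coe (z : ℤ) : ((z : 𝓞 K) : K) = z := map_intCast (algebraMap (𝓞 K) K) z

lemma ram_mem (hA : A ^ 2 = (a : K)) (hs : σ A = -A) {P : Ideal (𝓞 K)}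
    (hP : ∀ x : 𝓞 K, x - sg σ x ∈ P) : ((nn a : ℤ) : 𝓞 K) ∈ P := by
  rw [nn]; split_ifs with h
  · obtain ⟨x, hx⟩ := int_omega hA h
    have e1 : (x - sg σ x) ^ 2 = (a : 𝓞 K) := by
      apply RingOfIntegers.ext
      change ((x : K) - σ (x : K)) ^ 2 = (a : ℤ)
      have h2 : 2 * σ (x : K) = 1 - A := by
        have := congrArg σ hx
        rw [map_mul, map_add, map_one, hs, map_ofNat] at this
        rw [this]; ring
      have : (x : K) - σ (x : K) = A := by linear_combination (hx - h2) / 2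
      rw [this, hA]
    rw [← e1]; exact Ideal.pow_mem_of_mem _ (hP x) 2 (by norm_num)
  · obtain ⟨x, hx⟩ := int_sqrt hA
    have e1 : (x - sg σ x) ^ 2 = ((4 * a : ℤ) : 𝓞 K) := by
      apply RingOfIntegers.ext
      change ((x : K) - σ (x : K)) ^ 2 = (((4 * a : ℤ) : 𝓞 K) : K)
      rw [hx, hs, int_coe]; push_cast; linear_combination 4 * hA
    rw [← e1]; exact Ideal.pow_mem_of_mem _ (hP x) 2 (by norm_num)

lemma exists_mu (hA : A ^ 2 = (a : K)) (hs : σ A = -A) (ha : a < 0) :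
    ∃ M : 𝓞 K, (M : K) * σ (M : K) = (rr a : ℕ) ∧ (M : K) ^ 8 = ((rr a : ℕ) : K) ^ 4 := by
  obtain ⟨x, hx⟩ := int_sqrt hA
  rw [rr]; split_ifs with h
  · refine ⟨1 + x, ?_, ?_⟩
    · change (1 + (x : K)) * σ (1 + (x : K)) = _
      rw [map_add, hx, hs, map_one]
      rw [h] at hA; push_cast at hA ⊢
      linear_combination -hA
    · change (1 + (x : K)) ^ 8 = _
      rw [hx]
      rw [h] at hA; push_cast at hA ⊢
      have h2 : (1 + A) ^ 2 = 2 * A := by linear_combination hA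
      have h4 : (1 + A) ^ 4 = -4 := by
        rw [show (1 + A) ^ 4 = ((1 + A) ^ 2) ^ 2 by ring, h2]; linear_combination 4 * hA
      rw [show (1 + A) ^ 8 = ((1 + A) ^ 4) ^ 2 by ring, h4]; norm_num
  · have e : ((a.natAbs : ℕ) : K) = -(a : K) := by
      have : ((a.natAbs : ℕ) : ℤ) = -a := by omega
      have := congrArg (Int.cast : ℤ → K) this
      push_cast at this; simpa using this
    refine ⟨x, ?_, ?_⟩
    · rw [hx, hs, e]; linear_combination -hA
    · rw [hx, e, show A ^ 8 = (A ^ 2) ^ 4 by ring, hA]; ring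

lemma sqf_dvd_prime {m p : ℕ} (hp : p.Prime) (h : m ∣ p) : m = 1 ∨ m = p :=
  (Nat.dvd_prime hp).mp h

/-- The quadratic field `ℚ(√d)` has square class group of type `C₅ⁿ`. -/
def QS (d : ℤ) (n : ℕ) : Prop :=
  ∀ (k : Type) [Field k] [NumberField k] (δ : k), QF k d δ → SqC5 k n
def QI (d : ℤ) (n : ℕ) : Prop :=
  ∀ (k : Type) [Field k] [NumberField k] (δ : k), QF k d δ → IsC5 k n

namespace BQ

lemma fC (_h : BQ K a b c g A B) (f : K ≃ₐ[ℚ] K) : f (A * B / g) = f A * f B / g := by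
  rw [map_div₀, map_mul, map_intCast]

theorem main (h : BQ K a b c g A B) (s : Sig A B σ1 σ2 σ3)
    (conj : ∃ ψ : K →+* ℂ, ∀ x, ψ (σ3 x) = (starRingEnd ℂ) (ψ x))
    (mu : ∀ m : ℕ, Squarefree m → (m : ℤ) ∣ ramR c → ∃ μ : K, μ * σ3 μ = m ∧ μ ^ 8 = (m : K) ^ 4)
    (hram : QE (Fx σ3) σ3 →
      ∀ P : Ideal (𝓞 K), P.IsMaximal → P ≠ ⊥ → (∀ x : 𝓞 K, x - sg σ3 x ∈ P) → cls P = 1)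
    {n1 n2 n3 : ℕ} (q1 : QS a n1) (q2 : QS b n2) (q3 : QI c n3) :
    Nonempty (ClassGroup (𝓞 K) ≃* (Fin (n1 + n2 + n3) → Multiplicative (ZMod 5))) := by
  have hg := h.gal
  have ha := h.a0
  have hb := h.b0
  have e1 : QE (Fx σ1) σ1 := QE_Fx (h.sq1 _) (h.ne1 s)
  have e2 : QE (Fx σ2) σ2 := QE_Fx (h.sq1 _) (h.ne2 s)
  have e3 : QE (Fx σ3) σ3 := QE_Fx (h.sq1 _) (h.ne3 s)
  have c1 : σ1 (A * B / g) = -(A * B / g) := by rw [h.fC, s.a1, s.b1]; ring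
  have c2 : σ2 (A * B / g) = -(A * B / g) := by rw [h.fC, s.a2, s.b2]; ring
  have c3 : σ3 (A * B / g) = A * B / g := by rw [h.fC, s.a3, s.b3]; ring
  have f1 := QF_Fx h.rank4 e1 h.sa (by omega) h.hA s.a1
  have f2 := QF_Fx h.rank4 e2 h.sb (by omega) h.hB s.b2
  have f3 := QF_Fx h.rank4 e3 h.sc h.c1 h.hC c3
  have i3 := q3 _ _ f3
  have cm : CM (Fx σ3) c (⟨A * B / g, mem_Fx.mpr c3⟩ : Fx σ3) σ3 := by
    refine ⟨f3, e3, fun x => mem_Fx.mp x.2, ⟨σ1, c1, ?_⟩, conj, mu⟩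
    intro x
    have : σ1 * σ3 = σ3 * σ1 :=
      h.det _ _ (by simp [s.a1, s.a3]) (by simp [s.b1, s.b3])
    exact DFunLike.congr_fun this x
  have hodd := cm.odd (h.sq1 _) (h.ne3 s) (hram e3) (by
    intro x hx
    obtain ⟨ψ, hi, hs⟩ := i3
    obtain ⟨y, rfl⟩ := hs x
    rw [← map_pow] at hx
    rw [m5_sq y (hi (by rw [hx, map_one])), map_one])
  exact assemble e1 e2 e3 (h.prod s) (Oth_Fx e1 f2 s.b1) (Oth_Fx e1 f3 c1) (Oth_Fx e2 f1 s.a2)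
    (Oth_Fx e2 f3 c2) (Oth_Fx e3 f1 s.a3) (Oth_Fx e3 f2 s.b3) f1.rank f2.rank f3.rank
    (q1 _ _ f1) (q2 _ _ f2) i3.sq hodd

theorem fam1 (h : BQ K a b c g A B) (s : Sig A B σ1 σ2 σ3)
    (conj : ∃ ψ : K →+* ℂ, ∀ x, ψ (σ3 x) = (starRingEnd ℂ) (ψ x))
    (pa : (rr a).Prime) (pb : (rr b).Prime) (hc : (ramR c).natAbs = rr a * rr b)
    (hcop : IsCoprime (nn a) (nn b))
    {n1 n2 n3 : ℕ} (q1 : QS a n1) (q2 : QS b n2) (q3 : QI c n3) :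
    Nonempty (ClassGroup (𝓞 K) ≃* (Fin (n1 + n2 + n3) → Multiplicative (ZMod 5))) := by
  refine h.main s conj ?_ ?_ q1 q2 q3
  · intro m _ hm
    obtain ⟨M, hM, hM'⟩ := exists_mu h.hA s.a3 h.a0
    obtain ⟨N, hN, hN'⟩ := exists_mu h.hB s.b3 h.b0
    rw [Int.natCast_dvd, hc] at hm
    obtain ⟨m1, m2, h1, h2, rfl⟩ := exists_dvd_and_dvd_of_dvd_mul hm
    have k1 : ∃ μ : K, μ * σ3 μ = m1 ∧ μ ^ 8 = (m1 : K) ^ 4 := by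
      rcases sqf_dvd_prime pa h1 with rfl | rfl
      · exact ⟨1, by simp, by simp⟩
      · exact ⟨M, hM, hM'⟩
    have k2 : ∃ μ : K, μ * σ3 μ = m2 ∧ μ ^ 8 = (m2 : K) ^ 4 := by
      rcases sqf_dvd_prime pb h2 with rfl | rfl
      · exact ⟨1, by simp, by simp⟩
      · exact ⟨N, hN, hN'⟩
    obtain ⟨μ, u1, u2⟩ := k1
    obtain ⟨ν, v1, v2⟩ := k2
    refine ⟨μ * ν, ?_, ?_⟩
    · rw [map_mul]; push_cast; rw [← u1, ← v1]; ring
    · push_cast; rw [mul_pow, mul_pow, u2, v2]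
  · intro _ P hP _ hPx
    exfalso
    have h1 := ram_mem h.hA s.a3 hPx
    have h2 := ram_mem h.hB s.b3 hPx
    obtain ⟨u, v, huv⟩ := hcop
    apply hP.ne_top
    rw [Ideal.eq_top_iff_one]
    have : ((u : ℤ) : 𝓞 K) * (nn a : ℤ) + v * (nn b : ℤ) = 1 := by exact_mod_cast huv
    rw [← this]
    exact Ideal.add_mem _ (Ideal.mul_mem_left _ _ h1) (Ideal.mul_mem_left _ _ h2)

lemma int_mem_dvd {P : Ideal (𝓞 K)} (hP : P ≠ ⊤) {r : ℕ} (hr : r.Prime) (h : (r : 𝓞 K) ∈ P)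
    {z : ℤ} (hz : (z : 𝓞 K) ∈ P) : (r : ℤ) ∣ z := by
  by_contra hd
  have : IsCoprime (r : ℤ) z :=
    (Nat.prime_iff_prime_int.mp hr).coprime_iff_not_dvd.mpr hd
  obtain ⟨u, v, huv⟩ := this
  apply hP
  rw [Ideal.eq_top_iff_one]
  have : ((u : ℤ) : 𝓞 K) * (r : 𝓞 K) + v * (z : ℤ) = 1 := by exact_mod_cast huv
  rw [← this]
  exact Ideal.add_mem _ (Ideal.mul_mem_left _ _ h) (Ideal.mul_mem_left _ _ hz)

theorem fam2 (h : BQ K a b c g A B) (s : Sig A B σ1 σ2 σ3)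
    (conj : ∃ ψ : K →+* ℂ, ∀ x, ψ (σ3 x) = (starRingEnd ℂ) (ψ x))
    (pa : (rr a).Prime) (pc : c.natAbs.Prime) (c0 : 0 < c) (hc : ramR c = c) (hd : nn a ∣ (rr a : ℤ) ^ 4)
    (hin : rr a ≠ 2 ∧ ¬ IsSquare (c : ZMod (rr a)) ∨ rr a = 2 ∧ c % 8 = 5)
    {n1 n2 n3 : ℕ} (q1 : QS a n1) (q2 : QS b n2) (q3 : QI c n3) :
    Nonempty (ClassGroup (𝓞 K) ≃* (Fin (n1 + n2 + n3) → Multiplicative (ZMod 5))) := by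
  have c3 : σ3 (A * B / g) = A * B / g := by rw [h.fC, s.a3, s.b3]; ring
  refine h.main s conj ?_ ?_ q1 q2 q3
  · intro m _ hm
    rw [hc, Int.natCast_dvd] at hm
    rcases sqf_dvd_prime pc hm with rfl | rfl
    · exact ⟨1, by simp, by simp⟩
    · have e : ((c.natAbs : ℕ) : K) = (c : K) := by
        have : ((c.natAbs : ℕ) : ℤ) = c := by omega
        rw [← Int.cast_natCast, this]
      refine ⟨A * B / g, ?_, ?_⟩
      · rw [c3, e, ← h.hC]; ring
      · rw [e, ← h.hC]; ring
  · intro e3 P hP hP0 hPx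
    have hPp := hP.isPrime
    have h1 := ram_mem h.hA s.a3 hPx
    obtain ⟨M, hM, hM'⟩ := exists_mu h.hA s.a3 h.a0
    have hr : ((rr a : ℕ) : 𝓞 K) ∈ P := by
      obtain ⟨e, he⟩ := hd
      apply hPp.mem_of_pow_mem 4
      have : ((rr a : ℕ) : 𝓞 K) ^ 4 = (nn a : ℤ) * (e : 𝓞 K) := by exact_mod_cast he
      rw [this]
      exact Ideal.mul_mem_right _ _ h1
    have hMO : M ^ 8 = ((rr a : ℕ) : 𝓞 K) ^ 4 := by
      apply RingOfIntegers.ext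
      simpa using hM'
    have hMP : M ∈ P := by
      apply hPp.mem_of_pow_mem 8
      rw [hMO]; exact Ideal.pow_mem_of_mem _ hr 4 (by norm_num)
    have hM0 : M ≠ 0 := by
      rintro rfl
      have := pa.ne_zero
      apply this
      have h0 : ((rr a : ℕ) : 𝓞 K) = 0 := by
        apply pow_eq_zero_iff (n := 4) (by norm_num) |>.mp
        rw [← hMO]; simp
      exact_mod_cast h0
    have hn : Ideal.absNorm (Ideal.span {M}) = (rr a) ^ 2 := by
      rw [← absNorm_rN (k := Fx σ3), rN_span]
      have : Algebra.intNorm (𝓞 (Fx σ3)) (𝓞 K) M = ((rr a : ℕ) : 𝓞 (Fx σ3)) := by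
        apply RingOfIntegers.ext
        rw [coe_intNorm]
        apply (algebraMap (Fx σ3) K).injective
        rw [e3.nrm, hM]; simp
      rw [this, Ideal.absNorm_span_natCast]
      have hrk : finrank ℤ (𝓞 (Fx σ3)) = 2 := by
        rw [RingOfIntegers.rank]
        have := finrank_mul_finrank ℚ (Fx σ3) K
        rw [e3.rank, h.rank4] at this
        omega
      rw [hrk]
    have hle : Ideal.span {M} ≤ P := by rwa [Ideal.span_singleton_le_iff_mem]
    have hdv : Ideal.absNorm P ∣ (rr a) ^ 2 := by
      rw [← hn]; exact Ideal.absNorm_dvd_absNorm_of_le hle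
    obtain ⟨i, hi, hPi⟩ := (Nat.dvd_prime_pow pa).mp hdv
    have hfin : Ideal.span {M} = P := by
      apply eq_of_le_norm hP0 hle
      rw [hn, hPi]
      congr 1
      by_contra h2
      have : i = 0 ∨ i = 1 := by omega
      rcases this with rfl | rfl
      · rw [pow_zero, Ideal.absNorm_eq_one_iff] at hPi
        exact hP.ne_top hPi
      · rw [pow_one] at hPi
        rcases hin with ⟨k2, kk⟩ | ⟨k2, kk⟩
        · obtain ⟨x, hx⟩ := int_sqrt h.hC
          obtain ⟨n, hn⟩ := residue_int pa hPi x
          apply kk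
          have : ((c - n ^ 2 : ℤ) : 𝓞 K) ∈ P := by
            have e : ((c - n ^ 2 : ℤ) : 𝓞 K) = (x + n) * (x - n) := by
              have hx2 : x ^ 2 = (c : 𝓞 K) := by
                apply RingOfIntegers.ext
                change (x : K) ^ 2 = _
                rw [hx, h.hC]; simp
              push_cast; linear_combination -hx2
            rw [e]; exact Ideal.mul_mem_left _ _ hn
          have hd := int_mem_dvd hP.ne_top pa hr this
          rw [← ZMod.intCast_zmod_eq_zero_iff_dvd] at hd
          push_cast at hd
          exact ⟨n, by linear_combination hd⟩
        · obtain ⟨x, hx⟩ := int_omega h.hC (by omega)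
          obtain ⟨n, hn⟩ := residue_int pa hPi x
          obtain ⟨e, he⟩ : ∃ e, c = 8 * e + 5 := ⟨c / 8, by omega⟩
          have : (((2 * e + 1) - (n ^ 2 - n) : ℤ) : 𝓞 K) ∈ P := by
            have e : (((2 * e + 1) - (n ^ 2 - n) : ℤ) : 𝓞 K) = (x + n - 1) * (x - n) := by
              have hx2 : x ^ 2 - x = ((2 * e + 1 : ℤ) : 𝓞 K) := by
                apply RingOfIntegers.ext
                change (x : K) ^ 2 - x = _
                have := h.hC
                rw [he] at this
                rw [int_coe]
                push_cast at this ⊢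
                have hx' : (x : K) = (1 + A * B / g) / 2 := by linear_combination hx / 2
                rw [hx']
                linear_combination this / 4
              push_cast at hx2 ⊢; linear_combination -hx2
            rw [e]; exact Ideal.mul_mem_left _ _ hn
          have hd := int_mem_dvd hP.ne_top pa hr this
          rw [k2] at hd
          have h3 : (2 : ℤ) ∣ (n : ℤ) ^ 2 - n := by
            rcases Int.even_or_odd (n : ℤ) with ⟨t, ht⟩ | ⟨t, ht⟩
            · exact ⟨2 * t ^ 2 - t, by rw [ht]; ring⟩
            · exact ⟨2 * t ^ 2 + t, by rw [ht]; ring⟩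
          push_cast at hd
          omega
    rw [← hfin]; exact cls_span hM0

end BQ
end

end

section
open NumberField Module

section
open Polynomial

/-- The defining polynomial. -/
noncomputable def pol (a b : ℤ) : ℚ[X] := (X ^ 2 - C (a : ℚ)) * (X ^ 2 - C (b : ℚ))

/-- `ℚ(√a, √b)` inside `ℂ`. -/
noncomputable def Kf (a b : ℤ) : IntermediateField ℚ ℂ :=
  IntermediateField.adjoin ℚ ((pol a b).rootSet ℂ)

lemma pol_ne (a b : ℤ) : pol a b ≠ 0 :=
  mul_ne_zero (X_pow_sub_C_ne_zero two_pos _) (X_pow_sub_C_ne_zero two_pos _)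

lemma mem_roots_pol {a b : ℤ} {z : ℂ} : z ∈ (pol a b).rootSet ℂ ↔ z ^ 2 = a ∨ z ^ 2 = b := by
  rw [mem_rootSet, and_iff_right (pol_ne a b), pol]
  simp [sub_eq_zero]

instance (a b : ℤ) : (pol a b).IsSplittingField ℚ (Kf a b) :=
  IntermediateField.adjoin_rootSet_isSplittingField (IsAlgClosed.splits _)

instance (a b : ℤ) : FiniteDimensional ℚ (Kf a b) :=
  IsSplittingField.finiteDimensional _ (pol a b)

instance (a b : ℤ) : NumberField (Kf a b) := ⟨⟩

instance (a b : ℤ) : Normal ℚ (Kf a b) := Normal.of_isSplittingField (pol a b)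

instance (a b : ℤ) : IsGalois ℚ (Kf a b) := ⟨⟩
end

lemma sq_mem {a b : ℤ} {z : ℂ} (h : z ^ 2 = a ∨ z ^ 2 = b) : z ∈ Kf a b :=
  IntermediateField.subset_adjoin _ _ (mem_roots_pol.mpr h)

lemma Kf_ext {a b : ℤ} {A B : Kf a b} (hA : A ^ 2 = (a : Kf a b)) (hB : B ^ 2 = (b : Kf a b))
    (f h : Kf a b →ₐ[ℚ] ℂ) (h1 : f A = h A) (h2 : f B = h B) : f = h := by
  apply IntermediateField.algHom_ext_of_eq_adjoin ℚ (S := Kf a b) (s := (pol a b).rootSet ℂ) rfl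
  intro x hx
  rcases mem_roots_pol.mp hx with e | e
  · set y : Kf a b := ⟨x, sq_mem (Or.inl e)⟩
    have hy : y ^ 2 = A ^ 2 := by
      rw [hA]; apply Subtype.ext; simpa using e
    change f y = h y
    rcases sq_eq_sq_iff_eq_or_eq_neg.mp hy with e | e <;> rw [e]
    · exact h1
    · rw [map_neg, map_neg, h1]
  · set y : Kf a b := ⟨x, sq_mem (Or.inr e)⟩
    have hy : y ^ 2 = B ^ 2 := by
      rw [hB]; apply Subtype.ext; simpa using e
    change f y = h y
    rcases sq_eq_sq_iff_eq_or_eq_neg.mp hy with e | e <;> rw [e]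
    · exact h2
    · rw [map_neg, map_neg, h2]

lemma conj_sqrt {a : ℤ} (ha : a < 0) {z : ℂ} (h : z ^ 2 = a) :
    (starRingEnd ℂ) z = -z ∧ z.im ≠ 0 := by
  have h1 := congrArg Complex.re h
  have h2 := congrArg Complex.im h
  simp [pow_two] at h1 h2
  have ha' : (a : ℝ) < 0 := by exact_mod_cast ha
  have him : z.im ≠ 0 := by
    intro h0; rw [h0] at h1; nlinarith [mul_self_nonneg z.re]
  have hre : z.re = 0 := by
    have : z.re * z.im = 0 := by linarith
    exact (mul_eq_zero.mp this).resolve_right him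
  refine ⟨?_, him⟩
  apply Complex.ext <;> simp [hre]

/-- Arithmetic conditions on the parameters. -/
structure Par (a b c g : ℤ) : Prop where
  sa : Squarefree a
  sb : Squarefree b
  sc : Squarefree c
  ba : b < a
  a0 : a < 0
  c1 : c ≠ 1
  g0 : g ≠ 0
  abc : a * b = c * g ^ 2

lemma Par.bq {a b c g : ℤ} (p : Par a b c g) : ∃ A B : Kf a b, BQ (Kf a b) a b c g A B := by
  obtain ⟨x, hx⟩ := IsAlgClosed.exists_pow_nat_eq ((a : ℤ) : ℂ) two_pos
  obtain ⟨y, hy⟩ := IsAlgClosed.exists_pow_nat_eq ((b : ℤ) : ℂ) two_pos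
  have hA : (⟨x, sq_mem (Or.inl hx)⟩ : Kf a b) ^ 2 = (a : Kf a b) := by
    apply Subtype.ext; simpa using hx
  have hB : (⟨y, sq_mem (Or.inr hy)⟩ : Kf a b) ^ 2 = (b : Kf a b) := by
    apply Subtype.ext; simpa using hy
  refine ⟨⟨x, sq_mem (Or.inl hx)⟩, ⟨y, sq_mem (Or.inr hy)⟩, inferInstance, ?_, hA, hB, p.sa, p.sb,
    p.sc, p.a0, p.ba.trans p.a0, p.c1, p.g0, p.abc⟩
  intro f h h1 h2
  have := Kf_ext hA hB ((Kf a b).val.comp f.toAlgHom) ((Kf a b).val.comp h.toAlgHom)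
    (congrArg (Kf a b).val h1) (congrArg (Kf a b).val h2)
  ext z
  exact DFunLike.congr_fun this z

lemma exists_conj {a b c g : ℤ} {A B : Kf a b} (h : BQ (Kf a b) a b c g A B)
    {σ1 σ2 σ3 : Kf a b ≃ₐ[ℚ] Kf a b} (s : Sig A B σ1 σ2 σ3) :
    ∃ ψ : Kf a b →+* ℂ, ∀ x, ψ (σ3 x) = (starRingEnd ℂ) (ψ x) := by
  have hA' : (A : ℂ) ^ 2 = a := by simpa using congrArg (Kf a b).val h.hA
  have hB' : (B : ℂ) ^ 2 = b := by simpa using congrArg (Kf a b).val h.hB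
  refine ⟨(Kf a b).val.toRingHom, fun x => ?_⟩
  have := Kf_ext h.hA h.hB ((Kf a b).val.comp σ3.toAlgHom)
    (((Complex.conjAe.toAlgHom).restrictScalars ℚ).comp (Kf a b).val)
    (by
      change ((σ3 A : Kf a b) : ℂ) = (starRingEnd ℂ) (A : ℂ)
      rw [(conj_sqrt h.a0 hA').1, s.a3]; rfl)
    (by
      change ((σ3 B : Kf a b) : ℂ) = (starRingEnd ℂ) (B : ℂ)
      rw [(conj_sqrt h.b0 hB').1, s.b3]; rfl)
  exact DFunLike.congr_fun this x

/-- The required properties of `Kf a b`. -/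
def Res (a b : ℤ) (n : ℕ) : Prop :=
  IsNQuadratic 2 (Kf a b) ∧ IsImaginary (Kf a b) ∧
    Nonempty (ClassGroup (𝓞 (Kf a b)) ≃* (Fin n → Multiplicative (ZMod 5)))

theorem Par.res {a b c g : ℤ} (p : Par a b c g) {n : ℕ}
    (h : ∀ (A B : Kf a b) (σ1 σ2 σ3 : Kf a b ≃ₐ[ℚ] Kf a b), BQ (Kf a b) a b c g A B →
      Sig A B σ1 σ2 σ3 → (∃ ψ : Kf a b →+* ℂ, ∀ x, ψ (σ3 x) = (starRingEnd ℂ) (ψ x)) →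
      Nonempty (ClassGroup (𝓞 (Kf a b)) ≃* (Fin n → Multiplicative (ZMod 5)))) : Res a b n := by
  obtain ⟨A, B, hb⟩ := p.bq
  obtain ⟨σ1, σ2, σ3, s⟩ := hb.exists_sig
  have hA' : (A : ℂ) ^ 2 = a := by simpa using congrArg (Kf a b).val hb.hA
  exact ⟨⟨inferInstance, inferInstance, hb.klein⟩, ⟨A, (conj_sqrt p.a0 hA').2⟩,
    h A B σ1 σ2 σ3 hb s (exists_conj hb s)⟩

theorem Par.fam1 {a b c g : ℤ} (p : Par a b c g)
    (pa : (rr a).Prime) (pb : (rr b).Prime) (hc : (ramR c).natAbs = rr a * rr b)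
    (hcop : IsCoprime (nn a) (nn b))
    {n1 n2 n3 : ℕ} (q1 : QS a n1) (q2 : QS b n2) (q3 : QI c n3) : Res a b (n1 + n2 + n3) :=
  p.res fun _ _ _ _ _ h s conj => h.fam1 s conj pa pb hc hcop q1 q2 q3

theorem Par.fam2 {a b c g : ℤ} (p : Par a b c g)
    (pa : (rr a).Prime) (pc : c.natAbs.Prime) (c0 : 0 < c) (hc : ramR c = c)
    (hd : nn a ∣ (rr a : ℤ) ^ 4)
    (hin : rr a ≠ 2 ∧ ¬ IsSquare (c : ZMod (rr a)) ∨ rr a = 2 ∧ c % 8 = 5)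
    {n1 n2 n3 : ℕ} (q1 : QS a n1) (q2 : QS b n2) (q3 : QI c n3) : Res a b (n1 + n2 + n3) :=
  p.res fun _ _ _ _ _ h s conj => h.fam2 s conj pa pc c0 hc hd hin q1 q2 q3

lemma sqf_eq {e d : ℤ} (he : Squarefree e) (hd : Squarefree d) {q : ℚ}
    (h : (e : ℚ) * d = q ^ 2) : e = d := by
  have hi : IsSquare ((e * d : ℤ) : ℚ) := ⟨q, by push_cast; rw [h]; ring⟩
  rw [Rat.isSquare_intCast_iff] at hi
  obtain ⟨r, hr⟩ := hi
  have h1 : e ∣ r := by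
    rw [← he.dvd_pow_iff_dvd (n := 2) two_ne_zero]; exact ⟨d, by rw [hr]; ring⟩
  obtain ⟨t, rfl⟩ := h1
  have h2 : d = e * (t * t) := by
    apply mul_left_cancel₀ he.ne_zero
    rw [hr]; ring
  have hu := hd t ⟨e, by rw [h2]; ring⟩
  rcases Int.isUnit_iff.mp hu with e | e <;> subst e <;> simp at h2 <;> exact h2.symm

lemma BQ.sq_cases {K : Type} [Field K] [NumberField K] {a b c g : ℤ} {A B : K}
    (h : BQ K a b c g A B) {e : ℤ} (he : Squarefree e) {x : K} (hx : x ^ 2 = (e : K)) :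
    e = 1 ∨ e = a ∨ e = b ∨ e = c := by
  obtain ⟨σ1, σ2, σ3, s⟩ := h.exists_sig
  have hg := h.gal
  have key : ∀ {d : ℤ} {D : K}, Squarefree d → D ^ 2 = (d : K) → σ1 (x * D) = x * D →
      σ2 (x * D) = x * D → e = d := by
    intro d D hd hD h1 h2
    have : x * D ∈ Set.range (algebraMap ℚ K) := by
      rw [IsGalois.mem_range_algebraMap_iff_fixed]
      intro f
      rcases h.all s f with rfl | rfl | rfl | rfl
      · rfl
      · exact h1
      · exact h2
      · rw [← h.prod s, AlgEquiv.mul_apply, h1, h2]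
    obtain ⟨q, hq⟩ := this
    apply sqf_eq he hd (q := q)
    apply (algebraMap ℚ K).injective
    rw [map_pow, hq, mul_pow, hx, hD]; simp
  have c1 : σ1 (A * B / g) = -(A * B / g) := by rw [h.fC, s.a1, s.b1]; ring
  have c2 : σ2 (A * B / g) = -(A * B / g) := by rw [h.fC, s.a2, s.b2]; ring
  rcases sgn hx σ1 with h1 | h1 <;> rcases sgn hx σ2 with h2 | h2
  · exact Or.inl (key (D := 1) squarefree_one (by simp) (by simp [h1]) (by simp [h2]))
  · exact Or.inr (Or.inl (key h.sa h.hA (by simp [h1, s.a1]) (by simp [h2, s.a2])))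
  · exact Or.inr (Or.inr (Or.inl (key h.sb h.hB (by simp [h1, s.b1]) (by simp [h2, s.b2]))))
  · exact Or.inr (Or.inr (Or.inr (key h.sc h.hC (by rw [map_mul, c1, h1]; ring)
      (by rw [map_mul, c2, h2]; ring))))

lemma Par.c0 {a b c g : ℤ} (p : Par a b c g) : 0 < c := by
  have h1 : 0 < a * b := mul_pos_of_neg_of_neg p.a0 (p.ba.trans p.a0)
  rw [p.abc] at h1
  exact pos_of_mul_pos_left h1 (sq_nonneg g)

theorem Par.inj {a b c g a' b' c' g' : ℤ} (p : Par a b c g) (p' : Par a' b' c' g')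
    (h : Kf a b = Kf a' b') : a = a' ∧ b = b' := by
  obtain ⟨A, B, hb⟩ := p.bq
  have hc := p.c0
  have key : ∀ e : ℤ, Squarefree e → e < 0 → (∃ z : ℂ, z ^ 2 = e ∧ z ∈ Kf a' b') →
      e = a ∨ e = b := by
    rintro e he he0 ⟨z, hz, hm⟩
    rw [← h] at hm
    have := hb.sq_cases he (x := ⟨z, hm⟩) (by apply Subtype.ext; simpa using hz)
    omega
  obtain ⟨x, hx⟩ := IsAlgClosed.exists_pow_nat_eq ((a' : ℤ) : ℂ) two_pos
  obtain ⟨y, hy⟩ := IsAlgClosed.exists_pow_nat_eq ((b' : ℤ) : ℂ) two_pos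
  have h1 := key a' p'.sa p'.a0 ⟨x, hx, sq_mem (Or.inl hx)⟩
  have h2 := key b' p'.sb (p'.ba.trans p'.a0) ⟨y, hy, sq_mem (Or.inr hy)⟩
  have := p.ba
  have := p'.ba
  omega

theorem exists_finset {l : List (ℤ × ℤ)} (hl : l.Nodup) {n : ℕ}
    (h : ∀ p ∈ l, Res p.1 p.2 n ∧ ∃ c g, Par p.1 p.2 c g) {N : ℕ} (hN : l.length = N) :
    ∃ S : Finset (IntermediateField ℚ ℂ), N ≤ S.card ∧
      ∀ K ∈ S, IsNQuadratic 2 K ∧ IsImaginary K ∧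
        Nonempty (ClassGroup (𝓞 K) ≃* (Fin n → Multiplicative (ZMod 5))) := by
  classical
  refine ⟨(l.map fun p => Kf p.1 p.2).toFinset, ?_, ?_⟩
  · rw [List.toFinset_card_of_nodup, List.length_map, hN]
    apply hl.map_on
    intro p hp q hq e
    obtain ⟨c, g, h1⟩ := (h p hp).2
    obtain ⟨c', g', h2⟩ := (h q hq).2
    exact Prod.ext_iff.mpr (h1.inj h2 e)
  · intro K hK
    rw [List.mem_toFinset, List.mem_map] at hK
    obtain ⟨p, hp, rfl⟩ := hK
    exact (h p hp).1

end

section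
open NumberField Module

/-- Evaluate the argument before continuing. -/
def frc {α : Type} (n : Nat) (k : Nat → α) : α := Nat.rec (k 0) (fun m _ => k (Nat.succ m)) n
def cnd {α : Type} (b : Bool) (t e : α) : α := Bool.rec e t b

lemma frc_eq {α : Type} (n : Nat) (k : Nat → α) : frc n k = k n := by cases n <;> rfl
lemma cnd_eq {α : Type} (b : Bool) (t e : α) : cnd b t e = if b = true then t else e := by
  cases b <;> rfl

/-- Product of the primes below 200. -/
def P200 : Nat := 7799922041683461553249199106329813876687996789903550945093032474868511536164700810
/-- Characteristic bits of the primes below 200. -/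
def msk : Nat := 1020032875410759681235134578348735197776366020317731447515308

/-- Quick primality test below 40000. -/
def isP (n : Nat) : Bool :=
  cnd (Nat.ble 200 n) (cnd (Nat.beq (Nat.gcd n P200) 1) (Nat.ble n 39999) false) (Nat.testBit msk n)

lemma P200_prod : P200 = ((List.range 200).filter (fun n => Nat.testBit msk n)).prod := by
  decide +kernel

lemma not_dvd_P200 {p : ℕ} (hp : p.Prime) (h : 200 ≤ p) : ¬ p ∣ P200 := by
  rw [P200_prod, hp.prime.dvd_prod_iff]
  rintro ⟨a, ha, hd⟩
  rw [List.mem_filter, List.mem_range] at ha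
  have ha0 : a ≠ 0 := by
    rintro rfl
    exact absurd ha.2 (by decide +kernel)
  have := Nat.le_of_dvd (Nat.pos_of_ne_zero ha0) hd
  omega

lemma small_dvd : ∀ p < 200, p.Prime → p ∣ P200 := by decide +kernel
lemma small_msk : ∀ p < 200, Nat.testBit msk p = true → p.Prime := by decide +kernel

lemma isP_prime {n : ℕ} (h : isP n = true) : n.Prime := by
  rw [isP, cnd_eq] at h
  split_ifs at h with h1
  · rw [cnd_eq] at h
    split_ifs at h with h2
    · have h200 : 200 ≤ n := Nat.le_of_ble_eq_true h1
      have hn : n ≤ 39999 := Nat.le_of_ble_eq_true h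
      have hg : Nat.gcd n P200 = 1 := Nat.eq_of_beq_eq_true h2
      by_contra hc
      have hm := Nat.minFac_sq_le_self (by omega) hc
      have hp := Nat.minFac_prime (n := n) (by omega)
      have hlt : n.minFac < 200 := by nlinarith
      have := Nat.dvd_gcd (Nat.minFac_dvd n) (small_dvd _ hlt hp)
      rw [hg, Nat.dvd_one] at this
      exact hp.one_lt.ne' this
  · have : n < 200 := by
      by_contra hc
      exact h1 (Nat.ble_eq_true_of_le (by omega))
    exact small_msk n this h

/-- The primes up to 10789. -/
def plist : List Nat := [
  2, 3, 5, 7, 11, 13, 17, 19, 23, 29, 31, 37, 41, 43, 47, 53, 59, 61, 67, 71, 73, 79, 83, 89, 97,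
  101, 103, 107, 109, 113, 127, 131, 137, 139, 149, 151, 157, 163, 167, 173, 179, 181, 191, 193,
  197, 199, 211, 223, 227, 229, 233, 239, 241, 251, 257, 263, 269, 271, 277, 281, 283, 293, 307,
  311, 313, 317, 331, 337, 347, 349, 353, 359, 367, 373, 379, 383, 389, 397, 401, 409, 419, 421,
  431, 433, 439, 443, 449, 457, 461, 463, 467, 479, 487, 491, 499, 503, 509, 521, 523, 541, 547,
  557, 563, 569, 571, 577, 587, 593, 599, 601, 607, 613, 617, 619, 631, 641, 643, 647, 653, 659,
  661, 673, 677, 683, 691, 701, 709, 719, 727, 733, 739, 743, 751, 757, 761, 769, 773, 787, 797,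
  809, 811, 821, 823, 827, 829, 839, 853, 857, 859, 863, 877, 881, 883, 887, 907, 911, 919, 929,
  937, 941, 947, 953, 967, 971, 977, 983, 991, 997, 1009, 1013, 1019, 1021, 1031, 1033, 1039,
  1049, 1051, 1061, 1063, 1069, 1087, 1091, 1093, 1097, 1103, 1109, 1117, 1123, 1129, 1151, 1153,
  1163, 1171, 1181, 1187, 1193, 1201, 1213, 1217, 1223, 1229, 1231, 1237, 1249, 1259, 1277, 1279,
  1283, 1289, 1291, 1297, 1301, 1303, 1307, 1319, 1321, 1327, 1361, 1367, 1373, 1381, 1399, 1409,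
  1423, 1427, 1429, 1433, 1439, 1447, 1451, 1453, 1459, 1471, 1481, 1483, 1487, 1489, 1493, 1499,
  1511, 1523, 1531, 1543, 1549, 1553, 1559, 1567, 1571, 1579, 1583, 1597, 1601, 1607, 1609, 1613,
  1619, 1621, 1627, 1637, 1657, 1663, 1667, 1669, 1693, 1697, 1699, 1709, 1721, 1723, 1733, 1741,
  1747, 1753, 1759, 1777, 1783, 1787, 1789, 1801, 1811, 1823, 1831, 1847, 1861, 1867, 1871, 1873,
  1877, 1879, 1889, 1901, 1907, 1913, 1931, 1933, 1949, 1951, 1973, 1979, 1987, 1993, 1997, 1999,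
  2003, 2011, 2017, 2027, 2029, 2039, 2053, 2063, 2069, 2081, 2083, 2087, 2089, 2099, 2111, 2113,
  2129, 2131, 2137, 2141, 2143, 2153, 2161, 2179, 2203, 2207, 2213, 2221, 2237, 2239, 2243, 2251,
  2267, 2269, 2273, 2281, 2287, 2293, 2297, 2309, 2311, 2333, 2339, 2341, 2347, 2351, 2357, 2371,
  2377, 2381, 2383, 2389, 2393, 2399, 2411, 2417, 2423, 2437, 2441, 2447, 2459, 2467, 2473, 2477,
  2503, 2521, 2531, 2539, 2543, 2549, 2551, 2557, 2579, 2591, 2593, 2609, 2617, 2621, 2633, 2647,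
  2657, 2659, 2663, 2671, 2677, 2683, 2687, 2689, 2693, 2699, 2707, 2711, 2713, 2719, 2729, 2731,
  2741, 2749, 2753, 2767, 2777, 2789, 2791, 2797, 2801, 2803, 2819, 2833, 2837, 2843, 2851, 2857,
  2861, 2879, 2887, 2897, 2903, 2909, 2917, 2927, 2939, 2953, 2957, 2963, 2969, 2971, 2999, 3001,
  3011, 3019, 3023, 3037, 3041, 3049, 3061, 3067, 3079, 3083, 3089, 3109, 3119, 3121, 3137, 3163,
  3167, 3169, 3181, 3187, 3191, 3203, 3209, 3217, 3221, 3229, 3251, 3253, 3257, 3259, 3271, 3299,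
  3301, 3307, 3313, 3319, 3323, 3329, 3331, 3343, 3347, 3359, 3361, 3371, 3373, 3389, 3391, 3407,
  3413, 3433, 3449, 3457, 3461, 3463, 3467, 3469, 3491, 3499, 3511, 3517, 3527, 3529, 3533, 3539,
  3541, 3547, 3557, 3559, 3571, 3581, 3583, 3593, 3607, 3613, 3617, 3623, 3631, 3637, 3643, 3659,
  3671, 3673, 3677, 3691, 3697, 3701, 3709, 3719, 3727, 3733, 3739, 3761, 3767, 3769, 3779, 3793,
  3797, 3803, 3821, 3823, 3833, 3847, 3851, 3853, 3863, 3877, 3881, 3889, 3907, 3911, 3917, 3919,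
  3923, 3929, 3931, 3943, 3947, 3967, 3989, 4001, 4003, 4007, 4013, 4019, 4021, 4027, 4049, 4051,
  4057, 4073, 4079, 4091, 4093, 4099, 4111, 4127, 4129, 4133, 4139, 4153, 4157, 4159, 4177, 4201,
  4211, 4217, 4219, 4229, 4231, 4241, 4243, 4253, 4259, 4261, 4271, 4273, 4283, 4289, 4297, 4327,
  4337, 4339, 4349, 4357, 4363, 4373, 4391, 4397, 4409, 4421, 4423, 4441, 4447, 4451, 4457, 4463,
  4481, 4483, 4493, 4507, 4513, 4517, 4519, 4523, 4547, 4549, 4561, 4567, 4583, 4591, 4597, 4603,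
  4621, 4637, 4639, 4643, 4649, 4651, 4657, 4663, 4673, 4679, 4691, 4703, 4721, 4723, 4729, 4733,
  4751, 4759, 4783, 4787, 4789, 4793, 4799, 4801, 4813, 4817, 4831, 4861, 4871, 4877, 4889, 4903,
  4909, 4919, 4931, 4933, 4937, 4943, 4951, 4957, 4967, 4969, 4973, 4987, 4993, 4999, 5003, 5009,
  5011, 5021, 5023, 5039, 5051, 5059, 5077, 5081, 5087, 5099, 5101, 5107, 5113, 5119, 5147, 5153,
  5167, 5171, 5179, 5189, 5197, 5209, 5227, 5231, 5233, 5237, 5261, 5273, 5279, 5281, 5297, 5303,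
  5309, 5323, 5333, 5347, 5351, 5381, 5387, 5393, 5399, 5407, 5413, 5417, 5419, 5431, 5437, 5441,
  5443, 5449, 5471, 5477, 5479, 5483, 5501, 5503, 5507, 5519, 5521, 5527, 5531, 5557, 5563, 5569,
  5573, 5581, 5591, 5623, 5639, 5641, 5647, 5651, 5653, 5657, 5659, 5669, 5683, 5689, 5693, 5701,
  5711, 5717, 5737, 5741, 5743, 5749, 5779, 5783, 5791, 5801, 5807, 5813, 5821, 5827, 5839, 5843,
  5849, 5851, 5857, 5861, 5867, 5869, 5879, 5881, 5897, 5903, 5923, 5927, 5939, 5953, 5981, 5987,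
  6007, 6011, 6029, 6037, 6043, 6047, 6053, 6067, 6073, 6079, 6089, 6091, 6101, 6113, 6121, 6131,
  6133, 6143, 6151, 6163, 6173, 6197, 6199, 6203, 6211, 6217, 6221, 6229, 6247, 6257, 6263, 6269,
  6271, 6277, 6287, 6299, 6301, 6311, 6317, 6323, 6329, 6337, 6343, 6353, 6359, 6361, 6367, 6373,
  6379, 6389, 6397, 6421, 6427, 6449, 6451, 6469, 6473, 6481, 6491, 6521, 6529, 6547, 6551, 6553,
  6563, 6569, 6571, 6577, 6581, 6599, 6607, 6619, 6637, 6653, 6659, 6661, 6673, 6679, 6689, 6691,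
  6701, 6703, 6709, 6719, 6733, 6737, 6761, 6763, 6779, 6781, 6791, 6793, 6803, 6823, 6827, 6829,
  6833, 6841, 6857, 6863, 6869, 6871, 6883, 6899, 6907, 6911, 6917, 6947, 6949, 6959, 6961, 6967,
  6971, 6977, 6983, 6991, 6997, 7001, 7013, 7019, 7027, 7039, 7043, 7057, 7069, 7079, 7103, 7109,
  7121, 7127, 7129, 7151, 7159, 7177, 7187, 7193, 7207, 7211, 7213, 7219, 7229, 7237, 7243, 7247,
  7253, 7283, 7297, 7307, 7309, 7321, 7331, 7333, 7349, 7351, 7369, 7393, 7411, 7417, 7433, 7451,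
  7457, 7459, 7477, 7481, 7487, 7489, 7499, 7507, 7517, 7523, 7529, 7537, 7541, 7547, 7549, 7559,
  7561, 7573, 7577, 7583, 7589, 7591, 7603, 7607, 7621, 7639, 7643, 7649, 7669, 7673, 7681, 7687,
  7691, 7699, 7703, 7717, 7723, 7727, 7741, 7753, 7757, 7759, 7789, 7793, 7817, 7823, 7829, 7841,
  7853, 7867, 7873, 7877, 7879, 7883, 7901, 7907, 7919, 7927, 7933, 7937, 7949, 7951, 7963, 7993,
  8009, 8011, 8017, 8039, 8053, 8059, 8069, 8081, 8087, 8089, 8093, 8101, 8111, 8117, 8123, 8147,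
  8161, 8167, 8171, 8179, 8191, 8209, 8219, 8221, 8231, 8233, 8237, 8243, 8263, 8269, 8273, 8287,
  8291, 8293, 8297, 8311, 8317, 8329, 8353, 8363, 8369, 8377, 8387, 8389, 8419, 8423, 8429, 8431,
  8443, 8447, 8461, 8467, 8501, 8513, 8521, 8527, 8537, 8539, 8543, 8563, 8573, 8581, 8597, 8599,
  8609, 8623, 8627, 8629, 8641, 8647, 8663, 8669, 8677, 8681, 8689, 8693, 8699, 8707, 8713, 8719,
  8731, 8737, 8741, 8747, 8753, 8761, 8779, 8783, 8803, 8807, 8819, 8821, 8831, 8837, 8839, 8849,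
  8861, 8863, 8867, 8887, 8893, 8923, 8929, 8933, 8941, 8951, 8963, 8969, 8971, 8999, 9001, 9007,
  9011, 9013, 9029, 9041, 9043, 9049, 9059, 9067, 9091, 9103, 9109, 9127, 9133, 9137, 9151, 9157,
  9161, 9173, 9181, 9187, 9199, 9203, 9209, 9221, 9227, 9239, 9241, 9257, 9277, 9281, 9283, 9293,
  9311, 9319, 9323, 9337, 9341, 9343, 9349, 9371, 9377, 9391, 9397, 9403, 9413, 9419, 9421, 9431,
  9433, 9437, 9439, 9461, 9463, 9467, 9473, 9479, 9491, 9497, 9511, 9521, 9533, 9539, 9547, 9551,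
  9587, 9601, 9613, 9619, 9623, 9629, 9631, 9643, 9649, 9661, 9677, 9679, 9689, 9697, 9719, 9721,
  9733, 9739, 9743, 9749, 9767, 9769, 9781, 9787, 9791, 9803, 9811, 9817, 9829, 9833, 9839, 9851,
  9857, 9859, 9871, 9883, 9887, 9901, 9907, 9923, 9929, 9931, 9941, 9949, 9967, 9973, 10007,
  10009, 10037, 10039, 10061, 10067, 10069, 10079, 10091, 10093, 10099, 10103, 10111, 10133,
  10139, 10141, 10151, 10159, 10163, 10169, 10177, 10181, 10193, 10211, 10223, 10243, 10247,
  10253, 10259, 10267, 10271, 10273, 10289, 10301, 10303, 10313, 10321, 10331, 10333, 10337,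
  10343, 10357, 10369, 10391, 10399, 10427, 10429, 10433, 10453, 10457, 10459, 10463, 10477,
  10487, 10499, 10501, 10513, 10529, 10531, 10559, 10567, 10589, 10597, 10601, 10607, 10613,
  10627, 10631, 10639, 10651, 10657, 10663, 10667, 10687, 10691, 10709, 10711, 10723, 10729,
  10733, 10739, 10753, 10771, 10781, 10789]

/-- Coverage check: the list contains all primes from `n` on. -/
def cov (fuel : Nat) : Nat → List Nat → Bool :=
  Nat.rec (fun _ _ => true) (fun _ ih n l =>
    List.rec false
      (fun h t _ => cnd (Nat.beq h n) (frc (Nat.succ n) fun m => ih m t)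
        (cnd (cnd (Nat.ble 200 n) (Nat.beq (Nat.gcd n P200) 1) (Nat.testBit msk n)) false
          (frc (Nat.succ n) fun m => ih m (h :: t)))) l) fuel

lemma cov_plist : cov 10788 2 plist = true := by decide +kernel

/-- Final check with a test `T`. -/
def fin (B : Nat) (T : Nat → Bool) (l : List Nat) : Bool :=
  List.rec true (fun h _ ih => cnd (Nat.ble h B) (cnd (T h) ih false) true) l

lemma fin_cons (B : Nat) (T : Nat → Bool) (h : Nat) (t : List Nat) :
    fin B T (h :: t) = cnd (Nat.ble h B) (cnd (T h) (fin B T t) false) true := rfl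

lemma fin_spec (B : Nat) (T : Nat → Bool) (fuel : Nat) : ∀ (n : Nat) (l : List Nat),
    cov fuel n l = true → fin B T l = true → ∀ p : ℕ, p.Prime → n ≤ p → p < n + fuel → p ≤ B →
    T p = true := by
  have hmsk : ∀ p < 200, p.Prime → Nat.testBit msk p = true := by decide +kernel
  induction fuel with
  | zero => intro n l _ _ p _ h1 h2; omega
  | succ f ih =>
    intro n l hc hf p hp h1 h2 hB
    cases l with
    | nil =>
      exact absurd hc (by change ¬ (false = true); decide)
    | cons h t =>
      have e : cov (f + 1) n (h :: t) = cnd (Nat.beq h n) (frc (Nat.succ n) fun m => cov f m t)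
        (cnd (cnd (Nat.ble 200 n) (Nat.beq (Nat.gcd n P200) 1) (Nat.testBit msk n)) false
          (frc (Nat.succ n) fun m => cov f m (h :: t))) := rfl
      rw [e, cnd_eq, frc_eq, cnd_eq, frc_eq] at hc
      have hf' := hf
      rw [fin_cons, cnd_eq, cnd_eq] at hf'
      split_ifs at hc with h3 h5
      · have h3' : h = n := Nat.eq_of_beq_eq_true h3
        subst h3'
        rw [if_pos (Nat.ble_eq_true_of_le (by omega : h ≤ B))] at hf'
        split_ifs at hf' with h6
        rcases Nat.eq_or_lt_of_le h1 with h4 | h4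
        · subst h4; exact h6
        · exact ih _ _ hc hf' p hp h4 (by omega) hB
      · rcases Nat.eq_or_lt_of_le h1 with h4 | h4
        · subst h4
          exfalso
          apply h5
          rw [cnd_eq]
          split_ifs with h6
          · have h7 : 200 ≤ n := Nat.le_of_ble_eq_true h6
            have : Nat.gcd n P200 = 1 := by
              rw [← Nat.coprime_iff_gcd_eq_one, hp.coprime_iff_not_dvd]
              exact not_dvd_P200 hp h7
            rw [this]; rfl
          · apply hmsk _ _ hp
            by_contra hc
            exact h6 (Nat.ble_eq_true_of_le (by omega))
        · exact ih _ _ hc hf p hp h4 (by omega) hB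

end

section
open NumberField Module

/-- Remove all common factors with `G`. -/
def strip (fuel n G : Nat) : Nat :=
  (Nat.rec (fun n => n) (fun _ ih n =>
    frc (Nat.gcd n G) fun g => cnd (Nat.beq g 1) n (frc (Nat.div n g) ih)) fuel : Nat → Nat) n

lemma strip_succ (f n G : Nat) :
    strip (f + 1) n G = if Nat.gcd n G = 1 then n else strip f (n / Nat.gcd n G) G := by
  have e : strip (f + 1) n G = frc (Nat.gcd n G) fun g => cnd (Nat.beq g 1) n
    (frc (Nat.div n g) fun n => strip f n G) := rfl
  rw [e, frc_eq, cnd_eq, frc_eq]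
  have : (Nat.beq (Nat.gcd n G) 1 = true) ↔ Nat.gcd n G = 1 := Nat.beq_eq.to_iff
  simp only [this]
  rfl

lemma strip_zero (G : Nat) : ∀ f, strip f 0 G = 0 := by
  intro f
  induction f with
  | zero => rfl
  | succ f ih => rw [strip_succ, Nat.zero_div, ih, ite_self]

lemma strip_spec (G : Nat) : ∀ (f n : Nat), n ≠ 0 →
    ∃ m, m ≠ 0 ∧ n = strip f n G * m ∧ ∀ p : ℕ, p.Prime → p ∣ m → p ∣ G := by
  intro f
  induction f with
  | zero => exact fun n hn => ⟨1, one_ne_zero, (mul_one n).symm, fun p hp h => absurd h hp.not_dvd_one⟩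
  | succ f ih =>
    intro n hn
    rw [strip_succ]
    split_ifs with h1
    · exact ⟨1, one_ne_zero, (mul_one n).symm, fun p hp h => absurd h hp.not_dvd_one⟩
    · have hg : Nat.gcd n G ≠ 0 := by
        intro h; exact hn (Nat.eq_zero_of_gcd_eq_zero_left h)
      have hd : n / Nat.gcd n G * Nat.gcd n G = n := Nat.div_mul_cancel (Nat.gcd_dvd_left n G)
      obtain ⟨m, hm, e, hp⟩ := ih (n / Nat.gcd n G) (by
        intro h; rw [h, zero_mul] at hd; exact hn hd.symm)
      refine ⟨m * Nat.gcd n G, mul_ne_zero hm hg, ?_, ?_⟩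
      · rw [← mul_assoc, ← e, hd]
      · intro p hpp hpd
        rcases hpp.dvd_mul.mp hpd with h | h
        · exact hp p hpp h
        · exact h.trans (Nat.gcd_dvd_right n G)

/-- Update the product of known good primes. -/
def upd (n G : Nat) : Nat := frc (strip 20 n G) fun r => cnd (isP r) (Nat.mul G r) G

/-- The number `n` is the absolute norm of an integer. -/
def RepN (d : ℤ) (n : ℕ) : Prop := ∃ X Y : ℤ, (X ^ 2 - d * Y ^ 2).natAbs = 4 * n

section
variable {k : Type} [Field k] [NumberField k] {d : ℤ} {δ : k} {H : Subgroup (ClassGroup (𝓞 k))}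

/-- All prime divisors are good. -/
def GG (H : Subgroup (ClassGroup (𝓞 k))) (G : ℕ) : Prop := ∀ p : ℕ, p.Prime → p ∣ G → Good H p

lemma GG_one : GG H 1 := fun _ hp h => absurd h hp.not_dvd_one

lemma GG_mul {m n : ℕ} (hm : GG H m) (hn : GG H n) : GG H (m * n) := by
  intro p hp h
  rcases hp.dvd_mul.mp h with h | h
  · exact hm p hp h
  · exact hn p hp h

lemma GG_prime {p : ℕ} (hp : p.Prime) (h : Good H p) : GG H p := by
  intro q hq hd
  rwa [(Nat.prime_dvd_prime_iff_eq hq hp).mp hd]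

lemma GG_upd (h : QF k d δ) {n G : ℕ} (hr : RepN d n) (hG : GG H G) : GG H (upd n G) := by
  rw [upd, frc_eq, cnd_eq]
  split_ifs with hp
  · have hp := isP_prime hp
    have hn : n ≠ 0 := by
      rintro rfl
      rw [strip_zero] at hp
      exact Nat.not_prime_zero hp
    obtain ⟨m, hm, e, hq⟩ := strip_spec G 20 n hn
    obtain ⟨X, Y, hXY⟩ := hr
    refine GG_mul hG (GG_prime hp ?_)
    refine h.good_of_rep hp hm (X := X) (Y := Y) (by rw [← e, hXY]) ?_
    intro r hr hrm
    exact hG r hr (hq r hr hrm)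
  · exact hG

/-- Walk along the cycle of reduced forms. -/
def walk (s fuel : Nat) : Nat → Nat → Nat → Nat → Nat :=
  Nat.rec (fun _ _ _ G => G) (fun _ ih a b c G =>
    frc (upd a G) fun G =>
    frc (Nat.div (Nat.add s b) (Nat.mul 2 c)) fun k =>
    frc (Nat.mul c k) fun v => frc (Nat.mul 2 v) fun t =>
    frc (Nat.mul v k) fun v => frc (Nat.add a (Nat.mul b k)) fun u =>
    cnd (Nat.ble b t) (cnd (Nat.ble v u)
      (frc (Nat.sub t b) fun nb => frc (Nat.sub u v) fun c' => ih c nb c' G) G) G) fuel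

lemma GG_walk (h : QF k d δ) (s : ℕ) : ∀ (f a b c G : ℕ),
    (∀ x y : ℤ, RepN d (a * x ^ 2 + b * x * y - c * y ^ 2 : ℤ).natAbs) → GG H G →
    GG H (walk s f a b c G) := by
  intro f
  induction f with
  | zero => intro a b c G _ hG; exact hG
  | succ f ih =>
    intro a b c G hf hG
    have e : walk s (f + 1) a b c G = frc (upd a G) fun G =>
      frc (Nat.div (Nat.add s b) (Nat.mul 2 c)) fun k =>
      frc (Nat.mul c k) fun v => frc (Nat.mul 2 v) fun t =>
      frc (Nat.mul v k) fun v => frc (Nat.add a (Nat.mul b k)) fun u =>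
      cnd (Nat.ble b t) (cnd (Nat.ble v u)
      (frc (Nat.sub t b) fun nb => frc (Nat.sub u v) fun c' => walk s f c nb c' G) G) G := rfl
    rw [e]
    simp only [frc_eq, cnd_eq]
    generalize Nat.div (Nat.add s b) (Nat.mul 2 c) = K
    have hG' : GG H (upd a G) := by
      refine GG_upd h ?_ hG
      simpa using hf 1 0
    split_ifs with h1 h2
    · have h1 := Nat.le_of_ble_eq_true h1
      have h2 := Nat.le_of_ble_eq_true h2
      refine ih _ _ _ _ ?_ hG'
      intro x y
      have := hf y (x + K * y)
      rw [← Int.natAbs_neg] at this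
      have e1 : ((Nat.sub (Nat.mul 2 (Nat.mul c K)) b : ℕ) : ℤ) = 2 * (c * K) - b := by
        have := Nat.cast_sub (R := ℤ) h1
        refine this.trans ?_
        simp
      have e2 : ((Nat.sub (Nat.add a (Nat.mul b K)) (Nat.mul (Nat.mul c K) K) : ℕ) : ℤ)
          = a + b * K - c * K * K := by
        have := Nat.cast_sub (R := ℤ) h2
        refine this.trans ?_
        simp
      rw [e1, e2]
      convert this using 2
      ring
    · exact hG'
    · exact hG'

/-- Inertness test. -/
def inr (u l : Nat) : Bool :=
  cnd (Nat.beq l 2) (Nat.beq (Nat.mod u 8) 5)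
    (Nat.beq (Nat.mod (Nat.pow (Nat.mod u l) (Nat.div (Nat.sub l 1) 2)) l) (Nat.sub l 1))

lemma euler_neg {u l : ℕ} (hl : l.Prime) (h : (u % l) ^ ((l - 1) / 2) % l = l - 1) :
    (u : ZMod l) ^ ((l - 1) / 2) = -1 := by
  have := congrArg (fun n : ℕ => (n : ZMod l)) h
  simpa [Nat.cast_sub hl.one_le] using this

lemma good_inr (h : QF k d δ) {u l : ℕ} (hl : l.Prime) (hu : (8 * l : ℤ) ∣ u - d)
    (ht : inr u l = true) : Good H l := by
  rw [inr, cnd_eq] at ht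
  split_ifs at ht with h1
  · obtain rfl : l = 2 := Nat.eq_of_beq_eq_true h1
    have h2 : u % 8 = 5 := Nat.eq_of_beq_eq_true ht
    exact h.good_inert_two H (by omega)
  · have h2 := Nat.eq_of_beq_eq_true ht
    have hne : l ≠ 2 := by rintro rfl; exact h1 rfl
    refine h.good_inert_odd H hl hne ?_
    have h3 := euler_neg hl h2
    have h4 : ((u - d : ℤ) : ZMod l) = 0 := by
      rw [ZMod.intCast_zmod_eq_zero_iff_dvd]
      exact (dvd_mul_left _ _).trans hu
    rw [← h3]
    congr 1
    push_cast at h4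
    exact (sub_eq_zero.mp h4).symm

/-- Test for the primes of a real field. -/
def tR (d G l : Nat) : Bool := cnd (Nat.beq (Nat.mod G l) 0) true (inr d l)
/-- Test for the primes of an imaginary field. -/
def tI (e G l : Nat) : Bool :=
  cnd (Nat.beq (Nat.mod G l) 0) true (inr (Nat.mul e (Nat.sub (Nat.mul 8 l) 1)) l)

lemma good_tR (h : QF k d δ) {e G l : ℕ} (he : d = e) (hG : GG H G) (hl : l.Prime)
    (ht : tR e G l = true) : Good H l := by
  rw [tR, cnd_eq] at ht
  split_ifs at ht with h1
  · exact hG l hl (Nat.dvd_of_mod_eq_zero (Nat.eq_of_beq_eq_true h1))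
  · refine good_inr h hl ?_ ht
    rw [he]; simp

lemma good_tI (h : QF k d δ) {e G l : ℕ} (he : d = -e) (hG : GG H G) (hl : l.Prime)
    (ht : tI e G l = true) : Good H l := by
  rw [tI, cnd_eq] at ht
  split_ifs at ht with h1
  · exact hG l hl (Nat.dvd_of_mod_eq_zero (Nat.eq_of_beq_eq_true h1))
  · refine good_inr h hl ?_ ht
    have := hl.two_le
    have e1 : ((Nat.mul e (Nat.sub (Nat.mul 8 l) 1) : ℕ) : ℤ) = e * (8 * l - 1) := by
      have h2 : 1 ≤ 8 * l := by omega
      have := Nat.cast_sub (R := ℤ) h2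
      change ((e * (8 * l - 1) : ℕ) : ℤ) = _
      rw [Nat.cast_mul, this]; simp
    rw [e1, he]
    exact ⟨e, by ring⟩

lemma fin_plist {B : ℕ} {T : ℕ → Bool} (hB : B ≤ 10789) (h : fin B T plist = true) {l : ℕ}
    (hl : l.Prime) (hlB : l ≤ B) : T l = true :=
  fin_spec B T 10788 2 plist cov_plist h l hl hl.two_le (by omega) hlB

/-- Certificate check for real fields. -/
def checkR (d s W G0 : Nat) : Bool :=
  frc (cnd (Nat.beq (Nat.mod d 4) 1) d (Nat.mul 4 d)) fun D =>
  frc (cnd (Nat.beq (Nat.mod (Nat.add s D) 2) 0) s (Nat.sub s 1)) fun b =>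
  frc (Nat.div (Nat.sub D (Nat.mul b b)) 4) fun c =>
  frc (Nat.div s 2) fun B =>
  cnd (Nat.beq (Nat.add (Nat.mul b b) (Nat.mul 4 c)) D)
    (cnd (Nat.ble (Nat.succ D) (Nat.mul 4 (Nat.mul (Nat.succ B) (Nat.succ B))))
      (cnd (Nat.ble B 10789)
        (frc (walk s W 1 b c G0) fun G => fin B (tR d G) plist) false) false) false

lemma checkR_top {e s W G0 : ℕ} (hc : checkR e s W G0 = true) (he0 : 0 < e) (he : d = e)
    (h : QF k d δ) (hG : GG H G0) : H = ⊤ := by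
  rw [checkR] at hc
  simp only [frc_eq] at hc
  set D := (cnd (Nat.beq (Nat.mod e 4) 1) e (Nat.mul 4 e)) with hD
  generalize (cnd (Nat.beq (Nat.mod (Nat.add s D) 2) 0) s (Nat.sub s 1)) = b at hc
  generalize Nat.div (Nat.sub D (Nat.mul b b)) 4 = c at hc
  generalize Nat.div s 2 = B at hc
  simp only [cnd_eq] at hc
  split_ifs at hc with h1 h2 h3
  have h1 : b * b + 4 * c = D := Nat.eq_of_beq_eq_true h1
  have h2 : D + 1 ≤ 4 * ((B + 1) * (B + 1)) := Nat.le_of_ble_eq_true h2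
  have h3 := Nat.le_of_ble_eq_true h3
  have hD' : D = if e % 4 = 1 then e else 4 * e := by
    rw [hD, cnd_eq]
    have : (Nat.beq (Nat.mod e 4) 1 = true) ↔ e % 4 = 1 := Nat.beq_eq.to_iff
    simp only [this]
    rfl
  have hDz : (if d % 4 = 1 then d else 4 * d : ℤ) = D := by
    rw [hD', he]
    split_ifs <;> first | omega | (push_cast; rfl)
  have h1z : (b * b + 4 * c : ℤ) = D := by exact_mod_cast h1
  refine h.top_real (by omega) (B := B) ?_ ?_
  · rw [hDz]
    have : (D : ℤ) + 1 ≤ 4 * ((B + 1) * (B + 1)) := by exact_mod_cast h2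
    nlinarith
  · intro l hl hlB
    have hw : GG H (walk s W 1 b c G0) := by
      refine GG_walk h s W 1 b c G0 ?_ hG
      intro x y
      have key : 4 * (((1 : ℕ) : ℤ) * x ^ 2 + b * x * y - c * y ^ 2) = (2 * x + b * y) ^ 2 - D * y ^ 2 := by
        rw [← h1z]; push_cast; ring
      obtain ⟨Y, hY⟩ : ∃ Y : ℤ, d * Y ^ 2 = D * y ^ 2 := by
        rw [← hDz]
        split_ifs
        · exact ⟨y, rfl⟩
        · exact ⟨2 * y, by ring⟩
      refine ⟨2 * x + b * y, Y, ?_⟩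
      rw [hY, ← key, Int.natAbs_mul]
      rfl
    exact good_tR h he hw hl (fin_plist h3 hc hl hlB)

/-- Values of the principal form of an imaginary field. -/
def iw (p c fuel : Nat) : Nat → Nat → Nat :=
  Nat.rec (fun _ G => G) (fun _ ih x G =>
    frc (upd (Nat.add (Nat.mul x (Nat.add x p)) c) G) fun G => frc (Nat.succ x) fun x => ih x G) fuel

lemma GG_iw (h : QF k d δ) {p c : ℕ} (hf : ∀ x : ℕ, RepN d (x * (x + p) + c)) : ∀ (f x G : ℕ),
    GG H G → GG H (iw p c f x G) := by
  intro f
  induction f with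
  | zero => exact fun _ _ h => h
  | succ f ih =>
    intro x G hG
    have e : iw p c (f + 1) x G = frc (upd (Nat.add (Nat.mul x (Nat.add x p)) c) G) fun G =>
      frc (Nat.succ x) fun x => iw p c f x G := rfl
    rw [e]
    simp only [frc_eq]
    exact ih _ _ (GG_upd h (hf x) hG)

/-- Certificate check for imaginary fields. -/
def checkI (e W B G0 : Nat) : Bool :=
  frc (cnd (Nat.beq (Nat.mod e 4) 3) 1 0) fun p =>
  frc (cnd (Nat.beq p 1) (Nat.div (Nat.add e 1) 4) e) fun c =>
  cnd (Nat.ble (Nat.succ (cnd (Nat.beq p 1) (Nat.mul 4 e) (Nat.mul 16 e)))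
      (Nat.mul 9 (Nat.mul (Nat.succ B) (Nat.succ B))))
    (cnd (Nat.ble B 10789)
      (frc (iw p c W 0 (Nat.mul (Nat.mul G0 e) (cnd (Nat.beq (Nat.mod e 4) 1) 2 1)))
        fun G => fin B (tI e G) plist) false) false

lemma checkI_top {e W B G0 : ℕ} (hc : checkI e W B G0 = true) (he : d = -e)
    (h : QF k d δ) {S : Subgroup (ClassGroup (𝓞 k))}
    (hG : GG (S.comap (powMonoidHom 2)) G0) : S.comap (powMonoidHom 2) = ⊤ := by
  rw [checkI] at hc
  simp only [frc_eq] at hc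
  set p := (cnd (Nat.beq (Nat.mod e 4) 3) 1 0) with hp
  set c := (cnd (Nat.beq p 1) (Nat.div (Nat.add e 1) 4) e) with hc'
  have hp' : p = if e % 4 = 3 then 1 else 0 := by
    rw [hp, cnd_eq]
    have : (Nat.beq (Nat.mod e 4) 3 = true) ↔ e % 4 = 3 := Nat.beq_eq.to_iff
    simp only [this]
  have hpp : (Nat.beq p 1 = true) ↔ e % 4 = 3 := by
    have : (Nat.beq p 1 = true) ↔ p = 1 := Nat.beq_eq.to_iff
    rw [this, hp']
    split_ifs with h1 <;> simp [h1]
  have hc'' : c = if e % 4 = 3 then (e + 1) / 4 else e := by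
    rw [hc', cnd_eq]
    simp only [hpp]
    rfl
  have hq : (Nat.beq (Nat.mod e 4) 1 = true) ↔ e % 4 = 1 := Nat.beq_eq.to_iff
  simp only [cnd_eq, hpp, hq] at hc
  clear_value p c
  have hif1 : ∀ {b t : Bool}, (if b = true then t else false) = true → b = true ∧ t = true := by
    decide
  obtain ⟨h2, hc⟩ := hif1 hc
  obtain ⟨h3, hc⟩ := hif1 hc
  have h2 : (if e % 4 = 3 then 4 * e else 16 * e) + 1 ≤ 9 * ((B + 1) * (B + 1)) :=
    Nat.le_of_ble_eq_true h2
  have h3 := Nat.le_of_ble_eq_true h3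
  refine h.top_imag (B := B) ?_ ?_
  · have h2z : ((if e % 4 = 3 then 4 * e else 16 * e : ℕ) : ℤ) + 1 ≤ 9 * ((B + 1) * (B + 1)) := by
      exact_mod_cast h2
    have : 4 * |(if d % 4 = 1 then d else 4 * d : ℤ)| = ((if e % 4 = 3 then 4 * e else 16 * e : ℕ) : ℤ) := by
      rw [abs_of_nonpos (by split_ifs <;> omega)]
      split_ifs <;> push_cast <;> omega
    rw [this]
    nlinarith
  · intro l hl hlB
    refine good_tI h he (GG_iw h ?_ W 0 _ ?_) hl (fin_plist h3 hc hl hlB)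
    · intro x
      by_cases h4 : e % 4 = 3
      · rw [hp', hc'', if_pos h4, if_pos h4]
        obtain ⟨t, ht⟩ : ∃ t, e = 4 * t + 3 := ⟨e / 4, by omega⟩
        refine ⟨2 * x + 1, 1, ?_⟩
        have : (e + 1) / 4 = t + 1 := by omega
        rw [this, he, ht]
        zify
        rw [abs_of_nonneg]
        · push_cast; ring
        · push_cast; nlinarith
      · rw [hp', hc'', if_neg h4, if_neg h4]
        refine ⟨2 * x, 2, ?_⟩
        rw [he]
        zify
        rw [abs_of_nonneg]
        · push_cast; ring
        · push_cast; nlinarith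
    · refine GG_mul (GG_mul hG ?_) ?_
      · intro r hr hrd
        refine h.good_ram_dvd S hr ?_
        rw [he, dvd_neg]
        exact_mod_cast hrd
      · split_ifs with h4
        · exact GG_prime Nat.prime_two (h.good_ram_two S (by omega))
        · exact GG_one
end

end

section
open NumberField Module

/-- Newton iteration. -/
def nwt (m fuel : Nat) : Nat → Nat :=
  Nat.rec (fun t => t) (fun _ ih t => frc (Nat.div (Nat.add t (Nat.div m t)) 2) ih) fuel

/-- Certified non-square. -/
def nsq (m : Nat) : Bool :=
  frc (nwt m 30 m) fun t =>
  cnd (Nat.beq (Nat.mul t t) m) false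
    (cnd (Nat.ble (Nat.succ m) (Nat.mul (Nat.succ t) (Nat.succ t)))
      (Nat.ble (Nat.succ (Nat.mul (Nat.pred t) (Nat.pred t))) m) false)

lemma nsq_spec {m : ℕ} (h : nsq m = true) (x : ℕ) : x * x ≠ m := by
  rw [nsq, frc_eq, cnd_eq, cnd_eq] at h
  generalize nwt m 30 m = t at h
  split_ifs at h with h1 h2
  have h1 : ¬ t * t = m := by
    intro h0
    apply h1
    rw [Nat.beq_eq]; exact h0
  have h2 : m + 1 ≤ (t + 1) * (t + 1) := Nat.le_of_ble_eq_true h2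
  have h : (t - 1) * (t - 1) + 1 ≤ m := Nat.le_of_ble_eq_true h
  intro hx
  have a : x < t + 1 := by
    by_contra hc
    have := Nat.mul_le_mul (not_lt.mp hc) (not_lt.mp hc)
    omega
  have b : t - 1 < x := by
    by_contra hc
    have := Nat.mul_le_mul (not_lt.mp hc) (not_lt.mp hc)
    omega
  obtain rfl : x = t := by omega
  exact h1 hx

/-- Non-representability of `m` by `X^2 + e Y^2`, from `Y` on. -/
def nr (e m fuel : Nat) : Nat → Bool :=
  Nat.rec (fun _ => false) (fun _ ih Y => frc (Nat.mul e (Nat.mul Y Y)) fun v =>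
    cnd (Nat.ble v m) (cnd (nsq (Nat.sub m v)) (frc (Nat.succ Y) ih) false) true) fuel

lemma nr_spec {e m : ℕ} : ∀ (f Y : ℕ), nr e m f Y = true → ∀ X Y' : ℕ, Y ≤ Y' →
    X * X + e * (Y' * Y') ≠ m := by
  intro f
  induction f with
  | zero => intro Y h; exact absurd h (by change ¬ (false = true); decide)
  | succ f ih =>
    intro Y h X Y' hY
    have e1 : nr e m (f + 1) Y = frc (Nat.mul e (Nat.mul Y Y)) fun v =>
      cnd (Nat.ble v m) (cnd (nsq (Nat.sub m v)) (frc (Nat.succ Y) (nr e m f)) false) true := rfl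
    rw [e1] at h
    simp only [frc_eq, cnd_eq] at h
    split_ifs at h with h1 h2
    · rcases Nat.eq_or_lt_of_le hY with h3 | h3
      · subst h3
        have := nsq_spec h2 X
        intro h4
        apply this
        change _ = m - e * (Y * Y)
        omega
      · exact ih _ h X Y' h3
    · have h1 : ¬ e * (Y * Y) ≤ m := fun h0 => h1 (Nat.ble_eq_true_of_le h0)
      have := Nat.mul_le_mul_left e (Nat.mul_le_mul hY hY)
      omega

lemma nr_int {e n : ℕ} {d : ℤ} (he : d = -e) (h : nr e (4 * n) 1000 0 = true) (X Y : ℤ) :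
    X ^ 2 - d * Y ^ 2 ≠ 4 * n := by
  intro h0
  apply nr_spec _ _ h X.natAbs Y.natAbs (Nat.zero_le _)
  zify
  rw [abs_mul_abs_self, abs_mul_abs_self, ← h0, he]
  ring

/-- Check of a generator. -/
def genI (e q X Y : ℕ) : Bool :=
  isP q && !(Nat.beq (X % q) 0) && Nat.beq (X * X + e * (Y * Y)) (4 * q ^ 5)

section
variable {k : Type} [Field k] [NumberField k] {d : ℤ} {δ : k}

lemma genI_spec {e q X Y : ℕ} (he : d = -e) (h : QF k d δ) (hg : genI e q X Y = true) :
    q.Prime ∧ ∃ g : ClassGroup (𝓞 k), Gen q g := by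
  simp only [genI, Bool.and_eq_true, Bool.not_eq_true'] at hg
  obtain ⟨⟨h1, h2⟩, h3⟩ := hg
  have hq := isP_prime h1
  have h3 := Nat.eq_of_beq_eq_true h3
  refine ⟨hq, ?_⟩
  have hX : ¬ (q : ℤ) ∣ X := by
    intro hd
    have : X % q = 0 := Nat.mod_eq_zero_of_dvd (by exact_mod_cast hd)
    rw [this] at h2
    exact absurd h2 (by decide)
  have hN : ((X : ℤ) ^ 2 - d * (Y : ℤ) ^ 2).natAbs = 4 * q ^ 5 := by
    rw [← h3, he]
    zify
    rw [abs_of_nonneg]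
    · ring
    · nlinarith [mul_nonneg (Int.natCast_nonneg e) (sq_nonneg (Y : ℤ)), sq_nonneg (X : ℤ)]
  obtain ⟨g, hg, -⟩ := h.exists_gen hq hX hN
  exact ⟨g, hg⟩

lemma good_comap {q : ℕ} {g : ClassGroup (𝓞 k)} (hg : Gen q g) {S : Subgroup (ClassGroup (𝓞 k))}
    (h : g ∈ S) : Good (S.comap (powMonoidHom 2)) q := by
  apply hg.good
  rw [Subgroup.mem_comap]
  exact S.pow_mem h 2
end

/-- Certificates for imaginary fields. -/
def chkI (e : ℕ) (l : List (ℕ × ℕ × ℕ)) (W B : ℕ) : Bool :=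
  Nat.ble 1 e && match l with
  | [] => checkI e W B 1
  | [(q, X, Y)] => genI e q X Y && nr e (4 * q) 1000 0 && checkI e W B q
  | [(q, X, Y), (r, Z, T)] => genI e q X Y && genI e r Z T && nr e (4 * q) 1000 0 &&
      nr e (4 * r) 1000 0 && nr e (4 * (q * r)) 1000 0 && nr e (4 * (q * (r * r))) 1000 0 &&
      checkI e W B (q * r)
  | _ => false

lemma chkI_spec {e : ℕ} {l : List (ℕ × ℕ × ℕ)} {W B : ℕ} (hc : chkI e l W B = true) :
    QS (-(e : ℤ)) l.length := by
  intro k _ _ δ h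
  have h0 : 1 ≤ e := by
    unfold chkI at hc
    exact Nat.le_of_ble_eq_true (Bool.and_eq_true_iff.mp hc).1
  have hd : (-(e : ℤ)) < 0 := by omega
  match l, hc with
  | [], hc =>
    have hc : (Nat.ble 1 e && checkI e W B 1) = true := hc
    rw [Bool.and_eq_true] at hc
    obtain ⟨-, hc⟩ := hc
    refine ⟨psi (fun i => i.elim0) (fun i => i.elim0), psi_inj_zero _ _, fun c => ?_⟩
    have := checkI_top (S := (psi (fun i : Fin 0 => (i.elim0 : ClassGroup (𝓞 k)))
      (fun i => i.elim0)).range) hc rfl h GG_one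
    have hm : c ∈ (⊤ : Subgroup (ClassGroup (𝓞 k))) := trivial
    rw [← this] at hm
    exact hm
  | [(q, X, Y)], hc =>
    have hc : (Nat.ble 1 e && (genI e q X Y && nr e (4 * q) 1000 0 && checkI e W B q)) = true := hc
    simp only [Bool.and_eq_true] at hc
    obtain ⟨-, ⟨h1, h2⟩, h3⟩ := hc
    obtain ⟨hq, g, hg⟩ := genI_spec rfl h h1
    have hg5 : ∀ i : Fin 1, (fun _ => g : Fin 1 → _) i ^ 5 = 1 := fun i => hg.pow5
    refine ⟨psi (fun _ => g) hg5, psi_inj_one _ _ ?_, fun c => ?_⟩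
    · obtain ⟨Q, -, hQ, -, e1, -⟩ := hg.ex
      rw [← e1]
      exact h.mk0_ne_one hd (nr_int rfl h2) Q hQ
    · have := checkI_top (S := (psi (fun _ => g) hg5).range) h3 rfl h
        (GG_prime hq (good_comap hg (mem_psi (fun _ => g) hg5 0)))
      have hm : c ∈ (⊤ : Subgroup (ClassGroup (𝓞 k))) := trivial
      rw [← this] at hm
      exact hm
  | [(q, X, Y), (r, Z, T)], hc =>
    have hc : (Nat.ble 1 e && (genI e q X Y && genI e r Z T && nr e (4 * q) 1000 0 &&
      nr e (4 * r) 1000 0 && nr e (4 * (q * r)) 1000 0 && nr e (4 * (q * (r * r))) 1000 0 &&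
      checkI e W B (q * r))) = true := hc
    simp only [Bool.and_eq_true] at hc
    obtain ⟨-, ⟨⟨⟨⟨⟨h1, h2⟩, h3⟩, h4⟩, h5⟩, h6⟩, h7⟩ := hc
    obtain ⟨hq, g, hg⟩ := genI_spec rfl h h1
    obtain ⟨hr, f, hf⟩ := genI_spec rfl h h2
    have hgg : ∀ i : Fin 2, Gen ((![q, r] : Fin 2 → ℕ) i) ((![g, f] : Fin 2 → _) i) := by
      intro i
      fin_cases i
      · exact hg
      · exact hf
    refine ⟨psi ![g, f] (fun i => (hgg i).pow5), h.imag_two_inj hd hgg (nr_int rfl h3)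
      (nr_int rfl h4) (nr_int rfl h5) (nr_int rfl h6), fun c => ?_⟩
    have := checkI_top (S := (psi ![g, f] (fun i => (hgg i).pow5)).range) h7 rfl h
        (GG_mul (GG_prime hq (good_comap hg (mem_psi _ (fun i => (hgg i).pow5) 0)))
          (GG_prime hr (good_comap hf (mem_psi _ (fun i => (hgg i).pow5) 1))))
    have hm : c ∈ (⊤ : Subgroup (ClassGroup (𝓞 k))) := trivial
    rw [← this] at hm
    exact hm
  | _ :: _ :: _ :: _, hc =>
    have hc : (Nat.ble 1 e && false) = true := hc
    simp at hc

lemma checkR_spec {d s W : ℕ} (h0 : 0 < d) (hc : checkR d s W 1 = true) : QI d 0 := by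
  intro k _ _ δ h
  refine ⟨psi (fun i => i.elim0) (fun i => i.elim0), psi_inj_zero _ _, fun c => ?_⟩
  rw [checkR_top (H := (psi (fun i : Fin 0 => (i.elim0 : ClassGroup (𝓞 k)))
      (fun i => i.elim0)).range) hc h0 rfl h GG_one]
  trivial

/-- Use explicit relations given by norms. -/
def jl (d : Nat) (l : List (Nat × Nat)) : Nat → Nat :=
  List.rec (fun G => G) (fun t _ ih G =>
    frc (Nat.mul t.1 t.1) fun a => frc (Nat.mul d (Nat.mul t.2 t.2)) fun b =>
    frc (Nat.add (Nat.sub a b) (Nat.sub b a)) fun v =>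
    cnd (Nat.beq (Nat.mod v 4) 0) (frc (upd (Nat.div v 4) G) ih) (ih G)) l

lemma GG_jl {k : Type} [Field k] [NumberField k] {δ : k} {H : Subgroup (ClassGroup (𝓞 k))}
    {d : ℕ} (h : QF k d δ) : ∀ (l : List (ℕ × ℕ)) (G : ℕ), GG H G → GG H (jl d l G) := by
  intro l
  induction l with
  | nil => intro G hG; exact hG
  | cons t l ih =>
    intro G hG
    have e : jl d (t :: l) G = frc (Nat.mul t.1 t.1) fun a =>
      frc (Nat.mul d (Nat.mul t.2 t.2)) fun b =>
      frc (Nat.add (Nat.sub a b) (Nat.sub b a)) fun v =>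
      cnd (Nat.beq (Nat.mod v 4) 0) (frc (upd (Nat.div v 4) G) (jl d l)) (jl d l G) := rfl
    rw [e]
    simp only [frc_eq, cnd_eq]
    split_ifs with h4
    · refine ih _ (GG_upd h ⟨t.1, t.2, ?_⟩ hG)
      have h4 := Nat.eq_of_beq_eq_true h4
      have h5 : ∀ v : ℕ, v % 4 = 0 → 4 * Nat.div v 4 = v := fun v hv =>
        Nat.mul_div_cancel' (Nat.dvd_of_mod_eq_zero hv)
      rw [h5 _ h4]
      have e1 : ((t.1 : ℤ) ^ 2 - (d : ℤ) * (t.2 : ℤ) ^ 2)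
        = ((t.1 * t.1 : ℕ) : ℤ) - ((d * (t.2 * t.2) : ℕ) : ℤ) := by push_cast; ring
      rw [e1]
      change _ = (t.1 * t.1 - d * (t.2 * t.2)) + (d * (t.2 * t.2) - t.1 * t.1)
      generalize t.1 * t.1 = a
      generalize d * (t.2 * t.2) = b
      omega
    · exact ih _ hG

/-- Certificate for a real field with class number five. -/
structure RC where
  (d s : ℕ)
  (xs : List (ℕ × ℕ))
  (q X Y U V r ρ E C t σ F : ℕ)

/-- The check of the certificate. -/
def RC.chk (z : RC) : Bool :=
  Nat.ble 1 z.d && isP z.q && isP z.r && isP z.t && !(Nat.beq (z.X % z.q) 0) &&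
  (Nat.beq (z.X * z.X) (z.d * (z.Y * z.Y) + 4 * z.q ^ 5) ||
    Nat.beq (z.X * z.X + 4 * z.q ^ 5) (z.d * (z.Y * z.Y))) &&
  (Nat.beq (z.U * z.U) (z.d * (z.V * z.V) + 4) ||
    Nat.beq (z.U * z.U + 4) (z.d * (z.V * z.V))) &&
  Nat.beq (z.r % 10) 1 && Nat.beq (z.t % 10) 1 &&
  Nat.beq (z.ρ * z.ρ % z.r) (z.d % z.r) && Nat.beq (z.σ * z.σ % z.t) (z.d % z.t) &&
  Nat.beq (2 * z.E % z.r) ((z.U + z.V * z.ρ) % z.r) &&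
  Nat.beq (2 * z.C % z.r) ((z.X + z.Y * z.ρ) % z.r) &&
  Nat.beq (2 * z.F % z.t) ((z.U + z.V * z.σ) % z.t) &&
  !(Nat.beq (z.C % z.r) 0) && Nat.beq (z.E ^ ((z.r - 1) / 5) % z.r) 1 &&
  !(Nat.beq (z.C ^ ((z.r - 1) / 5) % z.r) 1) && !(Nat.beq (z.F ^ ((z.t - 1) / 5) % z.t) 1) &&
  frc (jl z.d z.xs z.q) (checkR z.d z.s 0)

lemma natAbs_of_or {x y d n : ℕ} (h : x * x = d * (y * y) + n ∨ x * x + n = d * (y * y)) :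
    ((x : ℤ) ^ 2 - (d : ℤ) * (y : ℤ) ^ 2).natAbs = n := by
  rcases h with h | h
  · have : ((x : ℤ) ^ 2 - (d : ℤ) * (y : ℤ) ^ 2) = n := by
      zify at h; linarith
    rw [this]; rfl
  · have : ((x : ℤ) ^ 2 - (d : ℤ) * (y : ℤ) ^ 2) = -n := by
      zify at h; linarith
    rw [this]; simp

lemma zmod_eq {a b r : ℕ} (h : a % r = b % r) : (a : ZMod r) = b :=
  (ZMod.natCast_eq_natCast_iff' a b r).mpr h

lemma zmod_ne_one {a r : ℕ} (hr : 1 < r) (h : a % r ≠ 1) : (a : ZMod r) ≠ 1 := by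
  intro h1
  apply h
  have : (a : ZMod r) = ((1 : ℕ) : ZMod r) := by simpa using h1
  rw [ZMod.natCast_eq_natCast_iff'] at this
  rw [this, Nat.mod_eq_of_lt hr]

lemma RC.spec {z : RC} (hc : z.chk = true) : QI z.d 1 := by
  intro k _ _ δ h
  simp only [RC.chk, Bool.and_eq_true, Bool.or_eq_true, Bool.not_eq_true', Nat.beq_eq,
    ← Bool.not_eq_true] at hc
  obtain ⟨⟨⟨⟨⟨⟨⟨⟨⟨⟨⟨⟨⟨⟨⟨⟨⟨⟨h0, hq⟩, hr⟩, ht⟩, hX⟩, hXY⟩, hUV⟩, hr5⟩, ht5⟩, hρ⟩, hσ⟩, hE⟩, hC⟩, hF⟩,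
    hC0⟩, hE1⟩, hC1⟩, hF1⟩, hR⟩ := hc
  rw [frc_eq] at hR
  have h0 := Nat.le_of_ble_eq_true h0
  have hq := isP_prime hq
  have hr := isP_prime hr
  have ht := isP_prime ht
  obtain ⟨g, hg, c, hc, hg1⟩ := h.exists_gen hq (X := z.X) (Y := z.Y) (by
    intro hd
    exact hX (Nat.mod_eq_zero_of_dvd (by exact_mod_cast hd))) (natAbs_of_or hXY)
  have hne : g ≠ 1 := by
    intro h1
    refine h.real_not_pow (by omega) (U := z.U) (V := z.V) (r := z.r) (s := z.t) (ρ := (z.ρ : ZMod z.r))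
      (σ := (z.σ : ZMod z.t)) (E := (z.E : ZMod z.r)) (C := (z.C : ZMod z.r)) (F := (z.F : ZMod z.t))
      hc (natAbs_of_or hUV) hr ht hr5 ht5 ?_ ?_ ?_ ?_ ?_ ?_ ?_ ?_ ?_ (hg1 h1)
    · have := zmod_eq hρ
      push_cast at this ⊢
      rw [pow_two, this]
    · have := zmod_eq hσ
      push_cast at this ⊢
      rw [pow_two, this]
    · have := zmod_eq hE
      push_cast at this ⊢
      exact this
    · have := zmod_eq hC
      push_cast at this ⊢
      exact this
    · have := zmod_eq hF
      push_cast at this ⊢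
      exact this
    · intro h2
      rw [ZMod.natCast_eq_zero_iff] at h2
      exact hC0 (Nat.mod_eq_zero_of_dvd h2)
    · have : z.E ^ ((z.r - 1) / 5) % z.r = 1 % z.r := by
        rw [hE1, Nat.mod_eq_of_lt hr.one_lt]
      have := zmod_eq this
      push_cast at this
      exact this
    · have := zmod_ne_one hr.one_lt hC1
      push_cast at this
      exact this
    · have := zmod_ne_one ht.one_lt hF1
      push_cast at this
      exact this
  have hg5 : ∀ i : Fin 1, (fun _ => g : Fin 1 → _) i ^ 5 = 1 := fun i => hg.pow5
  refine ⟨psi (fun _ => g) hg5, psi_inj_one _ _ hne, fun c => ?_⟩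
  rw [checkR_top (H := (psi (fun _ => g) hg5).range) hR h0 rfl h
    (GG_jl h z.xs _ (GG_prime hq (hg.good _ (mem_psi (fun _ => g) hg5 0))))]
  trivial

end

section
open NumberField Module

/-- Rank of the odd part of the class group, plus one, from the table. -/
def rk (l : List (ℕ × List (ℕ × ℕ × ℕ) × ℕ × ℕ)) (e : ℕ) : ℕ :=
  List.rec 0 (fun t _ ih => cnd (Nat.beq t.1 e) (Nat.succ t.2.1.length) ih) l

/-- Validity of a table of imaginary fields. -/
def okI (l : List (ℕ × List (ℕ × ℕ × ℕ) × ℕ × ℕ)) : Prop :=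
  ∀ t ∈ l, chkI t.1 t.2.1 t.2.2.1 t.2.2.2 = true

lemma rk_spec {e n : ℕ} : ∀ l, okI l → rk l e = n + 1 → QS (-(e : ℤ)) n := by
  intro l
  induction l with
  | nil => intro _ h; exact absurd h (by change ¬ (0 = n + 1); omega)
  | cons t l ih =>
    intro hl h
    have e1 : rk (t :: l) e = cnd (Nat.beq t.1 e) (Nat.succ t.2.1.length) (rk l e) := rfl
    rw [e1, cnd_eq] at h
    split_ifs at h with h1
    · have h1 := Nat.eq_of_beq_eq_true h1
      have h2 : t.2.1.length = n := Nat.succ_injective h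
      rw [← h1, ← h2]
      exact chkI_spec (hl t List.mem_cons_self)
    · exact ih (fun s hs => hl s (List.mem_cons_of_mem _ hs)) h

/-- Lookup in the table of real fields. -/
def rk1 (l : List RC) (d : ℕ) : Bool := List.rec false (fun t _ ih => cnd (Nat.beq t.d d) true ih) l

lemma rk1_spec {d : ℕ} : ∀ l : List RC, (∀ t ∈ l, t.chk = true) → rk1 l d = true → QI d 1 := by
  intro l
  induction l with
  | nil => intro _ h; exact absurd h (by change ¬ (false = true); decide)
  | cons t l ih =>
    intro hl h
    have e1 : rk1 (t :: l) d = cnd (Nat.beq t.d d) true (rk1 l d) := rfl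
    rw [e1, cnd_eq] at h
    split_ifs at h with h1
    · have h1 := Nat.eq_of_beq_eq_true h1
      rw [← h1]
      exact RC.spec (hl t List.mem_cons_self)
    · exact ih (fun s hs => hl s (List.mem_cons_of_mem _ hs)) h

/-- Rank plus one for the real field. -/
def rkR (lr : List RC) (d s W : ℕ) : ℕ :=
  cnd (Nat.beq W 0) (cnd (rk1 lr d) 2 0) (cnd (checkR d s W 1) 1 0)

lemma rkR_spec {lr : List RC} (hr : ∀ t ∈ lr, t.chk = true) {d s W n : ℕ} (hd : 0 < d)
    (h : rkR lr d s W = n + 1) : QI d n := by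
  simp only [rkR, cnd_eq] at h
  split_ifs at h with h1 h2 h3
  · obtain rfl : n = 1 := by omega
    exact rk1_spec lr hr h2
  · obtain rfl : n = 0 := by omega
    exact checkR_spec hd h3

/-- Total rank check. -/
def tot (n i j r : ℕ) : Bool :=
  Nat.ble 1 i && Nat.ble 1 j && Nat.ble 1 r && Nat.beq (i + j + r) (n + 3)

lemma tot_spec {n i j r : ℕ} (h : tot n i j r = true) :
    ∃ n1 n2 n3, i = n1 + 1 ∧ j = n2 + 1 ∧ r = n3 + 1 ∧ n = n1 + n2 + n3 := by
  simp only [tot, Bool.and_eq_true, Nat.ble_eq, Nat.beq_eq] at h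
  obtain ⟨⟨⟨h1, h2⟩, h3⟩, h4⟩ := h
  exact ⟨i - 1, j - 1, r - 1, by omega, by omega, by omega, by omega⟩

/-- One or a prime. -/
def oneP (x : ℕ) : Bool := Nat.beq x 1 || isP x

lemma rr_prime {x : ℕ} (h : oneP x = true) : (rr (-(x : ℤ))).Prime := by
  rw [oneP, Bool.or_eq_true] at h
  rcases h with h | h
  · obtain rfl := Nat.eq_of_beq_eq_true h
    exact Nat.prime_two
  · have hp := isP_prime h
    rw [rr, if_neg]
    · simpa using hp
    · have := hp.two_le; omega

lemma oneP_sqf {x : ℕ} (h : oneP x = true) : Squarefree x := by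
  rw [oneP, Bool.or_eq_true] at h
  rcases h with h | h
  · obtain rfl := Nat.eq_of_beq_eq_true h
    exact squarefree_one
  · exact (isP_prime h).prime.squarefree

lemma oneP_mul_sqf {x y : ℕ} (h : oneP x = true) (hy : isP y = true) (hxy : x ≠ y) :
    Squarefree (x * y) := by
  rw [Nat.squarefree_mul]
  · exact ⟨oneP_sqf h, (isP_prime hy).prime.squarefree⟩
  · rw [oneP, Bool.or_eq_true] at h
    rcases h with h | h
    · obtain rfl := Nat.eq_of_beq_eq_true h
      exact Nat.coprime_one_left y
    · exact (Nat.coprime_primes (isP_prime h) (isP_prime hy)).mpr hxy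

lemma sqf_int {x : ℕ} (h : Squarefree x) : Squarefree (x : ℤ) := by
  rw [← Int.squarefree_natAbs]; simpa using h
lemma sqf_neg {x : ℕ} (h : Squarefree x) : Squarefree (-(x : ℤ)) := by
  rw [← Int.squarefree_natAbs]; simpa using h

/-- Check of a field of the first family. -/
def row1 (li : List (ℕ × List (ℕ × ℕ × ℕ) × ℕ × ℕ)) (lr : List RC) (n : ℕ)
    (t : ℕ × ℕ × ℕ × ℕ) : Bool :=
  Nat.ble (Nat.succ t.1) t.2.1 && oneP t.1 && isP t.2.1 &&
  decide ((ramR ((t.1 * t.2.1 : ℕ) : ℤ)).natAbs = rr (-(t.1 : ℤ)) * rr (-(t.2.1 : ℤ))) &&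
  decide (Int.gcd (nn (-(t.1 : ℤ))) (nn (-(t.2.1 : ℤ))) = 1) &&
  tot n (rk li t.1) (rk li t.2.1) (rkR lr (Nat.mul t.1 t.2.1) t.2.2.1 t.2.2.2)

/-- Check of a field of the second family. -/
def row2 (li : List (ℕ × List (ℕ × ℕ × ℕ) × ℕ × ℕ)) (lr : List RC) (n : ℕ)
    (t : ℕ × ℕ × ℕ × ℕ) : Bool :=
  !(Nat.beq t.1 t.2.1) && oneP t.1 && isP t.2.1 &&
  decide (ramR (t.2.1 : ℤ) = t.2.1) &&
  decide (nn (-(t.1 : ℤ)) ∣ (rr (-(t.1 : ℤ)) : ℤ) ^ 4) &&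
  frc (rr (-(t.1 : ℤ))) (fun r => cnd (Nat.beq r 2) (Nat.beq (t.2.1 % 8) 5)
    (Nat.beq ((t.2.1 % r) ^ ((r - 1) / 2) % r) (r - 1))) &&
  tot n (rk li t.1) (rk li (Nat.mul t.1 t.2.1)) (rkR lr t.2.1 t.2.2.1 t.2.2.2)

/-- The field of a row. -/
def key1 (t : ℕ × ℕ × ℕ × ℕ) : ℤ × ℤ := (-(t.1 : ℤ), -(t.2.1 : ℤ))
/-- The field of a row. -/
def key2 (t : ℕ × ℕ × ℕ × ℕ) : ℤ × ℤ := (-(t.1 : ℤ), -((t.1 * t.2.1 : ℕ) : ℤ))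

lemma row1_spec {li : List (ℕ × List (ℕ × ℕ × ℕ) × ℕ × ℕ)} {lr : List RC} (hi : okI li)
    (hr : ∀ t ∈ lr, t.chk = true) {n : ℕ} {t : ℕ × ℕ × ℕ × ℕ} (h : row1 li lr n t = true) :
    Res (key1 t).1 (key1 t).2 n ∧ ∃ c g, Par (key1 t).1 (key1 t).2 c g := by
  obtain ⟨x, y, s, W⟩ := t
  simp only [row1, Bool.and_eq_true, Nat.ble_eq, decide_eq_true_eq] at h
  obtain ⟨⟨⟨⟨⟨h1, h2⟩, h3⟩, h4⟩, h5⟩, h6⟩ := h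
  have hy := isP_prime h3
  have hx := (oneP_sqf h2).ne_zero
  have h1 : x < y := h1
  have p : Par (-(x : ℤ)) (-(y : ℤ)) ((x * y : ℕ) : ℤ) 1 := by
    refine ⟨sqf_neg (oneP_sqf h2), sqf_neg hy.prime.squarefree,
      sqf_int (oneP_mul_sqf h2 h3 h1.ne), by omega, by omega, ?_, one_ne_zero, by push_cast; ring⟩
    intro h0
    have h0 : x * y = 1 := by exact_mod_cast h0
    exact hy.one_lt.ne' (Nat.eq_one_of_mul_eq_one_left h0)
  obtain ⟨n1, n2, n3, e1, e2, e3, rfl⟩ := tot_spec h6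
  refine ⟨p.fam1 (rr_prime h2) (rr_prime (by rw [oneP, h3, Bool.or_true])) h4
    (Int.isCoprime_iff_gcd_eq_one.mpr h5) (rk_spec _ hi e1) (rk_spec _ hi e2)
    (rkR_spec hr (Nat.mul_pos (Nat.pos_of_ne_zero hx) hy.pos) e3), _, _, p⟩

lemma row2_spec {li : List (ℕ × List (ℕ × ℕ × ℕ) × ℕ × ℕ)} {lr : List RC} (hi : okI li)
    (hr : ∀ t ∈ lr, t.chk = true) {n : ℕ} {t : ℕ × ℕ × ℕ × ℕ} (h : row2 li lr n t = true) :
    Res (key2 t).1 (key2 t).2 n ∧ ∃ c g, Par (key2 t).1 (key2 t).2 c g := by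
  obtain ⟨x, y, s, W⟩ := t
  simp only [row2, Bool.and_eq_true, decide_eq_true_eq, frc_eq, cnd_eq, Bool.not_eq_true'] at h
  obtain ⟨⟨⟨⟨⟨⟨h1, h2⟩, h3⟩, h4⟩, h5⟩, h7⟩, h6⟩ := h
  have hy := isP_prime h3
  have hx := (oneP_sqf h2).ne_zero
  have h1 : x ≠ y := by
    rintro rfl
    rw [Nat.beq_refl] at h1
    exact absurd h1 (by decide)
  have hrp := rr_prime h2
  have p : Par (-(x : ℤ)) (-((x * y : ℕ) : ℤ)) (y : ℤ) (-(x : ℤ)) := by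
    refine ⟨sqf_neg (oneP_sqf h2), sqf_neg (oneP_mul_sqf h2 h3 h1),
      sqf_int hy.prime.squarefree, ?_, by omega, ?_, by omega, by push_cast; ring⟩
    · have : x * 1 < x * y := Nat.mul_lt_mul_of_pos_left hy.one_lt (Nat.pos_of_ne_zero hx)
      omega
    · have := hy.one_lt; omega
  obtain ⟨n1, n2, n3, e1, e2, e3, rfl⟩ := tot_spec h6
  refine ⟨p.fam2 hrp (by simpa using hy) (by have := hy.pos; omega) h4 h5 ?_ (rk_spec _ hi e1)
    (rk_spec _ hi e2) (rkR_spec hr hy.pos e3), _, _, p⟩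
  split_ifs at h7 with h8
  · right
    have h8 := Nat.eq_of_beq_eq_true h8
    have h7 : y % 8 = 5 := Nat.eq_of_beq_eq_true h7
    exact ⟨h8, by omega⟩
  · left
    have h7 := Nat.eq_of_beq_eq_true h7
    have h9 : rr (-(x : ℤ)) ≠ 2 := by
      intro h0; rw [h0] at h8; exact h8 rfl
    refine ⟨h9, ?_⟩
    generalize rr (-(x : ℤ)) = r at h7 h9 hrp
    have h10 := euler_neg hrp h7
    rintro ⟨z, hz⟩
    have : Fact r.Prime := ⟨hrp⟩
    have hodd : r % 2 = 1 := hrp.eq_two_or_odd.resolve_left h9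
    have : Fact (2 < r) := ⟨by have := hrp.two_le; omega⟩
    have hz' : (y : ZMod r) = z * z := by simpa using hz
    have hz0 : z ≠ 0 := by
      rintro rfl
      rw [hz', mul_zero, zero_pow (by have := hrp.two_le; omega)] at h10
      exact absurd h10.symm (neg_ne_zero.mpr one_ne_zero)
    rw [hz', ← pow_two, ← pow_mul, show 2 * ((r - 1) / 2) = r - 1 by omega,
      ZMod.pow_card_sub_one_eq_one hz0] at h10
    exact ZMod.neg_one_ne_one h10.symm

lemma all_append {α : Type} {f : α → Bool} {l m : List α} (hl : l.all f = true)
    (hm : m.all f = true) : (l ++ m).all f = true := by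
  rw [List.all_append, hl, hm]; rfl

theorem rows_finset {li : List (ℕ × List (ℕ × ℕ × ℕ) × ℕ × ℕ)} {lr : List RC} (hi : okI li)
    (hr : ∀ t ∈ lr, t.chk = true) {n N : ℕ} {l1 l2 : List (ℕ × ℕ × ℕ × ℕ)}
    (h1 : l1.all (row1 li lr n) = true) (h2 : l2.all (row2 li lr n) = true)
    (hl : (l1.map key1 ++ l2.map key2).Nodup) (hN : (l1.map key1 ++ l2.map key2).length = N) :
    ∃ S : Finset (IntermediateField ℚ ℂ), N ≤ S.card ∧
      ∀ K ∈ S, IsNQuadratic 2 K ∧ IsImaginary K ∧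
        Nonempty (ClassGroup (𝓞 K) ≃* (Fin n → Multiplicative (ZMod 5))) := by
  refine exists_finset hl ?_ hN
  intro p hp
  rw [List.mem_append, List.mem_map, List.mem_map] at hp
  rw [List.all_eq_true] at h1 h2
  rcases hp with ⟨t, ht, rfl⟩ | ⟨t, ht, rfl⟩
  · exact row1_spec hi hr (h1 t ht)
  · exact row2_spec hi hr (h2 t ht)

end

section
open NumberField Module

/-- Part of the table of imaginary quadratic fields. -/
def itab0 : List (ℕ × List (ℕ × ℕ × ℕ) × ℕ × ℕ) :=
  [(1, [], 0, 1), (2, [], 0, 1), (3, [], 0, 1),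
   (7, [], 0, 1), (11, [], 0, 2), (19, [], 0, 2),
   (43, [], 0, 4), (47, [(2, 9, 1)], 1, 4), (67, [], 0, 5),
   (74, [(3, 26, 2)], 6, 11), (79, [(2, 7, 1)], 1, 5), (86, [(17, 2382, 8)], 8, 12),
   (103, [(2, 5, 1)], 0, 6), (119, [(2, 3, 1)], 6, 7), (122, [(3, 22, 2)], 3, 14),
   (127, [(2, 1, 1)], 0, 7), (131, [(3, 29, 1)], 6, 7), (143, [(3, 20, 2)], 10, 7),
   (159, [(7, 248, 6)], 5, 8), (163, [], 0, 8), (179, [(3, 16, 2)], 1, 8),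
   (181, [(5, 98, 4)], 14, 17), (197, [(37, 11234, 876)], 11, 18), (218, [(3, 10, 2)], 5, 19),
   (227, [(3, 8, 2)], 3, 10), (235, [], 0, 10)]

lemma itab0_ok : itab0.all (fun t => chkI t.1 t.2.1 t.2.2.1 t.2.2.2) = true := by
  decide +kernel

/-- Part of the table of imaginary quadratic fields. -/
def itab1 : List (ℕ × List (ℕ × ℕ × ℕ) × ℕ × ℕ) :=
  [(303, [(13, 290, 68)], 4, 11), (317, [(53, 38418, 788)], 6, 23), (319, [(5, 86, 4)], 6, 11),
   (346, [(41, 20410, 368)], 24, 24), (347, [(3, 25, 1)], 4, 12), (373, [(13, 480, 58)], 55, 25),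
   (394, [(19, 2010, 122)], 30, 26), (421, [(5, 104, 2)], 20, 27), (443, [(3, 23, 1)], 3, 14),
   (523, [(7, 220, 6)], 30, 15), (538, [(11, 734, 14)], 35, 30), (541, [(5, 62, 4)], 4, 31),
   (571, [(5, 58, 4)], 14, 15), (611, [(3, 19, 1)], 19, 16), (613, [(17, 2350, 16)], 83, 33),
   (619, [(5, 109, 1)], 5, 16), (635, [(11, 783, 7)], 6, 16), (683, [(3, 17, 1)], 0, 17),
   (691, [(5, 38, 4)], 2, 17), (694, [(31, 10698, 10)], 55, 35), (699, [(7, 103, 9)], 22, 17),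
   (709, [(5, 34, 4)], 30, 35), (739, [(5, 26, 4)], 16, 18), (757, [(13, 710, 36)], 98, 36),
   (779, [(5, 6, 4)], 13, 18), (787, [(7, 59, 9)], 19, 18)]

lemma itab1_ok : itab1.all (fun t => chkI t.1 t.2.1 t.2.2.1 t.2.2.2) = true := by
  decide +kernel

/-- Part of the table of imaginary quadratic fields. -/
def itab2 : List (ℕ × List (ℕ × ℕ × ℕ) × ℕ × ℕ) :=
  [(803, [(3, 13, 1)], 13, 18), (853, [(41, 21446, 64)], 30, 38), (877, [(29, 8936, 50)], 73, 39),
   (947, [(3, 5, 1)], 0, 20), (1051, [(5, 107, 1)], 4, 21), (1093, [(13, 262, 36)], 149, 44),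
   (1123, [(7, 239, 3)], 26, 22), (1213, [(13, 288, 34)], 128, 46), (1707, [(7, 76, 6)], 35, 27),
   (1723, [(19, 461, 75)], 60, 27), (1747, [(19, 2808, 34)], 76, 27), (1779, [(19, 2336, 50)], 25, 28),
   (1867, [(7, 4, 6)], 9, 28), (1923, [(7, 244, 2)], 26, 29), (2203, [(7, 255, 1)], 30, 31),
   (2347, [(19, 1317, 59)], 75, 32), (2643, [(19, 3008, 18)], 67, 34), (2683, [(11, 344, 14)], 99, 34),
   (3091, [(5, 97, 1)], 22, 37), (3139, [(23, 2671, 77)], 66, 37), (3147, [(19, 2623, 31)], 82, 37),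
   (3291, [(67, 73487, 7)], 24, 38), (3667, [(7, 185, 3)], 50, 40), (3683, [(13, 1205, 3)], 15, 40),
   (3811, [(7, 228, 2)], 74, 41), (3859, [(19, 2536, 30)], 59, 41)]

lemma itab2_ok : itab2.all (fun t => chkI t.1 t.2.1 t.2.2.1 t.2.2.2) = true := by
  decide +kernel

/-- Part of the table of imaginary quadratic fields. -/
def itab3 : List (ℕ × List (ℕ × ℕ × ℕ) × ℕ × ℕ) :=
  [(4083, [(31, 5969, 139)], 98, 42), (4227, [(7, 251, 1)], 53, 43), (4579, [(5, 89, 1)], 36, 45),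
   (4627, [(11, 727, 5)], 53, 45), (5163, [(31, 6239, 121)], 224, 47), (5667, [(43, 20008, 182)], 14, 50),
   (5803, [(11, 799, 1)], 92, 50), (6259, [(5, 79, 1)], 35, 52), (6403, [(7, 204, 2)], 100, 53),
   (7483, [(37, 15411, 73)], 213, 57), (8227, [(11, 491, 7)], 86, 60), (9307, [(43, 4497, 247)], 237, 64),
   (10483, [(53, 35638, 196)], 257, 68), (12451, [(7, 132, 2), (5, 7, 1)], 101, 74), (13843, [(31, 8523, 55)], 459, 78),
   (15658, [(59, 15086, 410), (19, 2198, 18)], 203, 166), (18922, [(43, 19778, 102), (11, 754, 2)], 447, 183), (33531, [(19, 3011, 5), (13, 974, 4)], 194, 122),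
   (37363, [(23, 4607, 11), (11, 779, 1)], 414, 128), (38602, [(41, 8798, 100), (19, 2918, 6)], 1397, 261), (39947, [(23, 2532, 22), (11, 696, 2)], 324, 133),
   (69811, [(79, 108364, 90), (43, 23256, 26)], 448, 176), (85099, [(29, 6085, 23), (23, 3371, 13)], 522, 194), (116187, [(31, 6473, 25), (19, 2392, 6)], 539, 227),
   (151627, [(53, 27817, 77), (23, 347, 13)], 838, 259)]

lemma itab3_ok : itab3.all (fun t => chkI t.1 t.2.1 t.2.2.1 t.2.2.2) = true := by
  decide +kernel

/-- The table of imaginary quadratic fields. -/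
def itab : List (ℕ × List (ℕ × ℕ × ℕ) × ℕ × ℕ) := itab0 ++ (itab1 ++ (itab2 ++ (itab3)))

lemma itab_ok : okI itab := List.all_eq_true.mp
  (all_append itab0_ok (all_append itab1_ok (all_append itab2_ok (itab3_ok))))

/-- The table of real quadratic fields with class number five. -/
def rtab : List RC :=
  [⟨5241, 72, [(75, 1), (217, 3), (73, 1), (61, 1), (140, 2)], 2, 2389, 33, 10090670, 139384, 241, 105, 177, 35, 11, 4, 4⟩,
   ⟨8049, 89, [(269, 3), (87, 1), (97, 1), (91, 1), (81, 1)], 2, 89, 1, 58768430, 655048, 521, 223, 240, 156, 31, 12, 12⟩,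
   ⟨3997, 63, [(63, 1), (128, 2), (124, 2), (65, 1), (61, 1), (71, 1)], 3, 55, 1, 569, 9, 241, 83, 176, 69, 11, 2, 2⟩,
   ⟨7861, 88, [(89, 1), (91, 1), (176, 2), (77, 1), (269, 3), (97, 1)], 3, 83, 1, 40430, 456, 601, 141, 76, 112, 31, 7, 18⟩,
   ⟨7513, 86, [(91, 1), (87, 1), (176, 2), (73, 1), (81, 1), (253, 3), (69, 1)], 2, 68861597, 794457, 85614334126, 987733512, 311, 7, 310, 248, 41, 16, 24⟩,
   ⟨817, 28, [(29, 1), (27, 1)], 2, 257, 9, 686, 24, 151, 45, 128, 29, 11, 5, 7⟩,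
   ⟨29369, 171, [(149, 1), (354, 2), (332, 2), (129, 1), (181, 1), (197, 1), (165, 1), (133, 1), (505, 3)], 2, 260703173759, 1521254019, 1394655499950, 8138087672, 281, 83, 34, 190, 101, 33, 45⟩,
   ⟨6157, 78, [(79, 1), (77, 1), (73, 1), (61, 1), (71, 1)], 3, 1805, 23, 1177, 15, 31, 9, 5, 14, 61, 22, 52⟩,
   ⟨103541, 321, [(965, 3), (967, 3), (341, 1), (289, 1), (371, 1), (648, 2), (331, 1), (329, 1), (345, 1), (287, 1), (355, 1), (239, 1), (183, 1), (608, 2), (307, 1), (977, 3), (317, 1), (375, 1), (357, 1)], 7, 1948, 6, 499581978645, 1552567841, 11, 3, 1, 4, 31, 1, 28⟩,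
   ⟨83029, 288, [(289, 1), (285, 1), (861, 3), (277, 1), (273, 1), (295, 1), (271, 1), (299, 1), (859, 3), (323, 1), (869, 3), (313, 1), (552, 2), (265, 1), (243, 1), (281, 1), (269, 1), (572, 2), (592, 2)], 3, 24889288222, 86376892, 1452214640988658973, 5039830230846855, 41, 2, 3, 25, 11, 1, 6⟩,
   ⟨76117, 275, [(277, 1), (275, 1), (552, 2), (255, 1), (536, 2), (267, 1), (281, 1), (568, 2), (295, 1), (309, 1), (233, 1), (315, 1), (815, 3)], 3, 291619, 1057, 2317502, 8400, 401, 27, 179, 80, 41, 12, 20⟩,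
   ⟨16637, 128, [(395, 3), (125, 1), (51, 1), (191, 1), (139, 1)], 11, 3323, 25, 129, 1, 431, 82, 321, 316, 11, 4, 6⟩,
   ⟨225713, 475, [(475, 1), (473, 1), (457, 1), (495, 1), (499, 1), (970, 2), (423, 1), (441, 1), (455, 1), (1435, 3), (1429, 3), (1433, 3), (922, 2), (874, 2), (1002, 2), (413, 1), (1405, 3), (892, 2), (393, 1), (449, 1), (523, 1), (543, 1), (1000, 2), (385, 1), (1417, 3), (487, 1), (403, 1), (493, 1), (529, 1), (583, 1), (477, 1), (505, 1), (479, 1)], 2, 5296633733100468116867, 11148633933080899803, 146029350666212594102282798, 307370276311349904711240, 31, 8, 1, 10, 11, 2, 8⟩,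
   ⟨79297, 281, [(287, 1), (265, 1), (845, 3), (837, 3), (275, 1), (303, 1), (841, 3), (315, 1), (237, 1), (271, 1), (853, 3), (245, 1), (307, 1), (251, 1), (554, 2), (261, 1), (600, 2)], 2, 981713836004821112233906314827, 3486233993339175722298833259, 55665824990378240646611133155271568897198, 197678879762445341355680347883415545640, 241, 44, 176, 50, 11, 3, 9⟩,
   ⟨122257, 349, [(1049, 3), (225, 1), (441, 1), (760, 2), (151, 1), (447, 1), (632, 2), (626, 2), (159, 1), (129, 1), (351, 1), (1051, 3), (475, 1), (369, 1), (489, 1), (345, 1), (181, 1), (473, 1), (1133, 3), (303, 1)], 2, 2350715, 6723, 476793247415876050122783337475442480577557210286, 1363619580570085742825765068276423366962071016, 11, 5, 1, 7, 41, 6, 34⟩,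
   ⟨201017, 448, [(1349, 3), (890, 2), (469, 1), (419, 1), (882, 2), (1351, 3), (415, 1), (435, 1), (493, 1), (427, 1), (914, 2), (467, 1), (1363, 3), (1333, 3), (1331, 3), (906, 2), (1327, 3), (886, 2), (918, 2), (874, 2), (872, 2), (473, 1), (413, 1), (537, 1), (892, 2), (365, 1)], 11, 1028428762, 2293812, 858575972048157465567406, 1914971595859673561736, 71, 4, 48, 35, 11, 5, 4⟩,
   ⟨214969, 463, [(1391, 3), (463, 1), (467, 1), (461, 1), (475, 1), (1381, 3), (924, 2), (459, 1), (473, 1), (417, 1), (497, 1), (439, 1), (928, 2), (421, 1), (415, 1), (465, 1), (387, 1), (1393, 3), (521, 1), (441, 1), (405, 1), (485, 1), (525, 1), (908, 2), (483, 1)], 2, 342782746525867845625482305280658928759591, 739317584844754752986621203663036503819, 5428111276141995312092958765746239074007276186729160624123950, 11707409896265108965938829879872561354123299378159657701272, 181, 22, 49, 151, 61, 26, 53⟩,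
   ⟨364697, 603, [(603, 1), (587, 1), (1194, 2), (1222, 2), (613, 1), (1196, 2), (639, 1), (555, 1), (565, 1), (635, 1), (1182, 2), (581, 1), (661, 1), (1158, 2), (473, 1), (605, 1), (1230, 2), (1178, 2), (1236, 2), (1837, 3), (571, 1), (563, 1), (667, 1), (1831, 3), (1224, 2), (1186, 2), (715, 1), (1228, 2), (673, 1), (643, 1), (525, 1)], 2, 13271508748008484041476413209246287, 21976281136719181740864374335299, 5609783913182912134725922273100536843338125928494, 9289236870740262390669302211386966626398301416, 641, 248, 155, 226, 11, 5, 7⟩,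
   ⟨457441, 676, [(2035, 3), (585, 1), (1246, 2), (931, 1), (1474, 2), (1929, 3), (1186, 2), (905, 1), (1502, 2), (941, 1), (1486, 2), (1166, 2), (945, 1), (1923, 3), (1214, 2), (753, 1), (1542, 2), (1190, 2), (951, 1), (1550, 2), (1935, 3), (1194, 2), (1883, 3), (1528, 2), (1849, 3), (2173, 3), (1184, 2), (1885, 3), (675, 1), (1532, 2), (1905, 3), (1859, 3), (1134, 2), (1178, 2), (1809, 3)], 2, 4448698288658211502028158042589891994633405210061136662721127605498409817843521878968349245946489, 6577568947142238636351455466802876998517665002275441402483437126877662681883619027567655302217, 282077468405259210777638610765378366067936511877057607194397590622256378203048118862429813239527598, 417062222808222448425649644842386147092071217496879384278160574170781359923006697559997192906840, 31, 6, 6, 12, 41, 2, 20⟩,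
   ⟨1733761, 1316, [(8128, 6), (4518, 4), (1323, 1), (1345, 1), (3939, 3), (1279, 1), (1361, 1), (1271, 1), (1375, 1), (3963, 3), (1277, 1), (7908, 6), (7900, 6), (1263, 1), (1359, 1), (1265, 1), (2610, 2), (1189, 1), (3965, 3), (1395, 1), (5280, 4), (2594, 2), (1285, 1), (6577, 5), (1245, 1), (2590, 2), (1383, 1), (2670, 2), (2698, 2), (1241, 1), (5282, 4), (2566, 2), (2654, 2), (7894, 6), (1273, 1), (1187, 1), (1125, 1), (5178, 4), (8308, 6), (3983, 3), (3977, 3), (1391, 1), (6567, 5), (2672, 2), (1237, 1), (2600, 2), (1445, 1), (1371, 1), (5246, 4), (1165, 1), (5230, 4), (1191, 1), (3881, 3), (1447, 1), (5286, 4), (2666, 2), (1227, 1), (5226, 4), (1269, 1), (3911, 3), (1357, 1), (1497, 1)], 19, 1201162141925506314438188013575015636, 912235609177896771955188917106210, 69819778618993370859163121983719272953956545944152034365376779743993521175791196835987670521779102637292855675386305681036860924419896324809134029048617752985420929718263519260648454206950363565214430478154896074439954596572019165854455197135643636263916547325976750, 53025387712488666185970804728973652760688329512724532719945676202515549811463889575189664379273957510634445881308491182261778149109031213159231131216203955389366797774495882400696676768686766625737641216985609845482853711079046963069046833945327294002965433334056,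 271, 101, 217, 82, 61, 18, 2⟩,
   ⟨1093, 33, [(29, 1), (31, 1), (27, 1)], 3, 11, 1, 33, 1, 131, 62, 113, 102, 31, 15, 24⟩]

lemma rtab_ok : ∀ t ∈ rtab, t.chk = true :=
  List.all_eq_true.mp (by decide +kernel)

/-- Part of the table of fields. -/
def rows1_1_0 : List (ℕ × ℕ × ℕ × ℕ) :=
  [(1, 47, 13, 3), (1, 103, 20, 4), (1, 127, 22, 7), (1, 131, 22, 4), (1, 179, 26, 8),
   (1, 227, 30, 2), (1, 347, 37, 8), (1, 523, 45, 12), (1, 571, 47, 19), (1, 619, 49, 17),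
   (1, 683, 52, 6), (1, 691, 52, 18), (1, 739, 54, 19), (1, 787, 56, 4), (1, 947, 61, 10),
   (1, 1051, 64, 24), (1, 1123, 67, 15), (1, 1723, 83, 10), (1, 1747, 83, 19), (1, 1867, 86, 10),
   (1, 2203, 93, 21), (1, 2347, 96, 29), (1, 2683, 103, 29), (2, 47, 19, 7), (2, 79, 25, 5),
   (2, 103, 28, 5), (2, 131, 32, 7), (2, 179, 37, 13), (2, 227, 42, 9), (2, 347, 52, 17),
   (2, 443, 59, 24), (2, 523, 64, 13)]

lemma rows1_1_0_ok : rows1_1_0.all (row1 itab rtab 1) = true := by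
  decide +kernel

/-- Part of the table of fields. -/
def rows1_1_1 : List (ℕ × ℕ × ℕ × ℕ) :=
  [(2, 571, 67, 8), (2, 619, 70, 4), (2, 683, 73, 29), (2, 691, 74, 6), (2, 787, 79, 14),
   (2, 947, 87, 29), (2, 1051, 91, 16), (2, 1123, 94, 18), (2, 1723, 117, 35), (2, 1747, 118, 28),
   (2, 1867, 122, 26), (2, 2203, 132, 20), (2, 2347, 137, 29), (2, 2683, 146, 36), (3, 47, 11, 3),
   (3, 79, 15, 2), (3, 103, 17, 4), (3, 127, 19, 4), (3, 131, 19, 9), (3, 179, 23, 4),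
   (3, 227, 26, 11), (3, 347, 32, 17), (3, 443, 36, 17), (3, 523, 39, 18), (3, 571, 41, 10),
   (3, 619, 43, 10), (3, 683, 45, 20), (3, 691, 45, 10), (3, 739, 47, 4), (3, 787, 48, 27),
   (3, 947, 53, 18), (3, 1051, 56, 10)]

lemma rows1_1_1_ok : rows1_1_1.all (row1 itab rtab 1) = true := by
  decide +kernel

/-- Part of the table of fields. -/
def rows1_1_2 : List (ℕ × ℕ × ℕ × ℕ) :=
  [(3, 1123, 58, 28), (3, 1723, 71, 24), (3, 1867, 74, 23), (3, 2203, 81, 45), (3, 2347, 83, 36),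
   (7, 47, 18, 9), (7, 79, 23, 11), (7, 103, 26, 15), (7, 127, 29, 22), (7, 131, 30, 5),
   (7, 179, 35, 2), (7, 227, 39, 7), (7, 443, 55, 6), (7, 523, 60, 13), (7, 619, 65, 13),
   (7, 683, 69, 9), (7, 691, 69, 15), (7, 739, 71, 9), (7, 787, 74, 20), (7, 947, 81, 10),
   (7, 1051, 85, 18), (7, 1723, 109, 33), (7, 1747, 110, 27), (7, 2203, 124, 30), (7, 2347, 128, 32),
   (7, 2683, 137, 40), (11, 47, 22, 6), (11, 79, 29, 5), (11, 103, 33, 2), (11, 127, 37, 3),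
   (11, 131, 37, 18), (11, 179, 44, 36)]

lemma rows1_1_2_ok : rows1_1_2.all (row1 itab rtab 1) = true := by
  decide +kernel

/-- Part of the table of fields. -/
def rows1_1_3 : List (ℕ × ℕ × ℕ × ℕ) :=
  [(11, 227, 49, 14), (11, 347, 61, 26), (11, 443, 69, 40), (11, 523, 75, 9), (11, 571, 79, 25),
   (11, 739, 90, 35), (11, 787, 93, 23), (11, 947, 102, 52), (11, 1051, 107, 49), (11, 1123, 111, 26),
   (11, 1723, 137, 33), (11, 1747, 138, 26), (11, 1867, 143, 38), (11, 2203, 155, 32), (11, 2347, 160, 42),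
   (11, 2683, 171, 35), (19, 43, 28, 0), (19, 47, 29, 3), (19, 79, 38, 11), (19, 127, 49, 9),
   (19, 131, 49, 24), (19, 179, 58, 21), (19, 227, 65, 22), (19, 347, 81, 8), (19, 443, 91, 11),
   (19, 571, 104, 74), (19, 619, 108, 48), (19, 691, 114, 81), (19, 739, 118, 63), (19, 787, 122, 75),
   (19, 947, 134, 20), (19, 1051, 141, 87)]

lemma rows1_1_3_ok : rows1_1_3.all (row1 itab rtab 1) = true := by
  decide +kernel

/-- Part of the table of fields. -/
def rows1_1_4 : List (ℕ × ℕ × ℕ × ℕ) :=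
  [(19, 1747, 182, 82), (19, 2203, 204, 110), (19, 2347, 211, 76), (19, 2683, 225, 87), (43, 79, 58, 15),
   (43, 103, 66, 11), (43, 127, 73, 21), (43, 131, 75, 10), (43, 179, 87, 27), (43, 227, 98, 33),
   (43, 347, 122, 65), (43, 443, 138, 69), (43, 523, 149, 90), (43, 571, 156, 102), (43, 691, 172, 53),
   (43, 739, 178, 118), (43, 787, 183, 86), (43, 947, 201, 54), (43, 1123, 219, 99), (43, 1747, 274, 175),
   (43, 1867, 283, 154), (43, 2203, 307, 139), (43, 2347, 317, 188), (43, 2683, 339, 304), (47, 67, 56, 8),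
   (47, 163, 87, 14), (67, 79, 72, 9), (67, 127, 92, 15), (67, 131, 93, 7), (67, 179, 109, 26),
   (67, 227, 123, 37), (67, 571, 195, 100)]

lemma rows1_1_4_ok : rows1_1_4.all (row1 itab rtab 1) = true := by
  decide +kernel

/-- Part of the table of fields. -/
def rows1_1_5 : List (ℕ × ℕ × ℕ × ℕ) :=
  [(67, 619, 203, 92), (67, 683, 213, 96), (67, 691, 215, 118), (67, 739, 222, 125), (67, 787, 229, 157),
   (67, 947, 251, 91), (67, 1123, 274, 216), (67, 1723, 339, 295), (67, 1747, 342, 225), (67, 1867, 353, 128),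
   (67, 2347, 396, 335), (79, 163, 113, 14), (103, 163, 129, 17), (127, 163, 143, 31), (131, 163, 146, 37),
   (163, 179, 170, 34), (163, 227, 192, 57), (163, 347, 237, 104), (163, 443, 268, 110), (163, 523, 291, 138),
   (163, 571, 305, 157), (163, 619, 317, 164), (163, 691, 335, 216), (163, 739, 347, 214), (163, 787, 358, 226),
   (163, 947, 392, 244), (163, 1051, 413, 301), (163, 1123, 427, 338), (163, 1723, 529, 242), (163, 1747, 533, 467),
   (163, 1867, 551, 458), (163, 2203, 599, 516)]

lemma rows1_1_5_ok : rows1_1_5.all (row1 itab rtab 1) = true := by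
  decide +kernel

/-- Part of the table of fields. -/
def rows1_1_6 : List (ℕ × ℕ × ℕ × ℕ) :=
  [(163, 2347, 618, 627), (163, 2683, 661, 590)]

lemma rows1_1_6_ok : rows1_1_6.all (row1 itab rtab 1) = true := by
  decide +kernel

/-- Part of the table of fields. -/
def rows2_1_0 : List (ℕ × ℕ × ℕ × ℕ) :=
  [(1, 181, 13, 3), (1, 197, 14, 2), (1, 317, 17, 2), (1, 373, 19, 3), (1, 421, 20, 7),
   (1, 541, 23, 4), (1, 613, 24, 4), (1, 709, 26, 9), (1, 757, 27, 7), (1, 853, 29, 2),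
   (1, 877, 29, 4), (1, 1213, 34, 10), (2, 37, 6, 2), (2, 61, 7, 2), (2, 109, 10, 4),
   (2, 173, 13, 1), (2, 197, 14, 2), (2, 269, 16, 3), (3, 53, 7, 1), (3, 101, 10, 2),
   (3, 233, 15, 4), (3, 569, 23, 6), (3, 593, 24, 4), (3, 641, 25, 10), (3, 881, 29, 9),
   (3, 1049, 32, 13), (3, 1097, 33, 2), (3, 1361, 36, 10), (3, 1409, 37, 15), (3, 1721, 41, 11),
   (3, 1889, 43, 16), (7, 17, 4, 2)]

lemma rows2_1_0_ok : rows2_1_0.all (row2 itab rtab 1) = true := by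
  decide +kernel

/-- Part of the table of fields. -/
def rows2_1_1 : List (ℕ × ℕ × ℕ × ℕ) :=
  [(7, 661, 25, 6), (7, 829, 28, 8), (7, 1069, 32, 9), (11, 13, 3, 1), (11, 29, 5, 1),
   (11, 73, 8, 4), (11, 281, 16, 6), (11, 569, 23, 6), (11, 953, 30, 9), (19, 41, 6, 3),
   (19, 193, 13, 4), (19, 241, 15, 6), (19, 337, 18, 6), (19, 433, 20, 7), (43, 2, 2, 1),
   (43, 73, 8, 4), (47, 5, 2, 1)]

lemma rows2_1_1_ok : rows2_1_1.all (row2 itab rtab 1) = true := by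
  decide +kernel

/-- Part of the table of fields. -/
def rows1_2_0 : List (ℕ × ℕ × ℕ × ℕ) :=
  [(1, 12451, 223, 76), (1, 37363, 386, 91), (2, 12451, 315, 36), (2, 37363, 546, 117), (3, 1747, 72, 0),
   (3, 2683, 89, 0), (3, 37363, 334, 145), (7, 571, 63, 0), (7, 1123, 88, 0), (7, 12451, 295, 50),
   (7, 37363, 511, 147), (11, 683, 86, 0), (11, 12451, 370, 138), (11, 37363, 641, 239), (19, 12451, 486, 426),
   (43, 683, 171, 0), (43, 37363, 1267, 1251), (47, 79, 60, 4), (47, 127, 77, 18), (47, 179, 91, 9),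
   (47, 227, 103, 27), (47, 347, 127, 24), (47, 443, 144, 45), (47, 523, 156, 18), (47, 571, 163, 10),
   (47, 619, 170, 24), (47, 683, 179, 48), (47, 691, 180, 29), (47, 739, 186, 14), (47, 787, 192, 23),
   (47, 947, 210, 60), (47, 1123, 229, 44)]

lemma rows1_2_0_ok : rows1_2_0.all (row1 itab rtab 2) = true := by
  decide +kernel

/-- Part of the table of fields. -/
def rows1_2_1 : List (ℕ × ℕ × ℕ × ℕ) :=
  [(47, 1723, 284, 31), (47, 1747, 286, 34), (47, 1867, 296, 58), (47, 2347, 332, 47), (47, 2683, 355, 40),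
   (67, 37363, 1582, 1140), (79, 103, 90, 23), (79, 127, 100, 46), (79, 131, 101, 13), (79, 227, 133, 10),
   (79, 347, 165, 22), (79, 443, 187, 13), (79, 523, 203, 38), (79, 571, 212, 84), (79, 619, 221, 49),
   (79, 683, 232, 24), (79, 691, 233, 33), (79, 739, 241, 65), (79, 787, 249, 50), (79, 947, 273, 27),
   (79, 1123, 297, 39), (79, 1723, 368, 90), (79, 1747, 371, 72), (79, 2203, 417, 60), (79, 2347, 430, 71),
   (103, 127, 114, 56), (103, 131, 116, 13), (103, 179, 135, 13), (103, 227, 152, 20), (103, 347, 189, 17),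
   (103, 443, 213, 31), (103, 523, 232, 86)]

lemma rows1_2_1_ok : rows1_2_1.all (row1 itab rtab 2) = true := by
  decide +kernel

/-- Part of the table of fields. -/
def rows1_2_2 : List (ℕ × ℕ × ℕ × ℕ) :=
  [(103, 571, 242, 38), (103, 619, 252, 46), (103, 691, 266, 49), (103, 787, 284, 78), (103, 947, 312, 33),
   (103, 1051, 329, 41), (103, 1123, 340, 126), (103, 1723, 421, 77), (103, 1747, 424, 125), (103, 1867, 438, 98),
   (103, 2203, 476, 161), (103, 2347, 491, 114), (103, 2683, 525, 79), (127, 179, 150, 12), (127, 227, 169, 13),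
   (127, 347, 209, 26), (127, 443, 237, 43), (127, 523, 257, 76), (127, 683, 294, 31), (127, 739, 306, 76),
   (127, 787, 316, 80), (127, 947, 346, 51), (127, 1051, 365, 60), (127, 1123, 377, 76), (127, 1723, 467, 146),
   (127, 1747, 471, 123), (127, 2203, 528, 100), (127, 2347, 545, 194), (131, 179, 153, 72), (131, 227, 172, 88),
   (131, 443, 240, 116), (131, 571, 273, 115)]

lemma rows1_2_2_ok : rows1_2_2.all (row1 itab rtab 2) = true := by
  decide +kernel

/-- Part of the table of fields. -/
def rows1_2_3 : List (ℕ × ℕ × ℕ × ℕ) :=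
  [(131, 619, 284, 129), (131, 683, 299, 128), (131, 691, 300, 138), (131, 739, 311, 122), (131, 787, 321, 82),
   (131, 947, 352, 173), (131, 1051, 371, 160), (131, 1123, 383, 116), (131, 1747, 478, 82), (131, 1867, 494, 200),
   (131, 2203, 537, 126), (131, 2347, 554, 100), (131, 2683, 592, 140), (163, 12451, 1424, 635), (163, 37363, 2467, 1941),
   (179, 227, 201, 73), (179, 523, 305, 73), (179, 571, 319, 135), (179, 619, 332, 68), (179, 691, 351, 99),
   (179, 739, 363, 147), (179, 947, 411, 230), (179, 1051, 433, 174), (179, 1747, 559, 175), (179, 1867, 578, 122),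
   (179, 2203, 627, 175), (179, 2347, 648, 205), (179, 2683, 693, 142), (227, 347, 280, 131), (227, 443, 317, 137),
   (227, 571, 360, 78), (227, 619, 374, 102)]

lemma rows1_2_3_ok : rows1_2_3.all (row1 itab rtab 2) = true := by
  decide +kernel

/-- Part of the table of fields. -/
def rows1_2_4 : List (ℕ × ℕ × ℕ × ℕ) :=
  [(227, 691, 396, 137), (227, 739, 409, 76), (227, 787, 422, 246), (227, 1051, 488, 137), (227, 1723, 625, 296),
   (227, 1747, 629, 213), (227, 1867, 651, 379), (227, 2203, 707, 390), (227, 2347, 729, 199), (347, 443, 392, 324),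
   (347, 523, 426, 175), (347, 683, 486, 420), (347, 691, 489, 101), (347, 739, 506, 165), (347, 787, 522, 144),
   (347, 1123, 624, 135), (347, 1723, 773, 311), (347, 1747, 778, 274), (347, 1867, 804, 332), (347, 2203, 874, 240),
   (347, 2683, 964, 503), (443, 523, 481, 118), (443, 571, 502, 106), (443, 683, 550, 456), (443, 691, 553, 141),
   (443, 739, 572, 183), (443, 787, 590, 124), (443, 947, 647, 576), (443, 1051, 682, 127), (443, 1123, 705, 262),
   (443, 1723, 873, 319), (443, 1867, 909, 258)]

lemma rows1_2_4_ok : rows1_2_4.all (row1 itab rtab 2) = true := by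
  decide +kernel

/-- Part of the table of fields. -/
def rows1_2_5 : List (ℕ × ℕ × ℕ × ℕ) :=
  [(443, 2203, 987, 313), (443, 2347, 1019, 549), (523, 571, 546, 288), (523, 619, 568, 235), (523, 683, 597, 115),
   (523, 691, 601, 213), (523, 739, 621, 212), (523, 787, 641, 551), (523, 947, 703, 173), (523, 1123, 766, 642),
   (523, 1723, 949, 611), (523, 1747, 955, 521), (523, 1867, 988, 720), (523, 2203, 1073, 776), (523, 2347, 1107, 688),
   (523, 2683, 1184, 850), (571, 619, 594, 356), (571, 691, 628, 430), (571, 787, 670, 265), (571, 1051, 774, 795),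
   (571, 1123, 800, 242), (571, 1723, 991, 582), (571, 1747, 998, 535), (571, 1867, 1032, 503), (571, 2203, 1121, 306),
   (571, 2347, 1157, 425), (571, 2683, 1237, 869), (619, 683, 650, 155), (619, 691, 654, 655), (619, 787, 697, 387),
   (619, 947, 765, 247), (619, 1051, 806, 517)]

lemma rows1_2_5_ok : rows1_2_5.all (row1 itab rtab 2) = true := by
  decide +kernel

/-- Part of the table of fields. -/
def rows1_2_6 : List (ℕ × ℕ × ℕ × ℕ) :=
  [(619, 1723, 1032, 453), (619, 1747, 1039, 398), (619, 2347, 1205, 615), (619, 2683, 1288, 750), (683, 739, 710, 146),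
   (683, 947, 804, 660), (683, 1051, 847, 293), (683, 1123, 875, 349), (683, 1747, 1092, 604), (683, 1867, 1129, 450),
   (683, 2203, 1226, 602), (683, 2347, 1266, 605), (683, 2683, 1353, 590), (691, 787, 737, 435), (691, 947, 808, 178),
   (691, 1051, 852, 652), (691, 1723, 1091, 467), (691, 1747, 1098, 473), (691, 1867, 1135, 805), (691, 2203, 1233, 825),
   (691, 2683, 1361, 529), (739, 787, 762, 371), (739, 947, 836, 277), (739, 1051, 881, 772), (739, 1723, 1128, 765),
   (739, 1747, 1136, 638), (739, 1867, 1174, 613), (739, 2203, 1275, 435), (739, 2347, 1316, 928), (739, 2683, 1408, 958),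
   (787, 1051, 909, 420), (787, 1123, 940, 773)]

lemma rows1_2_6_ok : rows1_2_6.all (row1 itab rtab 2) = true := by
  decide +kernel

/-- Part of the table of fields. -/
def rows1_2_7 : List (ℕ × ℕ × ℕ × ℕ) :=
  [(787, 1747, 1172, 785), (787, 2347, 1359, 1021), (787, 2683, 1453, 1105), (947, 1123, 1031, 379), (947, 1723, 1277, 509),
   (947, 1747, 1286, 596), (947, 2203, 1444, 603), (947, 2347, 1490, 823), (1051, 1123, 1086, 474), (1051, 1723, 1345, 905),
   (1051, 1747, 1355, 738), (1051, 2203, 1521, 744), (1051, 2347, 1570, 751), (1051, 2683, 1679, 1267), (1123, 1723, 1391, 987),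
   (1123, 1867, 1447, 1233), (1123, 2347, 1623, 1148), (1123, 2683, 1735, 1102), (1723, 1747, 1734, 1688), (1723, 1867, 1793, 1366),
   (1723, 2203, 1948, 1422), (1723, 2347, 2010, 1852), (1723, 2683, 2150, 2232), (1747, 1867, 1806, 987), (1747, 2347, 2024, 2267),
   (1747, 2683, 2164, 1815), (1867, 2203, 2028, 1762), (1867, 2347, 2093, 1195), (1867, 2683, 2238, 1799), (2203, 2347, 2273, 1775),
   (2203, 2683, 2431, 1373), (2347, 2683, 2509, 1895)]

lemma rows1_2_7_ok : rows1_2_7.all (row1 itab rtab 2) = true := by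
  decide +kernel

/-- Part of the table of fields. -/
def rows2_2_0 : List (ℕ × ℕ × ℕ × ℕ) :=
  [(1, 1093, 33, 0), (2, 7829, 88, 12), (2, 9461, 97, 20), (2, 19301, 138, 21), (3, 11177, 105, 29),
   (3, 38729, 196, 60), (7, 9973, 99, 10), (7, 12157, 110, 20), (7, 21661, 147, 21), (43, 929, 30, 11),
   (47, 13, 3, 1), (103, 37, 6, 2), (127, 5, 2, 1), (127, 29, 5, 1), (127, 109, 10, 4),
   (227, 17, 4, 2), (227, 41, 6, 3), (347, 2, 2, 1)]

lemma rows2_2_0_ok : rows2_2_0.all (row2 itab rtab 2) = true := by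
  decide +kernel

/-- Part of the table of fields. -/
def rows1_3_0 : List (ℕ × ℕ × ℕ × ℕ) :=
  [(47, 131, 78, 0), (47, 2203, 321, 0), (47, 12451, 764, 83), (47, 37363, 1325, 129), (79, 1051, 288, 0),
   (79, 12451, 991, 277), (79, 37363, 1718, 440), (103, 739, 275, 0), (103, 12451, 1132, 182), (103, 37363, 1961, 372),
   (127, 131, 128, 0), (127, 37363, 2178, 645), (131, 1723, 475, 0), (131, 12451, 1277, 753), (131, 37363, 2212, 493),
   (179, 443, 281, 0), (179, 683, 349, 0), (179, 1123, 448, 0), (179, 12451, 1492, 299), (179, 37363, 2586, 715),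
   (227, 947, 463, 0), (347, 1051, 603, 0), (347, 12451, 2078, 654), (347, 37363, 3600, 1778), (443, 12451, 2348, 535),
   (443, 37363, 4068, 1986), (523, 12451, 2551, 1481), (523, 37363, 4420, 3071), (571, 12451, 2666, 2116), (571, 37363, 4618, 3541),
   (619, 739, 676, 0), (619, 12451, 2776, 2498)]

lemma rows1_3_0_ok : rows1_3_0.all (row1 itab rtab 3) = true := by
  decide +kernel

/-- Part of the table of fields. -/
def rows1_3_1 : List (ℕ × ℕ × ℕ × ℕ) :=
  [(619, 37363, 4809, 1939), (683, 12451, 2916, 645), (691, 12451, 2933, 2536), (739, 37363, 5254, 3178), (787, 2203, 1316, 0),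
   (787, 12451, 3130, 1406), (787, 37363, 5422, 3627), (947, 12451, 3433, 743), (1051, 12451, 3617, 2721), (1051, 37363, 6266, 4497),
   (1123, 12451, 3739, 1679), (1123, 37363, 6477, 3190), (1723, 12451, 4631, 1768), (1723, 37363, 8023, 8707), (1747, 12451, 4663, 1341),
   (1867, 12451, 4821, 3856), (2203, 12451, 5237, 2937), (2203, 37363, 9072, 5797), (2347, 12451, 5405, 1831), (2347, 37363, 9364, 6193),
   (2683, 12451, 5779, 2901), (2683, 37363, 10012, 10711)]

lemma rows1_3_1_ok : rows1_3_1.all (row1 itab rtab 3) = true := by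
  decide +kernel

/-- Part of the table of fields. -/
def rows1_4_0 : List (ℕ × ℕ × ℕ × ℕ) :=
  [(12451, 37363, 21568, 12103)]

lemma rows1_4_0_ok : rows1_4_0.all (row1 itab rtab 4) = true := by
  decide +kernel


end

theorem stmt2 :
    (∃ S : Finset (IntermediateField ℚ ℂ), 243 ≤ S.card ∧
      ∀ K ∈ S, IsNQuadratic 2 K ∧ IsImaginary K ∧
        Nonempty (ClassGroup (𝓞 K) ≃* (Fin 1 → Multiplicative (ZMod 5)))) ∧
    (∃ S : Finset (IntermediateField ℚ ℂ), 274 ≤ S.card ∧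
      ∀ K ∈ S, IsNQuadratic 2 K ∧ IsImaginary K ∧
        Nonempty (ClassGroup (𝓞 K) ≃* (Fin 2 → Multiplicative (ZMod 5)))) ∧
    (∃ S : Finset (IntermediateField ℚ ℂ), 54 ≤ S.card ∧
      ∀ K ∈ S, IsNQuadratic 2 K ∧ IsImaginary K ∧
        Nonempty (ClassGroup (𝓞 K) ≃* (Fin 3 → Multiplicative (ZMod 5)))) ∧
    (∃ S : Finset (IntermediateField ℚ ℂ), 1 ≤ S.card ∧
      ∀ K ∈ S, IsNQuadratic 2 K ∧ IsImaginary K ∧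
        Nonempty (ClassGroup (𝓞 K) ≃* (Fin 4 → Multiplicative (ZMod 5)))) := by
  refine ⟨?_, ?_, ?_, ?_⟩
  · exact rows_finset itab_ok rtab_ok
      (all_append rows1_1_0_ok (all_append rows1_1_1_ok (all_append rows1_1_2_ok (all_append rows1_1_3_ok (all_append rows1_1_4_ok (all_append rows1_1_5_ok (rows1_1_6_ok)))))))
      (all_append rows2_1_0_ok (rows2_1_1_ok))
      (by decide +kernel) (by decide +kernel)
  · exact rows_finset itab_ok rtab_ok
      (all_append rows1_2_0_ok (all_append rows1_2_1_ok (all_append rows1_2_2_ok (all_append rows1_2_3_ok (all_append rows1_2_4_ok (all_append rows1_2_5_ok (all_append rows1_2_6_ok (rows1_2_7_ok))))))))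
      (rows2_2_0_ok)
      (by decide +kernel) (by decide +kernel)
  · exact rows_finset itab_ok rtab_ok
      (all_append rows1_3_0_ok (rows1_3_1_ok))
      (show List.all [] (row2 itab rtab 3) = true from rfl)
      (by decide +kernel) (by decide +kernel)
  · exact rows_finset itab_ok rtab_ok
      (rows1_4_0_ok)
      (show List.all [] (row2 itab rtab 4) = true from rfl)
      (by decide +kernel) (by decide +kernel)
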